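/- Fix N ≥ 1, 1 < p < ∞, 0 < γ < p, λ₊, λ₋ > 0, M > 0, d > 0, set τ := γ/(p−γ), and assume τ < 1. Assume moreover the following Liouville property: every v ∈ C¹(ℝ^N) satisfying ∫_{ℝ^N} |∇v|^{p−2} ∇v·∇φ dx = 0 for all φ ∈ C_c^∞(ℝ^N) (weak p-harmonicity), v(0) = 0, ∇v(0) = 0, and sup_{B_R(0)} |v| ≤ R^{1+τ} for every R ≥ 1, is identically zero. Then there exist ρ₀ ∈ (0, d) and C₂ > 0, depending only on N, p, γ, λ₊, λ₋, M and d, such that: for every open bounded Ω ⊆ ℝ^N, every local minimizer u of J on Ω with sup_Ω |u| ≤ M, every Ω' ⊆ Ω with dist(Ω', ∂Ω) ≥ d, every z ∈ Γ_0(u) ∩ Ω', and every 0 < r < ρ₀, one has sup_{B_r(z)} |u| ≤ C₂ r^{1+τ}. -/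

import Mathlib

open MeasureTheory Metric Set
open scoped InnerProductSpace

/-- The Alt–Phillips potential `F_γ(t) = λ₊ (t₊)^γ + λ₋ (t₋)^γ`. -/
noncomputable def Fgam (γ lp lm : ℝ) (t : ℝ) : ℝ :=
  lp * (max t 0) ^ γ + lm * (max (-t) 0) ^ γ

/-- `u` is a `C¹(Ω)` function with `∫_Ω ‖∇u‖^p < ∞` which is a local minimizer of the
functional with density `‖∇v‖^p/p + F(v)`, with respect to Lipschitz competitors on
balls compactly contained in `Ω` agreeing with `u` on the boundary sphere. -/
def APLocMin (N : ℕ) (p : ℝ) (F : ℝ → ℝ) (Ω : Set (EuclideanSpace ℝ (Fin N)))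
    (u : EuclideanSpace ℝ (Fin N) → ℝ) : Prop :=
  (∀ x ∈ Ω, DifferentiableAt ℝ u x) ∧
  ContinuousOn (fun x => gradient u x) Ω ∧
  IntegrableOn (fun x => ‖gradient u x‖ ^ p) Ω volume ∧
  ∀ (z : EuclideanSpace ℝ (Fin N)) (r : ℝ), 0 < r → closure (Metric.ball z r) ⊆ Ω →
    ∀ (v : EuclideanSpace ℝ (Fin N) → ℝ) (K : NNReal),
      LipschitzOnWith K v (closure (Metric.ball z r)) →
      Set.EqOn v u (Metric.sphere z r) →
      (∫ x in Metric.ball z r, (‖gradient u x‖ ^ p / p + F (u x))) ≤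
        ∫ x in Metric.ball z r, (‖gradient v x‖ ^ p / p + F (v x))

/-- The free boundary `Γ(u) = (∂{u>0} ∪ ∂{u<0}) ∩ Ω`. -/
def apFB (N : ℕ) (Ω : Set (EuclideanSpace ℝ (Fin N)))
    (u : EuclideanSpace ℝ (Fin N) → ℝ) : Set (EuclideanSpace ℝ (Fin N)) :=
  (frontier {x ∈ Ω | 0 < u x} ∪ frontier {x ∈ Ω | u x < 0}) ∩ Ω

/-- The zero-gradient part of the free boundary `Γ₀(u) = Γ(u) ∩ {∇u = 0}`. -/
def apFB0 (N : ℕ) (Ω : Set (EuclideanSpace ℝ (Fin N)))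
    (u : EuclideanSpace ℝ (Fin N) → ℝ) : Set (EuclideanSpace ℝ (Fin N)) :=
  apFB N Ω u ∩ {x | gradient u x = 0}

open scoped Gradient ENNReal NNReal
set_option linter.unusedVariables false
set_option linter.unusedSectionVars false
namespace AP
section
variable {E : Type*} [NormedAddCommGroup E] [InnerProductSpace ℝ E] [FiniteDimensional ℝ E] [MeasurableSpace E] [BorelSpace E] [Nontrivial E]
variable {W f g h u w φ : E → ℝ} {K L Q : ℝ≥0} {B S Z Ω : Set E} {D c e x x0 y z ξ : E} {A R X a b d k l m p q r s t β γ δ ε η ρ σ τ : ℝ} {F : ℝ → ℝ} {Ψ : E → E} {v : ℕ → E → ℝ}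
theorem grad_norm (f : E → ℝ) (x : E) : ‖∇ f x‖ = ‖fderiv ℝ f x‖ := by
  rw [← toDual_gradient (𝕜 := ℝ), LinearIsometryEquiv.norm_map]
theorem grad_norm_le (hf : LipschitzWith K f) (x : E) : ‖∇ f x‖ ≤ K := by
  rw [grad_norm]; exact norm_fderiv_le_of_lipschitz ℝ hf
theorem meas_grad (f : E → ℝ) : Measurable (fun x => ∇ f x) := by
  have : (fun x => ∇ f x) = fun x => (InnerProductSpace.toDual ℝ E).symm (fderiv ℝ f x) := rfl
  rw [this]
  exact (InnerProductSpace.toDual ℝ E).symm.continuous.measurable.comp (measurable_fderiv ℝ f)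
theorem line_le (hf : LipschitzWith K f) (v : E) (x : E) :
    ‖f (x + v) - f x‖ₑ ≤ ∫⁻ t in Ioc (0:ℝ) 1, ‖lineDeriv ℝ f (x + t • v) v‖ₑ := by
  have hg : LipschitzWith (K * ‖v‖₊) (fun t : ℝ => f (x + t • v)) := by
    apply hf.comp
    apply LipschitzWith.of_dist_le_mul
    intro s t
    simp only [dist_eq_norm, add_sub_add_left_eq_sub, ← sub_smul, norm_smul, coe_nnnorm]
    rw [mul_comm]
  have h := (hg.lipschitzOnWith (s := uIcc 0 1)).absolutelyContinuousOnInterval.integral_deriv_eq_sub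
  have hd : ∀ t, deriv (fun t : ℝ => f (x + t • v)) t = lineDeriv ℝ f (x + t • v) v := by
    intro t
    unfold lineDeriv
    have := deriv_comp_const_add (fun t : ℝ => f (x + t • v)) t 0
    rw [add_zero] at this
    rw [← this]
    congr 1; ext s; congr 1; rw [add_smul]; abel
  simp only [hd, one_smul, zero_smul, add_zero] at h
  rw [← h, intervalIntegral.integral_of_le zero_le_one]
  exact enorm_integral_le_lintegral_enorm _
theorem transl_gen (hf : LipschitzWith K f) (v : E) (c : ℝ≥0∞)
    (h : ∀ t ∈ Ioc (0:ℝ) 1, ∫⁻ x in S, ‖lineDeriv ℝ f (x + t • v) v‖ₑ ≤ c) :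
    ∫⁻ x in S, ‖f (x + v) - f x‖ₑ ≤ c := by
  have hlv : Measurable fun y : E => lineDeriv ℝ f y v := measurable_lineDeriv hf.continuous
  calc ∫⁻ x in S, ‖f (x + v) - f x‖ₑ
      ≤ ∫⁻ x in S, ∫⁻ t in Ioc (0:ℝ) 1, ‖lineDeriv ℝ f (x + t • v) v‖ₑ :=
        lintegral_mono fun x => line_le hf v x
    _ = ∫⁻ t in Ioc (0:ℝ) 1, ∫⁻ x in S, ‖lineDeriv ℝ f (x + t • v) v‖ₑ := by
        apply lintegral_lintegral_swap
        apply Measurable.aemeasurable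
        exact (hlv.comp (by fun_prop : Measurable fun q : E × ℝ => q.1 + q.2 • v)).enorm
    _ ≤ ∫⁻ t in Ioc (0:ℝ) 1, c := setLIntegral_mono' measurableSet_Ioc h
    _ = c := by simp
theorem lineDeriv_ae (hf : LipschitzWith K f) (v : E) :
    ∀ᵐ y : E, ‖lineDeriv ℝ f y v‖ₑ ≤ ‖v‖ₑ * ‖∇ f y‖ₑ := by
  filter_upwards [hf.ae_differentiableAt (μ := volume)] with y hy
  rw [hy.lineDeriv_eq_fderiv, ← inner_gradient_left, mul_comm, ← ofReal_norm, ← ofReal_norm (∇ f y),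
    ← ofReal_norm v, ← ENNReal.ofReal_mul (norm_nonneg _)]
  exact ENNReal.ofReal_le_ofReal (norm_inner_le_norm _ _)
theorem transl_le (hf : LipschitzWith K f) (hB : Convex ℝ B)
    (hBo : IsOpen B) (v : E) :
    ∫⁻ x in B ∩ {x | x + v ∈ B}, ‖f (x + v) - f x‖ₑ ≤ ‖v‖ₑ * ∫⁻ x in B, ‖∇ f x‖ₑ := by
  have hmA : MeasurableSet (B ∩ {x | x + v ∈ B}) :=
    hBo.measurableSet.inter ((hBo.preimage (by fun_prop : Continuous fun x => x + v)).measurableSet)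
  apply transl_gen hf v
  intro t ht
  rw [← lintegral_const_mul _ (meas_grad f).enorm]
  refine le_trans ?_ (lintegral_mono_ae (ae_restrict_of_ae (lineDeriv_ae hf v)))
  rw [← lintegral_indicator hmA, ← lintegral_indicator hBo.measurableSet,
    ← lintegral_add_right_eq_self (μ := (volume : Measure E)) (B.indicator _) (t • v)]
  apply lintegral_mono
  intro x
  by_cases hx : x ∈ B ∩ {x | x + v ∈ B}
  · have : x + t • v ∈ B := by
      have := hB hx.1 hx.2 (sub_nonneg.2 ht.2) ht.1.le (by ring)
      convert this using 1
      rw [smul_add, ← add_assoc, ← add_smul]; simp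
    simp only [indicator_of_mem hx, indicator_of_mem this]; exact le_rfl
  · simp only [indicator_of_notMem hx]; exact zero_le
theorem ae_lip (hf : LipschitzWith K f) (hB : Convex ℝ B)
    (hBo : IsOpen B) {ω : ℝ} (hω : 0 ≤ ω) (h : ∀ᵐ x : E, x ∈ B → ‖∇ f x‖ ≤ ω) (hx : x ∈ B) (hy : y ∈ B) :
    |f y - f x| ≤ ω * ‖y - x‖ := by
  set v := y - x with hv
  by_contra! hcon
  have hcont : Continuous fun z => |f (z + v) - f z| := by
    have := hf.continuous; fun_prop
  have hxv : x + v = y := by rw [hv]; abel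
  have ho : IsOpen {z : E | ω * ‖v‖ < |f (z + v) - f z|} := isOpen_lt continuous_const hcont
  set S := ({z : E | ω * ‖v‖ < |f (z + v) - f z|} ∩ (B ∩ {z | z + v ∈ B})) ∩ ball x 1 with hS
  have hSo : IsOpen S := (ho.inter (hBo.inter (hBo.preimage (by fun_prop : Continuous fun x => x + v)))).inter isOpen_ball
  have hxS : x ∈ S := ⟨⟨by simpa [hxv] using hcon, hx, by simpa [hxv] using hy⟩, mem_ball_self one_pos⟩
  have hSpos : 0 < volume S := hSo.measure_pos volume ⟨x, hxS⟩
  have hSfin : volume S ≠ ∞ := (lt_of_le_of_lt (measure_mono inter_subset_right) measure_ball_lt_top).ne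
  have key : ∫⁻ z in S, ‖f (z + v) - f z‖ₑ ≤ ENNReal.ofReal (ω * ‖v‖) * volume S := by
    apply transl_gen hf v
    intro t ht
    have : ∀ᵐ y : E, y ∈ B → ‖lineDeriv ℝ f y v‖ₑ ≤ ENNReal.ofReal (ω * ‖v‖) := by
      filter_upwards [lineDeriv_ae hf v, h] with y hy1 hy2 hyB
      refine hy1.trans ?_
      rw [← ofReal_norm, ← ofReal_norm (∇ f y), ← ENNReal.ofReal_mul (norm_nonneg _), mul_comm]
      exact ENNReal.ofReal_le_ofReal (mul_le_mul_of_nonneg_right (hy2 hyB) (norm_nonneg _))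
    have h2 := (measurePreserving_add_right (volume : Measure E) (t • v)).quasiMeasurePreserving.ae this
    rw [← setLIntegral_const]
    apply lintegral_mono_ae
    refine (ae_restrict_iff' hSo.measurableSet).2 ?_
    filter_upwards [h2] with z hz hzS
    apply hz
    have := hB hzS.1.2.1 hzS.1.2.2 (sub_nonneg.2 ht.2) ht.1.le (by ring)
    convert this using 1
    rw [smul_add, ← add_assoc, ← add_smul]; simp
  have key2 : ENNReal.ofReal (ω * ‖v‖) * volume S < ∫⁻ z in S, ‖f (z + v) - f z‖ₑ := by
    rw [← setLIntegral_const]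
    apply setLIntegral_strict_mono hSo.measurableSet hSpos.ne'
    · have := hf.continuous
      exact (by fun_prop : Continuous fun z => f (z + v) - f z).measurable.enorm
    · simp [ENNReal.mul_eq_top, hSfin]
    · refine Filter.Eventually.of_forall fun z hz => ?_
      rw [← ofReal_norm, ENNReal.ofReal_lt_ofReal_iff_of_nonneg (by positivity)]
      exact hz.1.1
  exact absurd key (not_le.2 key2)
theorem fk_l (hf : LipschitzWith K f) (hSm : MeasurableSet S)
    (h0 : ∀ x, x ∉ S → f x = 0) (hr : 0 < r) :
    (volume (ball (0:E) r) - volume S) * ∫⁻ x, ‖f x‖ₑ ≤ volume (ball (0:E) r) * (ENNReal.ofReal r * ∫⁻ x, ‖∇ f x‖ₑ) := by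
  have h1 : ∫⁻ v in ball (0:E) r, ∫⁻ x, ‖f (x + v) - f x‖ₑ ≤ volume (ball (0:E) r) * (ENNReal.ofReal r * ∫⁻ x, ‖∇ f x‖ₑ) := by
    rw [mul_comm, ← setLIntegral_const]
    apply setLIntegral_mono' measurableSet_ball
    intro v hv
    have := transl_le hf convex_univ isOpen_univ v
    simp only [mem_univ, ofPred_true, inter_univ, Measure.restrict_univ] at this
    refine this.trans (mul_le_mul_left ?_ _)
    rw [← ofReal_norm]; exact ENNReal.ofReal_le_ofReal (by simpa using (mem_ball_zero_iff.1 hv).le)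
  refine le_trans ?_ h1
  have hfc := hf.continuous
  rw [lintegral_lintegral_swap (by
    apply Measurable.aemeasurable
    exact (by fun_prop : Continuous fun q : E × E => f (q.2 + q.1) - f q.2).measurable.enorm),
    ← lintegral_const_mul _ hfc.measurable.enorm]
  apply lintegral_mono
  intro x
  show _ ≤ ∫⁻ v in ball (0:E) r, ‖f (x + v) - f x‖ₑ
  have hmT : MeasurableSet {v : E | x + v ∈ S} := hSm.preimage (by fun_prop : Measurable fun v => x + v)
  calc (volume (ball (0:E) r) - volume S) * ‖f x‖ₑ
      ≤ volume (ball (0:E) r \ {v | x + v ∈ S}) * ‖f x‖ₑ := by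
        refine mul_le_mul_left (le_trans ?_ (le_measure_sdiff)) _
        have : volume {v : E | x + v ∈ S} = volume S := measure_preimage_add volume x S
        rw [this]
    _ = ∫⁻ v in ball (0:E) r \ {v | x + v ∈ S}, ‖f x‖ₑ := by rw [setLIntegral_const, mul_comm]
    _ ≤ ∫⁻ v in ball (0:E) r \ {v | x + v ∈ S}, ‖f (x + v) - f x‖ₑ := by
        apply setLIntegral_mono' (measurableSet_ball.diff hmT)
        intro v hv
        rw [h0 _ hv.2, zero_sub, enorm_neg]
    _ ≤ _ := lintegral_mono_set sdiff_subset
theorem poinc_l (hf : LipschitzWith K f)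
    (hZ : Z ⊆ ball c r) (h0 : ∀ x ∈ Z, f x = 0) :
    volume Z * ∫⁻ x in ball c r, ‖f x‖ₑ ≤ volume (ball (0:E) (2 * r)) * (ENNReal.ofReal (2 * r) * ∫⁻ x in ball c r, ‖∇ f x‖ₑ) := by
  have hfc := hf.continuous
  have hball : MeasurableSet {q : E × E | q.2 + q.1 ∈ ball c r} :=
    (isOpen_ball.preimage (by fun_prop : Continuous fun q : E × E => q.2 + q.1)).measurableSet
  have h1 : ∫⁻ v in ball (0:E) (2 * r), ∫⁻ x in ball c r, {x | x + v ∈ ball c r}.indicator (fun x => ‖f (x + v) - f x‖ₑ) x ≤ volume (ball (0:E) (2 * r)) * (ENNReal.ofReal (2 * r) * ∫⁻ x in ball c r, ‖∇ f x‖ₑ) := by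
    rw [mul_comm (volume _), ← setLIntegral_const]
    apply setLIntegral_mono' measurableSet_ball
    intro v hv
    have := transl_le hf (convex_ball c r) isOpen_ball v
    have hm3 : MeasurableSet {x : E | x + v ∈ ball c r} :=
      (isOpen_ball.preimage (by fun_prop : Continuous fun x => x + v)).measurableSet
    rw [setLIntegral_indicator hm3, inter_comm]
    refine this.trans (mul_le_mul_left ?_ _)
    rw [← ofReal_norm]; exact ENNReal.ofReal_le_ofReal (by simpa using (mem_ball_zero_iff.1 hv).le)
  refine le_trans ?_ h1
  rw [lintegral_lintegral_swap (by
    apply Measurable.aemeasurable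
    exact Measurable.indicator (f := fun q : E × E => ‖f (q.2 + q.1) - f q.2‖ₑ)
      ((by fun_prop : Continuous fun q : E × E => f (q.2 + q.1) - f q.2).measurable.enorm) hball),
    ← lintegral_const_mul _ hfc.measurable.enorm]
  apply setLIntegral_mono' measurableSet_ball
  intro x hx
  have e : ∀ v : E, {x | x + v ∈ ball c r}.indicator (fun x => ‖f (x + v) - f x‖ₑ) x =
    {v | x + v ∈ ball c r}.indicator (fun v => ‖f (x + v) - f x‖ₑ) v := fun v => rfl
  simp only [e]
  have hm2 : MeasurableSet {v : E | x + v ∈ ball c r} :=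
    (isOpen_ball.preimage (by fun_prop : Continuous fun v => x + v)).measurableSet
  rw [setLIntegral_indicator hm2]
  calc volume Z * ‖f x‖ₑ = volume {v : E | x + v ∈ Z} * ‖f x‖ₑ := by
        congr 1; exact (measure_preimage_add volume x Z).symm
    _ = ∫⁻ v in {v : E | x + v ∈ Z}, ‖f x‖ₑ := by rw [setLIntegral_const, mul_comm]
    _ ≤ ∫⁻ v in {v : E | x + v ∈ Z}, ‖f (x + v) - f x‖ₑ := by
        apply setLIntegral_mono ((by fun_prop : Continuous fun v => f (x + v) - f x).measurable.enorm)
        intro v hv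
        rw [h0 _ hv, zero_sub, enorm_neg]
    _ ≤ _ := by
        apply lintegral_mono_set
        intro v hv
        refine ⟨hZ hv, ?_⟩
        have h3 := mem_ball.1 (hZ hv)
        have h4 := mem_ball.1 hx
        rw [mem_ball_zero_iff]
        calc ‖v‖ = dist (x + v) x := by simp [dist_eq_norm]
          _ ≤ dist (x + v) c + dist x c := dist_triangle_right _ _ _
          _ < _ := by linarith
theorem intOn_of_bdd {F : Type*} [NormedAddCommGroup F] {g : E → F} (hSm : MeasurableSet S)
    (hS : volume S ≠ ∞) (hg : AEStronglyMeasurable g volume) (C : ℝ) (hC : ∀ x ∈ S, ‖g x‖ ≤ C) : IntegrableOn g S :=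
  Measure.integrableOn_of_bounded hS hg (M := C) ((ae_restrict_iff' hSm).2 (Filter.Eventually.of_forall hC))
theorem fk (hf : LipschitzWith K f) (hSm : MeasurableSet S) (hSf : volume S ≠ ∞)
    (h0 : ∀ x, x ∉ S → f x = 0) (hi : Integrable f) (hgi : Integrable (fun x => ∇ f x)) (hr : 0 < r)
    (hS : 2 * volume.real S ≤ volume.real (ball (0:E) r)) :
    ∫ x, |f x| ≤ 2 * r * ∫ x, ‖∇ f x‖ := by
  have h := fk_l hf hSm h0 hr
  have hbf : volume (ball (0:E) r) ≠ ∞ := measure_ball_lt_top.ne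
  have hbp : 0 < volume (ball (0:E) r) := measure_ball_pos _ _ hr
  rw [← ofReal_integral_norm_eq_lintegral_enorm hi, ← ofReal_integral_norm_eq_lintegral_enorm hgi,
    ← ofReal_measureReal hbf, ← ofReal_measureReal hSf, ← ENNReal.ofReal_sub _ measureReal_nonneg,
    ← ENNReal.ofReal_mul hr.le, ← ENNReal.ofReal_mul measureReal_nonneg,
    ← ENNReal.ofReal_mul (by linarith [measureReal_nonneg (μ := volume) (s := S)]), ENNReal.ofReal_le_ofReal_iff (by positivity)] at h
  have hb : 0 < volume.real (ball (0:E) r) := ENNReal.toReal_pos hbp.ne' hbf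
  simp only [Real.norm_eq_abs] at h
  have h2 : volume.real (ball (0:E) r) / 2 * ∫ x, |f x| ≤ (volume.real (ball (0:E) r) - volume.real S) * ∫ x, |f x| :=
    mul_le_mul_of_nonneg_right (by linarith) (by positivity)
  have h3 := h2.trans h
  nlinarith
theorem poinc (hf : LipschitzWith K f) (hr : 0 < r)
    (hZ : Z ⊆ ball c r) (h0 : ∀ x ∈ Z, f x = 0) :
    volume.real Z * ∫ x in ball c r, |f x| ≤ volume.real (ball (0:E) (2 * r)) * (2 * r * ∫ x in ball c r, ‖∇ f x‖) := by
  have h := poinc_l hf hZ h0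
  have hbf : volume (ball (0:E) (2 * r)) ≠ ∞ := measure_ball_lt_top.ne
  have hZf : volume Z ≠ ∞ := (lt_of_le_of_lt (measure_mono hZ) measure_ball_lt_top).ne
  have hi : IntegrableOn f (ball c r) := by
    refine (hf.continuous.continuousOn.integrableOn_compact (isCompact_closedBall c r)).mono_set ball_subset_closedBall
  have hgi : IntegrableOn (fun x => ∇ f x) (ball c r) :=
    intOn_of_bdd measurableSet_ball measure_ball_lt_top.ne (meas_grad f).aestronglyMeasurable K (fun x _ => grad_norm_le hf x)
  rw [← ofReal_integral_norm_eq_lintegral_enorm hi, ← ofReal_integral_norm_eq_lintegral_enorm hgi,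
    ← ofReal_measureReal hbf, ← ofReal_measureReal hZf,
    ← ENNReal.ofReal_mul (by positivity : 0 ≤ 2 * r), ← ENNReal.ofReal_mul measureReal_nonneg,
    ← ENNReal.ofReal_mul measureReal_nonneg, ENNReal.ofReal_le_ofReal_iff (by positivity)] at h
  simpa using h
theorem grad_congr (h : f =ᶠ[nhds x] g) : ∇ f x = ∇ g x := h.gradient_eq
theorem grad_eq_zero_of_min (h : ∀ y, f x ≤ f y) : ∇ f x = 0 := by
  have h1 : IsLocalMin f x := Filter.Eventually.of_forall h
  rw [← norm_eq_zero, grad_norm, h1.fderiv_eq_zero, norm_zero]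
theorem grad_eq_zero_of_max (h : ∀ y, f y ≤ f x) : ∇ f x = 0 := by
  have h1 : IsLocalMax f x := Filter.Eventually.of_forall h
  rw [← norm_eq_zero, grad_norm, h1.fderiv_eq_zero, norm_zero]
theorem grad_sub_const (f : E → ℝ) (k : ℝ) (x : E) : ∇ (fun y => f y - k) x = ∇ f x := by
  unfold gradient; rw [fderiv_sub_const]
open Classical in
theorem grad_trunc (hW : Continuous W) {H : ℝ} (hH : 0 < H) (x : E) :
    ∇ (fun y => min (max (W y - k) 0) H) x = if k < W x ∧ W x < k + H then ∇ W x else 0 := by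
  split_ifs with h
  · rw [← grad_sub_const W k x]
    apply grad_congr
    filter_upwards [(isOpen_lt continuous_const hW).mem_nhds h.1, (isOpen_lt hW continuous_const).mem_nhds h.2] with y hy1 hy2
    rw [max_eq_left (by have h : k < W y := hy1; linarith), min_eq_left (by have h : W y < k + H := hy2; linarith)]
  · by_cases h1 : k < W x
    · have h2 : k + H ≤ W x := by by_contra! h3; exact h ⟨h1, h3⟩
      apply grad_eq_zero_of_max
      intro y
      rw [max_eq_left (by linarith : (0:ℝ) ≤ W x - k), min_eq_right (by linarith : H ≤ W x - k)]
      exact min_le_right _ _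
    · apply grad_eq_zero_of_min
      intro y
      rw [max_eq_right (by linarith : W x - k ≤ 0), min_eq_left hH.le]
      exact le_min (le_max_right _ _) hH.le
open Classical in
theorem grad_pos (hW : Continuous W) (x : E) :
    ∇ (fun y => max (W y - k) 0) x = if k < W x then ∇ W x else 0 := by
  split_ifs with h
  · rw [← grad_sub_const W k x]
    apply grad_congr
    filter_upwards [(isOpen_lt continuous_const hW).mem_nhds h] with y hy1
    rw [max_eq_left (by have h : k < W y := hy1; linarith)]
  · apply grad_eq_zero_of_min
    intro y
    rw [max_eq_right (by linarith : W x - k ≤ 0)]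
    exact le_max_right _ _
noncomputable def cut (c : E) (r s : ℝ) (x : E) : ℝ := max 0 (min 1 ((s - dist x c) / (s - r)))
theorem cut_nonneg (c : E) (r s : ℝ) (x : E) : 0 ≤ cut c r s x := le_max_left _ _
theorem cut_le_one (c : E) (r s : ℝ) (x : E) : cut c r s x ≤ 1 := max_le zero_le_one (min_le_left _ _)
theorem cut_one (h : r < s) (hx : dist x c ≤ r) : cut c r s x = 1 := by
  unfold cut
  rw [min_eq_left, max_eq_right zero_le_one]
  rw [le_div_iff₀ (by linarith)]; linarith
theorem cut_zero (h : r < s) (hx : s ≤ dist x c) : cut c r s x = 0 := by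
  unfold cut
  apply max_eq_left
  refine (min_le_right _ _).trans (div_nonpos_of_nonpos_of_nonneg (by linarith) (by linarith))
theorem cut_lip (c : E) (h : r < s) : LipschitzWith (Real.toNNReal (1 / (s - r))) (cut c r s) := by
  have h1 : LipschitzWith (Real.toNNReal (1 / (s - r))) (fun x : E => (s - dist x c) / (s - r)) := by
    apply LipschitzWith.of_dist_le_mul
    intro x y
    have hp : 0 < s - r := by linarith
    rw [Real.coe_toNNReal _ (by positivity), Real.dist_eq, ← sub_div, abs_div, abs_of_pos hp, div_mul_eq_mul_div, one_mul]
    gcongr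
    have := abs_dist_sub_le x y c
    rw [abs_sub_comm]; simpa using this
  exact (h1.const_min 1).const_max 0
theorem cut_grad (c : E) (h : r < s) (x : E) : ‖∇ (cut c r s) x‖ ≤ 1 / (s - r) := by
  have := grad_norm_le (cut_lip c h) x
  rwa [Real.coe_toNNReal _ (by have : 0 < s - r := by linarith
                               positivity)] at this
theorem cs_int (hSm : MeasurableSet S) (hS : volume S ≠ ∞) (hg : IntegrableOn g S)
    (hg2 : IntegrableOn (fun x => g x ^ 2) S) : (∫ x in S, g x) ^ 2 ≤ volume.real S * ∫ x in S, g x ^ 2 := by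
  rcases eq_or_lt_of_le (measureReal_nonneg (μ := volume) (s := S)) with h | h
  · have : volume S = 0 := by
      rwa [eq_comm, measureReal_eq_zero_iff hS] at h
    rw [setIntegral_measure_zero _ this, setIntegral_measure_zero _ this]; simp
  · set I := ∫ x in S, g x with hI
    have hc : IntegrableOn (fun _ : E => I ^ 2) S := integrableOn_const hS
    have h1 : 0 ≤ ∫ x in S, (volume.real S * g x - I) ^ 2 := integral_nonneg fun x => sq_nonneg _
    have h2 : ∫ x in S, (volume.real S * g x - I) ^ 2 =
        volume.real S ^ 2 * (∫ x in S, g x ^ 2) - 2 * volume.real S * I * I + volume.real S * I ^ 2 := by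
      have e : ∀ x, (volume.real S * g x - I) ^ 2 = volume.real S ^ 2 * g x ^ 2 - 2 * volume.real S * I * g x + I ^ 2 := by
        intro x; ring
      simp_rw [e]
      have hi : IntegrableOn (fun x => volume.real S ^ 2 * g x ^ 2 - 2 * volume.real S * I * g x) S :=
        (hg2.const_mul _).sub (hg.const_mul _)
      rw [integral_add hi hc,
        integral_sub (hg2.const_mul _) (hg.const_mul _), integral_const_mul, integral_const_mul, setIntegral_const, smul_eq_mul]
    rw [h2] at h1
    have : 0 ≤ volume.real S * (volume.real S * (∫ x in S, g x ^ 2) - I ^ 2) := by nlinarith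
    have := nonneg_of_mul_nonneg_right this h
    linarith
theorem vol_ball (c : E) (hr : 0 ≤ r) :
    volume.real (ball c r) = r ^ Module.finrank ℝ E * volume.real (ball (0:E) 1) := by
  unfold Measure.real
  rw [Measure.addHaar_ball _ _ hr, ENNReal.toReal_mul, ENNReal.toReal_ofReal (by positivity)]
theorem vol_ball_pos (c : E) (hr : 0 < r) : 0 < volume.real (ball c r) :=
  ENNReal.toReal_pos (measure_ball_pos _ _ hr).ne' measure_ball_lt_top.ne
def DG (W : E → ℝ) (c : E) (ρ k0 k1 : ℝ) (G : ℝ → ℝ) : Prop :=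
  ∀ k, k0 ≤ k → k < k1 → ∀ r s, 0 < r → r < s → s ≤ ρ →
    ∫ x in ball c r ∩ {x | k < W x}, ‖∇ W x‖ ^ 2 ≤ (G k / (s - r)) ^ 2 * volume.real (ball c s ∩ {x | k < W x})
theorem grad_mul_le (hf : LipschitzWith K f) (hg : LipschitzWith L g) :
    ∀ᵐ x : E, ∇ (fun y => f y * g y) x = f x • ∇ g x + g x • ∇ f x := by
  filter_upwards [hf.ae_differentiableAt (μ := volume), hg.ae_differentiableAt (μ := volume)] with x h1 h2
  have := (h1.hasGradientAt.hasFDerivAt.mul h2.hasGradientAt.hasFDerivAt)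
  apply HasGradientAt.gradient
  rw [hasGradientAt_iff_hasFDerivAt]
  rw [map_add, map_smul, map_smul]
  exact this
theorem lip_mul_bdd (hf : LipschitzWith K f) (hg : LipschitzWith L g) (A B : ℝ≥0)
    (hA : ∀ x, |f x| ≤ A) (hB : ∀ x, |g x| ≤ B) : LipschitzWith (A * L + B * K) (fun x => f x * g x) := by
  apply LipschitzWith.of_dist_le_mul
  intro x y
  have h1 := hf.dist_le_mul x y
  have h2 := hg.dist_le_mul x y
  rw [Real.dist_eq] at *
  have e : f x * g x - f y * g y = f x * (g x - g y) + g y * (f x - f y) := by ring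
  rw [e]
  refine (abs_add_le _ _).trans ?_
  rw [abs_mul, abs_mul]; push_cast
  have := mul_le_mul (hA x) h2 (abs_nonneg _) A.2
  have := mul_le_mul (hB y) h1 (abs_nonneg _) B.2
  nlinarith
theorem dg_step (hW : LipschitzWith K W) {G x : ℝ}
    (hkl : k < l) (hr : 0 < r) (hrs : r < s) (hx : 0 < x) (hρ : 0 < ρ) (hG : 0 ≤ G)
    (hdg : ∀ r' s', 0 < r' → r' < s' → s' ≤ s →
      ∫ x in ball c r' ∩ {x | k < W x}, ‖∇ W x‖ ^ 2 ≤ (G / (s' - r')) ^ 2 * volume.real (ball c s' ∩ {x | k < W x}))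
    (hA : 2 * volume.real (ball c s ∩ {x | k < W x}) ≤ x ^ Module.finrank ℝ E * volume.real (ball (0:E) ρ)) :
    (l - k) * volume.real (ball c r ∩ {x | l < W x}) ≤
      4 * x * ρ * (G + (l - k)) / (s - r) * volume.real (ball c s ∩ {x | k < W x}) := by
  set m := (r + s) / 2 with hm
  have hrm : r < m := by rw [hm]; linarith
  have hms : m < s := by rw [hm]; linarith
  have hWc := hW.continuous
  have hmk : ∀ k t, MeasurableSet (ball c t ∩ {x | k < W x}) := fun k t =>
    measurableSet_ball.inter (isOpen_lt continuous_const hWc).measurableSet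
  have hfin : ∀ k t, volume (ball c t ∩ {x | k < W x}) ≠ ∞ := fun k t =>
    (lt_of_le_of_lt (measure_mono inter_subset_left) measure_ball_lt_top).ne
  set T : E → ℝ := fun y => min (max (W y - k) 0) (l - k) with hT
  have hTl : LipschitzWith K T := by
    have h1 : LipschitzWith K (fun y => W y - k) := by
      apply LipschitzWith.of_dist_le_mul; intro x y
      have := hW.dist_le_mul x y
      simpa [Real.dist_eq] using this
    exact (h1.max_const 0).min_const _
  have hT0 : ∀ y, 0 ≤ T y := fun y => le_min (le_max_right _ _) (by linarith)
  have hT1 : ∀ y, T y ≤ l - k := fun y => min_le_right _ _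
  set f : E → ℝ := fun y => cut c r m y * T y with hf
  have hlk : 0 < l - k := by linarith
  have hfl : LipschitzWith _ f := lip_mul_bdd (cut_lip c hrm) hTl 1 (Real.toNNReal (l - k))
    (fun y => by rw [abs_of_nonneg (cut_nonneg _ _ _ _)]; exact cut_le_one _ _ _ _)
    (fun y => by rw [abs_of_nonneg (hT0 y), Real.coe_toNNReal _ hlk.le]; exact hT1 y)
  set S := ball c m ∩ {x | k < W x} with hS
  set A := ball c s ∩ {x | k < W x} with hAdef
  have hSA : S ⊆ A := inter_subset_inter_left _ (ball_subset_ball hms.le)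
  have hSAr : volume.real S ≤ volume.real A := measureReal_mono hSA (hfin _ _)
  have hf0 : ∀ y, y ∉ S → f y = 0 := by
    intro y hy
    by_cases h : y ∈ ball c m
    · have : W y ≤ k := by by_contra! h2; exact hy ⟨h, h2⟩
      simp only [hf, hT]
      rw [max_eq_right (by linarith : W y - k ≤ 0), min_eq_left hlk.le, mul_zero]
    · simp only [hf]; rw [cut_zero hrm (by simpa using h), zero_mul]
  have hgl : ∀ᵐ y : E, ‖∇ f y‖ ≤ S.indicator (fun y => ‖∇ W y‖ + (l - k) / (m - r)) y := by
    filter_upwards [grad_mul_le (cut_lip c hrm) hTl] with y hy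
    by_cases hyS : y ∈ S
    · rw [indicator_of_mem hyS, hy]
      refine (norm_add_le _ _).trans ?_
      rw [norm_smul, norm_smul, Real.norm_of_nonneg (cut_nonneg _ _ _ _), Real.norm_of_nonneg (hT0 y)]
      have h1 : ‖∇ T y‖ ≤ ‖∇ W y‖ := by
        rw [hT, grad_trunc hWc hlk]; split_ifs <;> simp
      have h2 := cut_grad c hrm y
      have h3 := mul_le_mul (cut_le_one c r m y) h1 (norm_nonneg _) zero_le_one
      have h4 := mul_le_mul (hT1 y) h2 (norm_nonneg _) hlk.le
      rw [one_mul] at h3; rw [mul_one_div] at h4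
      exact add_le_add h3 h4
    · rw [indicator_of_notMem hyS]
      have : ∇ f y = 0 := by
        apply grad_eq_zero_of_min
        intro z; rw [hf0 y hyS]; exact mul_nonneg (cut_nonneg _ _ _ _) (hT0 z)
      rw [this, norm_zero]
  have hWi : IntegrableOn (fun y => ‖∇ W y‖) S := intOn_of_bdd (hmk _ _) (hfin _ _)
    (meas_grad W).norm.aestronglyMeasurable K (fun x _ => by rw [norm_norm]; exact grad_norm_le hW x)
  have hWi2 : IntegrableOn (fun y => ‖∇ W y‖ ^ 2) S := intOn_of_bdd (hmk _ _) (hfin _ _)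
    ((meas_grad W).norm.pow_const 2).aestronglyMeasurable (K ^ 2) (fun x _ => by
      rw [norm_pow, norm_norm]; exact pow_le_pow_left₀ (norm_nonneg _) (grad_norm_le hW x) 2)
  have hci : IntegrableOn (fun y : E => (l - k) / (m - r)) S := integrableOn_const (hfin _ _)
  have hind : Integrable (S.indicator (fun y => ‖∇ W y‖ + (l - k) / (m - r))) :=
    (hWi.add hci).integrable_indicator (hmk _ _)
  have hgi : Integrable (fun x => ∇ f x) := hind.mono' (meas_grad f).aestronglyMeasurable hgl
  have hfi : Integrable f := by
    have : IntegrableOn f S := (hfl.continuous.continuousOn.integrableOn_compact (isCompact_closedBall c m)).mono_set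
      (inter_subset_left.trans ball_subset_closedBall)
    rw [← integrable_indicator_iff (hmk _ _)] at this
    have e : S.indicator f = f := by
      rw [indicator_eq_self]; intro y hy; by_contra h; exact hy (hf0 y h)
    rwa [e] at this
  have hfk := fk hfl (hmk k m) (hfin k m) hf0 hfi hgi (r := x * ρ) (by positivity) (by
    refine le_trans ?_ (hA.trans (le_of_eq ?_))
    · linarith
    · rw [vol_ball _ (by positivity : 0 ≤ x * ρ), vol_ball (0:E) hρ.le, mul_pow]; ring)
  have hgrad : ∫ x, ‖∇ f x‖ ≤ (G / (s - m) + (l - k) / (m - r)) * volume.real A := by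
    calc ∫ x, ‖∇ f x‖ ≤ ∫ y, S.indicator (fun y => ‖∇ W y‖ + (l - k) / (m - r)) y := integral_mono_ae hgi.norm hind hgl
      _ = (∫ y in S, ‖∇ W y‖) + (l - k) / (m - r) * volume.real S := by
        rw [integral_indicator (hmk _ _), integral_add hWi hci, setIntegral_const, smul_eq_mul, mul_comm (volume.real S)]
      _ ≤ _ := by
        rw [add_mul]
        have hmr : 0 < m - r := by linarith
        have hsm : 0 < s - m := by linarith
        refine add_le_add ?_ (mul_le_mul_of_nonneg_left hSAr (by positivity))
        refine (sq_le_sq₀ (integral_nonneg fun _ => norm_nonneg _) (by positivity)).1 ?_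
        calc (∫ y in S, ‖∇ W y‖) ^ 2 ≤ volume.real S * ∫ y in S, ‖∇ W y‖ ^ 2 := cs_int (hmk _ _) (hfin _ _) hWi hWi2
          _ ≤ volume.real A * ((G / (s - m)) ^ 2 * volume.real A) :=
            mul_le_mul hSAr (hdg m s (by linarith) hms le_rfl) (integral_nonneg fun _ => by positivity) measureReal_nonneg
          _ = _ := by ring
  have hlow : (l - k) * volume.real (ball c r ∩ {x | l < W x}) ≤ ∫ y, |f y| := by
    calc (l - k) * volume.real (ball c r ∩ {x | l < W x}) = ∫ y in ball c r ∩ {x | l < W x}, (l - k) := by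
          rw [setIntegral_const, smul_eq_mul, mul_comm]
      _ ≤ ∫ y in ball c r ∩ {x | l < W x}, |f y| := by
          apply setIntegral_mono_on (integrableOn_const (hfin _ _)) hfi.abs.integrableOn (hmk _ _)
          intro y hy
          have h2 : l < W y := hy.2
          simp only [hf, hT]
          rw [cut_one hrm (mem_ball.1 hy.1).le, one_mul, max_eq_left (by linarith), min_eq_right (by linarith), abs_of_pos hlk]
      _ ≤ ∫ y, |f y| := setIntegral_le_integral hfi.abs (Filter.Eventually.of_forall fun y => abs_nonneg _)
  calc _ ≤ _ := hlow
    _ ≤ _ := hfk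
    _ ≤ 2 * (x * ρ) * ((G / (s - m) + (l - k) / (m - r)) * volume.real A) := mul_le_mul_of_nonneg_left hgrad (by positivity)
    _ = _ := by
      have e1 : s - m = (s - r) / 2 := by rw [hm]; ring
      have e2 : m - r = (s - r) / 2 := by rw [hm]; ring
      have : s - r ≠ 0 := by linarith
      rw [e1, e2]; field_simp; ring
theorem dg1 (Γ : ℝ) (hΓ : 0 ≤ Γ) : ∃ ν : ℝ, 0 < ν ∧ ∀ (W : E → ℝ) (K : ℝ≥0), LipschitzWith K W →
    ∀ (c : E) (ρ k0 k1 : ℝ), 0 < ρ → k0 < k1 → DG W c ρ k0 k1 (fun _ => Γ * (k1 - k0)) →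
    volume.real (ball c ρ ∩ {x | k0 < W x}) ≤ ν * volume.real (ball c ρ) → ∀ x ∈ ball c (ρ / 2), W x ≤ k1 := by
  set n := Module.finrank ℝ E with hn
  set x0 : ℝ := (4 ^ n * (32 * (Γ + 1)))⁻¹ with hx0
  have hx0p : 0 < x0 := by positivity
  refine ⟨x0 ^ n / 2, by positivity, ?_⟩
  intro W K hW c ρ k0 k1 hρ hk hdg hsm
  set H := k1 - k0 with hH
  have hHp : 0 < H := by rw [hH]; linarith
  have hWc := hW.continuous
  set V := volume.real (ball (0:E) ρ) with hV
  have hVc : volume.real (ball c ρ) = V := by rw [hV, vol_ball _ hρ.le, vol_ball _ hρ.le]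
  have hVp : 0 < V := vol_ball_pos _ hρ
  set R : ℕ → ℝ := fun j => ρ / 2 * (1 + (1 / 2) ^ j) with hR
  set k : ℕ → ℝ := fun j => k1 - (1 / 2) ^ j * H with hkd
  have key : ∀ j, volume.real (ball c (R j) ∩ {x | k j < W x}) ≤ x0 ^ n / 2 * ((1 / 4) ^ j) ^ n * V := by
    intro j
    induction j with
    | zero =>
      have e1 : R 0 = ρ := by simp [hR]; ring
      have e2 : k 0 = k0 := by simp [hkd, hH]
      rw [e1, e2]; simpa [hVc] using hsm
    | succ j ih =>
      have hy : (0:ℝ) < (1 / 2) ^ j := by positivity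
      have hy1 : ((1:ℝ) / 2) ^ j ≤ 1 := pow_le_one₀ (by norm_num) (by norm_num)
      have e4 : ((1:ℝ) / 4) ^ j = (1 / 2) ^ j * (1 / 2) ^ j := by rw [← mul_pow]; norm_num
      have es : ((1:ℝ) / 2) ^ (j + 1) = (1 / 2) ^ j / 2 := by rw [pow_succ]; ring
      have es4 : ((1:ℝ) / 4) ^ (j + 1) = (1 / 4) ^ j / 4 := by rw [pow_succ]; ring
      set y : ℝ := (1 / 2) ^ j with hyd
      have hRr : R (j + 1) < R j := by simp only [hR, es, ← hyd]; nlinarith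
      have hRle : R j ≤ ρ := by simp only [hR, ← hyd]; nlinarith
      have h := dg_step hW (c := c) (ρ := ρ) (k := k j) (l := k (j + 1)) (r := R (j + 1)) (s := R j) (G := Γ * H)
        (x := x0 * (1 / 4) ^ j) (by simp only [hkd, es, ← hyd]; nlinarith) (by simp only [hR]; positivity) hRr (by positivity) hρ (by positivity)
        (fun r' s' h1 h2 h3 => hdg (k j) (by simp only [hkd, ← hyd]; nlinarith) (by simp only [hkd, ← hyd]; nlinarith) r' s' h1 h2 (h3.trans hRle))
        (by rw [mul_pow, ← hn]; linarith)
      have ekk : k (j + 1) - k j = y / 2 * H := by simp only [hkd, es, ← hyd]; ring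
      have eRR : R j - R (j + 1) = ρ * y / 4 := by simp only [hR, es, ← hyd]; ring
      rw [ekk, eRR] at h
      set a := volume.real (ball c (R j) ∩ {x | k j < W x}) with ha
      set b := volume.real (ball c (R (j + 1)) ∩ {x | k (j + 1) < W x}) with hb
      have ha0 : 0 ≤ a := measureReal_nonneg
      have h2 : b ≤ 32 * (Γ + 1) * x0 * a := by
        have e5 : 4 * (x0 * (1 / 4) ^ j) * ρ * (Γ * H + y / 2 * H) / (ρ * y / 4) * a = (y / 2 * H) * (32 * x0 * (Γ + y / 2) * a) := by
          rw [e4]; field_simp; ring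
        rw [e5] at h
        have h6 := le_of_mul_le_mul_left h (by positivity)
        refine h6.trans ?_
        have : (Γ + y / 2) ≤ Γ + 1 := by linarith
        have h7 : 32 * x0 * (Γ + y / 2) * a ≤ 32 * x0 * (Γ + 1) * a := by gcongr
        linarith
      have h8 : 32 * (Γ + 1) * x0 = (1 / 4) ^ n := by
        rw [hx0, one_div, inv_pow]; field_simp
      rw [h8] at h2
      calc b ≤ (1 / 4) ^ n * (x0 ^ n / 2 * ((1 / 4) ^ j) ^ n * V) := h2.trans (by gcongr)
        _ = _ := by rw [pow_succ (1 / 4 : ℝ) j, mul_pow]; ring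
  have hlim : volume.real (ball c (ρ / 2) ∩ {x | k1 < W x}) ≤ 0 := by
    have hle : ∀ j : ℕ, volume.real (ball c (ρ / 2) ∩ {x | k1 < W x}) ≤ x0 ^ n / 2 * V * (1 / 4) ^ j := by
      intro j
      have hy : (0:ℝ) < (1 / 2) ^ j := by positivity
      refine (measureReal_mono ?_ ((lt_of_le_of_lt (measure_mono inter_subset_left) measure_ball_lt_top).ne)).trans ((key j).trans ?_)
      · apply inter_subset_inter
        · apply ball_subset_ball; simp only [hR]; nlinarith
        · intro z hz
          have hz' : k1 < W z := hz
          show k j < W z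
          simp only [hkd]; nlinarith
      · have hq : (((1:ℝ) / 4) ^ j) ^ n ≤ (1 / 4) ^ j :=
          pow_le_of_le_one (by positivity) (pow_le_one₀ (by norm_num) (by norm_num)) (Module.finrank_pos (R := ℝ) (M := E)).ne'
        calc _ ≤ x0 ^ n / 2 * (1 / 4) ^ j * V := by gcongr
          _ = _ := by ring
    have ht : Filter.Tendsto (fun j : ℕ => x0 ^ n / 2 * V * (1 / 4 : ℝ) ^ j) Filter.atTop (nhds (x0 ^ n / 2 * V * 0)) :=
      (tendsto_pow_atTop_nhds_zero_of_lt_one (by norm_num) (by norm_num)).const_mul _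
    rw [mul_zero] at ht
    exact ge_of_tendsto' ht hle
  intro x hx
  by_contra! hcon
  have ho : IsOpen (ball c (ρ / 2) ∩ {x | k1 < W x}) := isOpen_ball.inter (isOpen_lt continuous_const hWc)
  have := ho.measure_pos volume ⟨x, hx, hcon⟩
  have h3 := ENNReal.toReal_pos this.ne' ((lt_of_le_of_lt (measure_mono inter_subset_left) measure_ball_lt_top).ne)
  exact absurd hlim (not_le.2 h3)
theorem dg2 (Γ μ : ℝ) (hΓ : 0 ≤ Γ) (hμ : 0 < μ) : ∃ θ : ℝ, 0 < θ ∧ θ < 1 ∧ ∀ (W : E → ℝ) (K : ℝ≥0), LipschitzWith K W →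
    ∀ (c : E) (ρ k0 S : ℝ), 0 < ρ → k0 < S → DG W c ρ k0 S (fun k => Γ * (S - k)) → (∀ x ∈ ball c ρ, W x ≤ S) →
    μ * volume.real (ball c (ρ / 2)) ≤ volume.real (ball c (ρ / 2) ∩ {x | W x ≤ k0}) →
    ∀ x ∈ ball c (ρ / 4), W x ≤ S - θ * (S - k0) := by
  obtain ⟨ν, hν, hdg1⟩ := dg1 (E := E) (2 * Γ) (by positivity)
  set n := Module.finrank ℝ E with hn
  set C : ℝ := 4 * 2 ^ n * Γ / μ with hC
  have hC0 : 0 ≤ C := by positivity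
  obtain ⟨J, hJ⟩ := exists_nat_gt (C ^ 2 * 2 ^ n / ν ^ 2)
  have hJ0 : (0:ℝ) < J := lt_of_le_of_lt (by positivity) hJ
  refine ⟨(1 / 2) ^ (J + 1), by positivity, pow_lt_one₀ (by norm_num) (by norm_num) (by omega), ?_⟩
  intro W K hW c ρ k0 S hρ hk hdg hS hZ
  have hWc := hW.continuous
  set k : ℕ → ℝ := fun j => S - (1 / 2) ^ j * (S - k0) with hkd
  set B := ball c (ρ / 2) with hB
  set V := volume.real B with hV
  have hVp : 0 < V := vol_ball_pos _ (by positivity)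
  have hmk : ∀ k t, MeasurableSet (ball c t ∩ {x | k < W x}) := fun k t =>
    measurableSet_ball.inter (isOpen_lt continuous_const hWc).measurableSet
  have hfin : ∀ (A : Set E) t, volume (ball c t ∩ A) ≠ ∞ := fun k t =>
    (lt_of_le_of_lt (measure_mono inter_subset_left) measure_ball_lt_top).ne
  have hkS : ∀ j, k j < S := fun j => by
    have hy : (0:ℝ) < (1 / 2) ^ j := by positivity
    simp only [hkd]; nlinarith
  have hk0 : ∀ j, k0 ≤ k j := fun j => by
    have hy : ((1:ℝ) / 2) ^ j ≤ 1 := pow_le_one₀ (by norm_num) (by norm_num)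
    simp only [hkd]; nlinarith
  have hkk : ∀ j, k (j + 1) - k j = (S - k j) / 2 := fun j => by
    simp only [hkd, pow_succ]; ring
  have hkmono : ∀ j, k j < k (j + 1) := fun j => by linarith [hkk j, hkS j]
  set D : ℕ → Set E := fun j => B ∩ {x | k j < W x ∧ W x < k (j + 1)} with hD
  have hDm : ∀ j, MeasurableSet (D j) := fun j =>
    measurableSet_ball.inter ((isOpen_lt continuous_const hWc).inter (isOpen_lt hWc continuous_const)).measurableSet
  set a : ℕ → ℝ := fun j => volume.real (B ∩ {x | k j < W x}) with ha
  have hVρ : volume.real (ball c ρ) = 2 ^ n * V := by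
    rw [hV, hB, vol_ball _ hρ.le, vol_ball _ (by positivity : 0 ≤ ρ / 2), ← hn, div_pow]; field_simp
  have hVρ0 : volume.real (ball (0:E) (2 * (ρ / 2))) = 2 ^ n * V := by
    rw [← hVρ, mul_div_cancel₀ _ two_ne_zero, vol_ball _ hρ.le, vol_ball c hρ.le]
  have step : ∀ j, a (j + 1) ^ 2 ≤ C ^ 2 * 2 ^ n * V * volume.real (D j) := by
    intro j
    set H := k (j + 1) - k j with hH
    have hHp : 0 < H := sub_pos.2 (hkmono j)
    set T : E → ℝ := fun y => min (max (W y - k j) 0) H with hT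
    have hTl : LipschitzWith K T := by
      have h1 : LipschitzWith K (fun y => W y - k j) := by
        apply LipschitzWith.of_dist_le_mul; intro x y
        have := hW.dist_le_mul x y
        simpa [Real.dist_eq] using this
      exact (h1.max_const 0).min_const _
    have hT0 : ∀ y, 0 ≤ T y := fun y => le_min (le_max_right _ _) hHp.le
    have hp := poinc hTl (c := c) (r := ρ / 2) (by positivity) (Z := B ∩ {x | W x ≤ k0}) inter_subset_left (fun y hy => by
      have h2 : W y ≤ k0 := hy.2
      have := hk0 j
      simp only [hT]; rw [max_eq_right (by linarith), min_eq_left hHp.le])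
    have hTi : IntegrableOn (fun y => |T y|) B :=
      (hTl.continuous.abs.continuousOn.integrableOn_compact (isCompact_closedBall c (ρ / 2))).mono_set ball_subset_closedBall
    have hlow : H * a (j + 1) ≤ ∫ y in B, |T y| := by
      calc H * a (j + 1) = ∫ y in B ∩ {x | k (j + 1) < W x}, H := by
            rw [setIntegral_const, smul_eq_mul, mul_comm]
        _ ≤ ∫ y in B ∩ {x | k (j + 1) < W x}, |T y| := by
            apply setIntegral_mono_on (integrableOn_const (hfin _ _)) (hTi.mono_set inter_subset_left) (hmk _ _)
            intro y hy
            have h2 : k (j + 1) < W y := hy.2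
            have h3 := hkmono j
            simp only [hT]
            rw [max_eq_left (by linarith), min_eq_right (by linarith), abs_of_pos hHp]
        _ ≤ _ := setIntegral_mono_set hTi (Filter.Eventually.of_forall fun y => abs_nonneg _)
            (Filter.Eventually.of_forall fun y hy => hy.1)
    have hbnd : ∀ (A : Set E), MeasurableSet A → volume A ≠ ∞ → IntegrableOn (fun y => ‖∇ W y‖) A ∧ IntegrableOn (fun y => ‖∇ W y‖ ^ 2) A := by
      intro A hAm hAf
      exact ⟨intOn_of_bdd hAm hAf
        (meas_grad W).norm.aestronglyMeasurable K (fun x _ => by rw [norm_norm]; exact grad_norm_le hW x),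
        intOn_of_bdd hAm hAf
        ((meas_grad W).norm.pow_const 2).aestronglyMeasurable (K ^ 2) (fun x _ => by
          rw [norm_pow, norm_norm]; exact pow_le_pow_left₀ (norm_nonneg _) (grad_norm_le hW x) 2)⟩
    have hgr : ∫ y in B, ‖∇ T y‖ = ∫ y in D j, ‖∇ W y‖ := by
      have e : ∀ y ∈ B, ‖∇ T y‖ = (D j).indicator (fun y => ‖∇ W y‖) y := by
        intro y hyB
        have hkj : k j + H = k (j + 1) := by rw [hH]; ring
        rw [hT, grad_trunc hWc hHp, hkj]
        split_ifs with h
        · rw [indicator_of_mem (show y ∈ D j from ⟨hyB, h⟩)]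
        · rw [indicator_of_notMem (fun h' => h h'.2), norm_zero]
      rw [setIntegral_congr_fun measurableSet_ball e, setIntegral_indicator (hDm j)]
      congr 2
      exact inter_eq_right.2 inter_subset_left
    have hcs := cs_int (hDm j) (hfin _ _) (hbnd _ (hDm j) (hfin _ _)).1 (hbnd _ (hDm j) (hfin _ _)).2
    have hen : ∫ y in D j, ‖∇ W y‖ ^ 2 ≤ (4 * Γ * H / ρ) ^ 2 * (2 ^ n * V) := by
      calc ∫ y in D j, ‖∇ W y‖ ^ 2 ≤ ∫ y in B ∩ {x | k j < W x}, ‖∇ W y‖ ^ 2 :=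
            setIntegral_mono_set (hbnd _ (hmk _ _) (hfin _ _)).2 (Filter.Eventually.of_forall fun y => by positivity)
              (Filter.Eventually.of_forall fun y hy => ⟨hy.1, hy.2.1⟩)
        _ ≤ _ := hdg (k j) (hk0 j) (hkS j) (ρ / 2) ρ (by positivity) (by linarith) le_rfl
        _ ≤ (Γ * (S - k j) / (ρ - ρ / 2)) ^ 2 * volume.real (ball c ρ) := by
            refine mul_le_mul_of_nonneg_left (measureReal_mono inter_subset_left measure_ball_lt_top.ne) (by positivity)
        _ = _ := by
            rw [hVρ, (by linarith [hkk j] : S - k j = 2 * H), (by ring : ρ - ρ / 2 = ρ / 2)]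
            congr 2; field_simp; ring
    rw [hVρ0, hgr, mul_div_cancel₀ _ two_ne_zero] at hp
    set I := ∫ y in D j, ‖∇ W y‖ with hI
    have hI0 : 0 ≤ I := integral_nonneg fun _ => norm_nonneg _
    have h5 : μ * V * (H * a (j + 1)) ≤ 2 ^ n * V * (ρ * I) := by
      refine le_trans ?_ hp
      exact mul_le_mul hZ hlow (mul_nonneg hHp.le measureReal_nonneg) measureReal_nonneg
    have h6 : μ * (H * a (j + 1)) ≤ 2 ^ n * (ρ * I) := by nlinarith
    have h7 : I ^ 2 ≤ volume.real (D j) * ((4 * Γ * H / ρ) ^ 2 * (2 ^ n * V)) :=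
      hcs.trans (mul_le_mul_of_nonneg_left hen measureReal_nonneg)
    have h8 : (μ * (H * a (j + 1))) ^ 2 ≤ (2 ^ n * (ρ * I)) ^ 2 :=
      pow_le_pow_left₀ (mul_nonneg hμ.le (mul_nonneg hHp.le measureReal_nonneg)) h6 2
    have h9 : (μ * H) ^ 2 * (a (j + 1) ^ 2) ≤ (μ * H) ^ 2 * (C ^ 2 * 2 ^ n * V * volume.real (D j)) := by
      calc (μ * H) ^ 2 * (a (j + 1) ^ 2) = (μ * (H * a (j + 1))) ^ 2 := by ring
        _ ≤ _ := h8
        _ = (2 ^ n * ρ) ^ 2 * I ^ 2 := by ring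
        _ ≤ (2 ^ n * ρ) ^ 2 * (volume.real (D j) * ((4 * Γ * H / ρ) ^ 2 * (2 ^ n * V))) := by gcongr
        _ = _ := by rw [hC]; field_simp
    exact le_of_mul_le_mul_left h9 (by positivity)
  have hanti : ∀ i j, i ≤ j → a j ≤ a i := by
    intro i j hij
    have hm : k i ≤ k j := (strictMono_nat_of_lt_succ hkmono).monotone hij
    exact measureReal_mono (inter_subset_inter_right _ fun z hz => lt_of_le_of_lt hm hz) (hfin _ _)
  have hsum : ∑ j ∈ Finset.range J, volume.real (D j) ≤ V := by
    rw [← measureReal_biUnion_finset]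
    · apply measureReal_mono _ measure_ball_lt_top.ne
      exact iUnion₂_subset fun j _ => inter_subset_left
    · intro i _ j _ hij
      have hm := (strictMono_nat_of_lt_succ hkmono).monotone
      rw [Function.onFun, Set.disjoint_left]
      intro z hz1 hz2
      rcases lt_or_gt_of_ne hij with h | h
      · have := hm (Nat.succ_le_of_lt h)
        exact absurd (hz1.2.2.trans_le this) (not_lt.2 hz2.2.1.le)
      · have := hm (Nat.succ_le_of_lt h)
        exact absurd (hz2.2.2.trans_le this) (not_lt.2 hz1.2.1.le)
    · exact fun j _ => hDm j
  have haJ : a J ≤ ν * V := by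
    have h1 : (J : ℝ) * a J ^ 2 ≤ C ^ 2 * 2 ^ n * V * V := by
      calc (J : ℝ) * a J ^ 2 = ∑ j ∈ Finset.range J, a J ^ 2 := by simp
        _ ≤ ∑ j ∈ Finset.range J, C ^ 2 * 2 ^ n * V * volume.real (D j) := by
            apply Finset.sum_le_sum
            intro j hj
            refine le_trans ?_ (step j)
            exact pow_le_pow_left₀ measureReal_nonneg (hanti _ _ (Finset.mem_range.1 hj)) 2
        _ = C ^ 2 * 2 ^ n * V * ∑ j ∈ Finset.range J, volume.real (D j) := by rw [Finset.mul_sum]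
        _ ≤ _ := by gcongr
    rw [div_lt_iff₀ (by positivity)] at hJ
    refine (sq_le_sq₀ measureReal_nonneg (by positivity)).1 ?_
    refine le_of_mul_le_mul_left (h1.trans ?_) hJ0
    nlinarith [mul_pos hVp hVp]
  have hfinal := hdg1 W K hW c (ρ / 2) (k J) (k (J + 1)) (by positivity) (hkmono J) (by
    intro k' h1 h2 r s hr hrs hs
    refine (hdg k' ((hk0 J).trans h1) (h2.trans (hkS _)) r s hr hrs (by linarith)).trans ?_
    refine mul_le_mul_of_nonneg_right ?_ measureReal_nonneg
    have h3 : 0 ≤ S - k' := by linarith [hkS (J + 1)]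
    have h4 : 0 < s - r := by linarith
    apply pow_le_pow_left₀ (by positivity)
    apply div_le_div_of_nonneg_right _ h4.le
    have := hkk J
    nlinarith) haJ
  intro x hx
  have := hfinal x (by rwa [(by ring : ρ / 2 / 2 = ρ / 4)])
  simpa only [hkd] using this
noncomputable def aa (δ p t : ℝ) : ℝ := (δ ^ 2 + t ^ 2) ^ ((p - 2) / 2)
noncomputable def Ph (δ p : ℝ) (ξ : E) : E := aa δ p ‖ξ‖ • ξ
noncomputable def GG (δ p : ℝ) (ξ : E) : ℝ := (δ ^ 2 + ‖ξ‖ ^ 2) ^ (p / 2) / p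
theorem dpos (hδ : 0 < δ) (t : ℝ) : 0 < δ ^ 2 + t ^ 2 := by positivity
theorem aa_pos (hδ : 0 < δ) (p t : ℝ) : 0 < aa δ p t := Real.rpow_pos_of_pos (dpos hδ t) _
theorem GG_nonneg (hp : 1 < p) (ξ : E) : 0 ≤ GG δ p ξ :=
  div_nonneg (Real.rpow_nonneg (by positivity) _) (by linarith)
theorem GG_cont (hp : 1 < p) : Continuous (GG δ p : E → ℝ) := by
  unfold GG
  refine Continuous.div_const (Continuous.rpow_const (by fun_prop) fun x => Or.inr (by linarith)) _
theorem Ph_cont (hδ : 0 < δ) : Continuous (Ph δ p : E → E) := by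
  unfold Ph aa
  exact (Continuous.rpow_const (by fun_prop) fun x => Or.inl (dpos hδ _).ne').smul continuous_id
theorem line_sq (ξ D : E) (t : ℝ) : HasDerivAt (fun s : ℝ => ‖ξ + s • D‖ ^ 2) (2 * ⟪ξ + t • D, D⟫_ℝ) t := by
  have h : HasDerivAt (fun s : ℝ => ξ + s • D) D t := by
    simpa using ((hasDerivAt_id t).smul_const D).const_add ξ
  exact h.norm_sq
theorem GG_line (hδ : 0 < δ) (hp : 1 < p) (ξ D : E) (t : ℝ) :
    HasDerivAt (fun s : ℝ => GG δ p (ξ + s • D)) ⟪Ph δ p (ξ + t • D), D⟫_ℝ t := by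
  have h := ((line_sq ξ D t).const_add (δ ^ 2)).rpow_const (p := p / 2) (Or.inl (dpos hδ ‖ξ + t • D‖).ne')
  have h2 := h.div_const p
  unfold GG Ph aa
  refine h2.congr_deriv ?_
  rw [real_inner_smul_left, (by ring : p / 2 - 1 = (p - 2) / 2)]
  field_simp
theorem Ph_line (hδ : 0 < δ) (ξ D e : E) (t : ℝ) :
    HasDerivAt (fun s : ℝ => ⟪Ph δ p (ξ + s • D), e⟫_ℝ)
      (aa δ p ‖ξ + t • D‖ * (⟪D, e⟫_ℝ + (p - 2) * (⟪ξ + t • D, D⟫_ℝ * ⟪ξ + t • D, e⟫_ℝ / (δ ^ 2 + ‖ξ + t • D‖ ^ 2)))) t := by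
  have h := ((line_sq ξ D t).const_add (δ ^ 2)).rpow_const (p := (p - 2) / 2) (Or.inl (dpos hδ ‖ξ + t • D‖).ne')
  have h1 : HasDerivAt (fun s : ℝ => ⟪ξ + s • D, e⟫_ℝ) ⟪D, e⟫_ℝ t := by
    simp_rw [inner_add_left, real_inner_smul_left]
    simpa using ((hasDerivAt_id t).mul_const ⟪D, e⟫_ℝ).const_add ⟪ξ, e⟫_ℝ
  have h2 := h.mul h1
  unfold Ph
  simp_rw [real_inner_smul_left]
  unfold aa
  refine h2.congr_deriv ?_
  rw [Real.rpow_sub (dpos hδ ‖ξ + t • D‖) _ 1, Real.rpow_one]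
  have := (dpos hδ ‖ξ + t • D‖).ne'
  field_simp
  ring
theorem ell_upper (hδ : 0 < δ) (ξ D : E) (hm : ∀ t ∈ Icc (0:ℝ) 1, aa δ p ‖ξ + t • D‖ ≤ m) :
    ‖Ph δ p (ξ + D) - Ph δ p ξ‖ ≤ (1 + |p - 2|) * m * ‖D‖ := by
  set e := Ph δ p (ξ + D) - Ph δ p ξ with he
  have hm0 : 0 ≤ m := (aa_pos hδ p _).le.trans (hm 0 (by simp))
  by_cases hz : ‖e‖ = 0
  · rw [hz]; positivity
  have hep : 0 < ‖e‖ := lt_of_le_of_ne (norm_nonneg _) (Ne.symm hz)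
  obtain ⟨t, ht, h⟩ := exists_hasDerivAt_eq_slope _ _ (zero_lt_one' ℝ)
    (fun t _ => (Ph_line (p := p) hδ ξ D e t).continuousAt.continuousWithinAt) (fun t _ => Ph_line hδ ξ D e t)
  simp only [one_smul, zero_smul, add_zero, sub_zero, div_one, ← inner_sub_left, ← he, real_inner_self_eq_norm_sq] at h
  have ha := hm t ⟨ht.1.le, ht.2.le⟩
  have ha0 := aa_pos hδ p ‖ξ + t • D‖
  set y := ξ + t • D
  have h1 : |⟪D, e⟫_ℝ| ≤ ‖D‖ * ‖e‖ := abs_real_inner_le_norm _ _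
  have h2 : |⟪y, D⟫_ℝ * ⟪y, e⟫_ℝ / (δ ^ 2 + ‖y‖ ^ 2)| ≤ ‖D‖ * ‖e‖ := by
    rw [abs_div, abs_of_pos (dpos hδ ‖y‖), div_le_iff₀ (dpos hδ ‖y‖), abs_mul]
    calc |⟪y, D⟫_ℝ| * |⟪y, e⟫_ℝ| ≤ (‖y‖ * ‖D‖) * (‖y‖ * ‖e‖) :=
          mul_le_mul (abs_real_inner_le_norm _ _) (abs_real_inner_le_norm _ _) (abs_nonneg _) (by positivity)
      _ = ‖D‖ * ‖e‖ * ‖y‖ ^ 2 := by ring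
      _ ≤ _ := by gcongr; nlinarith
  have h3 : ⟪D, e⟫_ℝ + (p - 2) * (⟪y, D⟫_ℝ * ⟪y, e⟫_ℝ / (δ ^ 2 + ‖y‖ ^ 2)) ≤ (1 + |p - 2|) * (‖D‖ * ‖e‖) := by
    have h4 : (p - 2) * (⟪y, D⟫_ℝ * ⟪y, e⟫_ℝ / (δ ^ 2 + ‖y‖ ^ 2)) ≤ |p - 2| * (‖D‖ * ‖e‖) := by
      refine (le_abs_self _).trans ?_
      rw [abs_mul]; gcongr
    have := le_abs_self ⟪D, e⟫_ℝ
    linarith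
  have h5 : ‖e‖ ^ 2 ≤ m * ((1 + |p - 2|) * (‖D‖ * ‖e‖)) := by
    rw [← h]
    exact (mul_le_mul_of_nonneg_left h3 ha0.le).trans (mul_le_mul_of_nonneg_right ha (by positivity))
  have : ‖e‖ * ‖e‖ ≤ ‖e‖ * ((1 + |p - 2|) * m * ‖D‖) := by linarith
  exact le_of_mul_le_mul_left this hep
theorem ell_lower (hδ : 0 < δ) (hp : 1 < p) (hm0 : 0 ≤ m) (ξ D : E) (hm : ∀ t ∈ Icc (0:ℝ) 1, m ≤ aa δ p ‖ξ + t • D‖) :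
    min 1 (p - 1) * m * ‖D‖ ^ 2 ≤ ⟪Ph δ p (ξ + D) - Ph δ p ξ, D⟫_ℝ := by
  obtain ⟨t, ht, h⟩ := exists_hasDerivAt_eq_slope _ _ (zero_lt_one' ℝ)
    (fun t _ => (Ph_line (p := p) hδ ξ D D t).continuousAt.continuousWithinAt) (fun t _ => Ph_line hδ ξ D D t)
  simp only [one_smul, zero_smul, add_zero, sub_zero, div_one, ← inner_sub_left, real_inner_self_eq_norm_sq] at h
  rw [← h]
  have ha := hm t ⟨ht.1.le, ht.2.le⟩
  set y := ξ + t • D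
  set q := ⟪y, D⟫_ℝ * ⟪y, D⟫_ℝ / (δ ^ 2 + ‖y‖ ^ 2) with hq
  have hq0 : 0 ≤ q := div_nonneg (mul_self_nonneg _) (dpos hδ _).le
  have hq1 : q ≤ ‖D‖ ^ 2 := by
    rw [hq, div_le_iff₀ (dpos hδ ‖y‖), ← abs_mul_abs_self]
    calc |⟪y, D⟫_ℝ| * |⟪y, D⟫_ℝ| ≤ (‖y‖ * ‖D‖) * (‖y‖ * ‖D‖) :=
          mul_le_mul (abs_real_inner_le_norm _ _) (abs_real_inner_le_norm _ _) (abs_nonneg _) (by positivity)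
      _ = ‖D‖ ^ 2 * ‖y‖ ^ 2 := by ring
      _ ≤ _ := by gcongr; nlinarith
  have h3 : min 1 (p - 1) * ‖D‖ ^ 2 ≤ ‖D‖ ^ 2 + (p - 2) * q := by
    rcases le_total p 2 with h2 | h2
    · have := min_le_right (1:ℝ) (p - 1)
      nlinarith
    · have := min_le_left (1:ℝ) (p - 1)
      nlinarith [mul_nonneg (sub_nonneg.2 h2) hq0, sq_nonneg ‖D‖]
  have h4 : 0 ≤ min 1 (p - 1) * ‖D‖ ^ 2 := mul_nonneg (le_min zero_le_one (by linarith)) (sq_nonneg _)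
  calc min 1 (p - 1) * m * ‖D‖ ^ 2 = m * (min 1 (p - 1) * ‖D‖ ^ 2) := by ring
    _ ≤ _ := mul_le_mul ha h3 h4 (hm0.trans ha)
theorem aa_le_max {u : ℝ} (hδ : 0 < δ) (hl : 0 ≤ l) (h1 : l ≤ t) (h2 : t ≤ u) :
    min (aa δ p l) (aa δ p u) ≤ aa δ p t ∧ aa δ p t ≤ max (aa δ p l) (aa δ p u) := by
  unfold aa
  rcases le_total p 2 with h | h
  · exact ⟨(min_le_right _ _).trans (Real.rpow_le_rpow_of_nonpos (dpos hδ _) (by nlinarith) (by linarith)),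
      (Real.rpow_le_rpow_of_nonpos (dpos hδ _) (by nlinarith) (by linarith)).trans (le_max_left _ _)⟩
  · exact ⟨(min_le_left _ _).trans (Real.rpow_le_rpow (dpos hδ _).le (by nlinarith) (by linarith)),
      (Real.rpow_le_rpow (dpos hδ _).le (by nlinarith) (by linarith)).trans (le_max_right _ _)⟩
theorem seg_norm (ξ D : E) (ht : t ∈ Icc (0:ℝ) 1) {u : ℝ} (h1 : ‖ξ‖ ≤ u) (h2 : ‖ξ + D‖ ≤ u) : ‖ξ + t • D‖ ≤ u := by
  have := (convex_closedBall (0:E) u) (x := ξ) (by simpa using h1) (y := ξ + D) (by simpa using h2) (sub_nonneg.2 ht.2) ht.1 (by ring)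
  have e : (1 - t) • ξ + t • (ξ + D) = ξ + t • D := by rw [smul_add, ← add_assoc, ← add_smul]; simp
  rw [e] at this; simpa using this
theorem Ph_mono_strict (hδ : 0 < δ) (hp : 1 < p) (ξ D : E) : ∃ c : ℝ, 0 < c ∧ c * ‖D‖ ^ 2 ≤ ⟪Ph δ p (ξ + D) - Ph δ p ξ, D⟫_ℝ := by
  set u := max ‖ξ‖ ‖ξ + D‖
  set m := min (aa δ p 0) (aa δ p u)
  have hm : 0 < m := lt_min (aa_pos hδ _ _) (aa_pos hδ _ _)
  refine ⟨min 1 (p - 1) * m, mul_pos (lt_min one_pos (by linarith)) hm, ell_lower hδ hp hm.le ξ D fun t ht => ?_⟩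
  exact (aa_le_max hδ le_rfl (norm_nonneg _) (seg_norm ξ D ht (le_max_left _ _) (le_max_right _ _))).1
theorem Ph_mono (hδ : 0 < δ) (hp : 1 < p) (ξ D : E) : 0 ≤ ⟪Ph δ p (ξ + D) - Ph δ p ξ, D⟫_ℝ := by
  obtain ⟨c, hc, h⟩ := Ph_mono_strict hδ hp ξ D
  exact le_trans (by positivity) h
theorem GG_conv (hδ : 0 < δ) (hp : 1 < p) (ξ ζ : E) : GG δ p ξ + ⟪Ph δ p ξ, ζ - ξ⟫_ℝ ≤ GG δ p ζ := by
  set D := ζ - ξ with hD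
  obtain ⟨t, ht, h⟩ := exists_hasDerivAt_eq_slope _ _ (zero_lt_one' ℝ)
    (fun t _ => (GG_line hδ hp ξ D t).continuousAt.continuousWithinAt) (fun t _ => GG_line hδ hp ξ D t)
  simp only [one_smul, zero_smul, add_zero, sub_zero, div_one] at h
  have e : ξ + D = ζ := by rw [hD]; abel
  rw [e] at h
  have h2 := Ph_mono hδ hp ξ (t • D)
  rw [inner_smul_right, inner_sub_left] at h2
  have := nonneg_of_mul_nonneg_right h2 ht.1
  linarith
theorem GG_conv2 (hδ : 0 < δ) (hp : 1 < p) (ξ ζ : E) :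
    ⟪Ph δ p (ξ + (2:ℝ)⁻¹ • (ζ - ξ)) - Ph δ p ξ, (2:ℝ)⁻¹ • (ζ - ξ)⟫_ℝ ≤ GG δ p ζ - GG δ p ξ - ⟪Ph δ p ξ, ζ - ξ⟫_ℝ := by
  set H := (2:ℝ)⁻¹ • (ζ - ξ) with hH
  have h2 : ζ - ξ = H + H := by rw [hH, ← add_smul]; norm_num
  have e : ζ - (ξ + H) = H := by rw [← sub_sub, h2]; abel
  have h1 := GG_conv hδ hp ξ (ξ + H)
  have h3 := GG_conv hδ hp (ξ + H) ζ
  rw [e] at h3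
  rw [h2, inner_add_right, inner_sub_left]
  rw [add_sub_cancel_left] at h1
  linarith
theorem GG_mid (hδ : 0 < δ) (hp : 1 < p) (ξ ζ : E) :
    GG δ p ((2:ℝ)⁻¹ • (ξ + ζ)) ≤ (GG δ p ξ + GG δ p ζ) / 2 ∧
    (GG δ p ((2:ℝ)⁻¹ • (ξ + ζ)) = (GG δ p ξ + GG δ p ζ) / 2 → ξ = ζ) := by
  set m := (2:ℝ)⁻¹ • (ξ + ζ) with hm
  have e1 : ξ - m = -(ζ - m) := by
    have : m + m = ξ + ζ := by rw [hm, ← add_smul]; norm_num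
    rw [neg_sub, sub_eq_sub_iff_add_eq_add, this]
  have h1 := GG_conv hδ hp m ξ
  have h2 := GG_conv hδ hp m ζ
  rw [e1, inner_neg_right] at h1
  refine ⟨by linarith, fun h => ?_⟩
  have h3 := GG_conv2 hδ hp m ζ
  obtain ⟨c, hc, h4⟩ := Ph_mono_strict hδ hp m ((2:ℝ)⁻¹ • (ζ - m))
  have h5 : c * ‖(2:ℝ)⁻¹ • (ζ - m)‖ ^ 2 ≤ 0 := by linarith
  have h6 : ‖(2:ℝ)⁻¹ • (ζ - m)‖ ^ 2 ≤ 0 := by nlinarith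
  have h7 : ζ - m = 0 := by simpa using h6
  have h8 : ξ - m = 0 := by rw [e1, h7, neg_zero]
  rw [sub_eq_zero] at h7 h8; rw [h7, h8]
theorem GG_quant (p : ℝ) (hp : 1 < p) (U : ℝ) (hU : 0 < U) : ∃ c : ℝ, 0 < c ∧ ∀ δ : ℝ, 0 < δ → δ ≤ 1 → ∀ ξ ζ : E, ‖ξ‖ ≤ U → ‖ζ‖ ≤ U →
    c * ‖ζ - ξ‖ ^ (max p 2) ≤ GG δ p ζ - GG δ p ξ - ⟪Ph δ p ξ, ζ - ξ⟫_ℝ := by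
  have key : ∃ c : ℝ, 0 < c ∧ ∀ δ : ℝ, 0 < δ → δ ≤ 1 → ∀ ξ D : E, ‖ξ‖ ≤ U → ‖ξ + D‖ ≤ U →
      c * ‖D‖ ^ (max p 2) ≤ ⟪Ph δ p (ξ + D) - Ph δ p ξ, D⟫_ℝ := by
    rcases le_total p 2 with h | h
    · refine ⟨(p - 1) * (1 + U ^ 2) ^ ((p - 2) / 2), mul_pos (by linarith) (Real.rpow_pos_of_pos (by positivity) _), ?_⟩
      intro δ hδ hδ1 ξ D h1 h2
      have := ell_lower hδ hp (m := (1 + U ^ 2) ^ ((p - 2) / 2)) (Real.rpow_nonneg (by positivity) _) ξ D (fun t ht => by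
        unfold aa
        apply Real.rpow_le_rpow_of_nonpos (dpos hδ _) _ (by linarith)
        have := seg_norm ξ D ht h1 h2
        nlinarith [norm_nonneg (ξ + t • D)])
      rw [min_eq_right (by linarith)] at this
      rw [max_eq_right h]; simpa using this
    · refine ⟨(1 / 2) * (1 / 2) ^ (p - 2), by positivity, ?_⟩
      intro δ hδ hδ1 ξ D h1 h2
      rw [max_eq_left h]
      set ζ := ξ + D with hζ
      have hD : D = ζ - ξ := by rw [hζ]; abel
      have e : ⟪Ph δ p ζ - Ph δ p ξ, D⟫_ℝ = (aa δ p ‖ξ‖ + aa δ p ‖ζ‖) / 2 * ‖D‖ ^ 2 + (aa δ p ‖ζ‖ - aa δ p ‖ξ‖) * (‖ζ‖ ^ 2 - ‖ξ‖ ^ 2) / 2 := by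
        rw [hD, ← real_inner_self_eq_norm_sq, ← real_inner_self_eq_norm_sq, ← real_inner_self_eq_norm_sq]
        simp only [Ph, inner_sub_left, inner_sub_right, real_inner_smul_left, real_inner_comm ζ ξ]
        ring
      have hpos : 0 ≤ (aa δ p ‖ζ‖ - aa δ p ‖ξ‖) * (‖ζ‖ ^ 2 - ‖ξ‖ ^ 2) := by
        unfold aa
        rcases le_total ‖ζ‖ ‖ξ‖ with h3 | h3
        · apply mul_nonneg_of_nonpos_of_nonpos
          · rw [sub_nonpos]; exact Real.rpow_le_rpow (dpos hδ _).le (by gcongr) (by linarith)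
          · rw [sub_nonpos]; gcongr
        · apply mul_nonneg
          · rw [sub_nonneg]; exact Real.rpow_le_rpow (dpos hδ _).le (by gcongr) (by linarith)
          · rw [sub_nonneg]; gcongr
      have hlow : ∀ η : E, ‖D‖ / 2 ≤ ‖η‖ → (1 / 2) ^ (p - 2) * ‖D‖ ^ (p - 2) ≤ aa δ p ‖η‖ := by
        intro η hη
        rw [← Real.mul_rpow (by norm_num) (norm_nonneg _)]
        unfold aa
        calc (1 / 2 * ‖D‖) ^ (p - 2) = ((1 / 2 * ‖D‖) ^ (2:ℝ)) ^ ((p - 2) / 2) := by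
              rw [← Real.rpow_mul (by positivity)]; congr 1; ring
          _ ≤ _ := by
              apply Real.rpow_le_rpow (by positivity) _ (by linarith)
              rw [Real.rpow_two]; nlinarith [norm_nonneg D, sq_nonneg δ]
      have hsum : (1 / 2) ^ (p - 2) * ‖D‖ ^ (p - 2) ≤ aa δ p ‖ξ‖ + aa δ p ‖ζ‖ := by
        have h3 : ‖D‖ ≤ ‖ζ‖ + ‖ξ‖ := by rw [hD]; exact norm_sub_le _ _
        have p1 := aa_pos hδ p ‖ξ‖
        have p2 := aa_pos hδ p ‖ζ‖
        rcases le_total (‖D‖ / 2) ‖ξ‖ with h4 | h4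
        · linarith [hlow ξ h4]
        · linarith [hlow ζ (by linarith)]
      rw [e]
      have e2 : ‖D‖ ^ p = ‖D‖ ^ (p - 2) * ‖D‖ ^ 2 := by
        rcases eq_or_lt_of_le (norm_nonneg D) with h5 | h5
        · rw [← h5, Real.zero_rpow (by linarith)]; simp
        · rw [← Real.rpow_two, ← Real.rpow_add h5]; congr 1; ring
      rw [e2]
      have := mul_le_mul_of_nonneg_right hsum (sq_nonneg ‖D‖)
      linarith
  obtain ⟨c, hc, h⟩ := key
  refine ⟨c * (1 / 2) ^ (max p 2), by positivity, fun δ hδ hδ1 ξ ζ h1 h2 => ?_⟩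
  refine le_trans ?_ (GG_conv2 hδ hp ξ ζ)
  refine le_trans (le_of_eq ?_) (h δ hδ hδ1 ξ ((2:ℝ)⁻¹ • (ζ - ξ)) h1 ?_)
  · rw [norm_smul, Real.mul_rpow (norm_nonneg _) (norm_nonneg _), mul_assoc]; norm_num
  · exact seg_norm ξ (ζ - ξ) (by norm_num) h1 (by simpa using h2)
theorem GG_ge (hp : 1 < p) (ξ : E) : ‖ξ‖ ^ p / p ≤ GG δ p ξ := by
  unfold GG
  apply div_le_div_of_nonneg_right _ (by linarith)
  calc ‖ξ‖ ^ p = (‖ξ‖ ^ (2:ℝ)) ^ (p / 2) := by rw [← Real.rpow_mul (norm_nonneg _)]; congr 1; ring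
    _ ≤ _ := by
      apply Real.rpow_le_rpow (by positivity) _ (by linarith)
      rw [Real.rpow_two]; nlinarith
theorem lineD_ae (hf : LipschitzWith K f) (v : E) :
    ∀ᵐ y : E, lineDeriv ℝ f y v = ⟪∇ f y, v⟫_ℝ := by
  filter_upwards [hf.ae_differentiableAt (μ := volume)] with y hy
  rw [hy.lineDeriv_eq_fderiv, ← inner_gradient_left]
theorem weak0 {f : ℕ → E → ℝ} (hf : ∀ j, LipschitzWith K (f j)) (C : ℝ) (hC : ∀ j x, |f j x| ≤ C)
    (h0 : ∀ x, Filter.Tendsto (fun j => f j x) Filter.atTop (nhds 0)) {ψ : E → ℝ} (hψ : Integrable ψ) (v : E) :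
    Filter.Tendsto (fun j => ∫ x, ψ x * ⟪∇ (f j) x, v⟫_ℝ) Filter.atTop (nhds 0) := by
  rw [Metric.tendsto_atTop]
  intro ε hε
  obtain ⟨χ, hχs, hχ, hχn⟩ := ((memLp_one_iff_integrable).2 hψ).exist_eLpNorm_sub_le ENNReal.one_ne_top le_rfl
    (ε := ε / (2 * (K * ‖v‖ + 1))) (by positivity)
  have hχi : Integrable χ := hχ.continuous.integrable_of_hasCompactSupport hχs
  have hd : Integrable (fun x => ψ x - χ x) := hψ.sub hχi
  have hn : ∫ x, ‖ψ x - χ x‖ ≤ ε / (2 * (K * ‖v‖ + 1)) := by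
    rw [← ENNReal.ofReal_le_ofReal_iff (by positivity), ofReal_integral_norm_eq_lintegral_enorm hd]
    rw [eLpNorm_one_eq_lintegral_enorm] at hχn
    exact hχn
  obtain ⟨L, hL⟩ := (hχ.of_le (by norm_num : (1 : WithTop ℕ∞) ≤ _)).lipschitzWith_of_hasCompactSupport hχs (by norm_num)
  have hfd : Continuous fun x => fderiv ℝ χ x (-v) := (hχ.continuous_fderiv (by simp)).clm_apply continuous_const
  have hlim : Filter.Tendsto (fun j => ∫ x, fderiv ℝ χ x (-v) * f j x) Filter.atTop (nhds 0) := by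
    have := tendsto_integral_of_dominated_convergence (μ := (volume : Measure E)) (F := fun j x => fderiv ℝ χ x (-v) * f j x) (f := fun _ => 0)
      (fun x => ‖fderiv ℝ χ x (-v)‖ * C)
      (fun j => (hfd.mul (hf j).continuous).aestronglyMeasurable)
      ((hfd.norm.integrable_of_hasCompactSupport ((hχs.fderiv_apply (𝕜 := ℝ) (-v)).norm)).mul_const _)
      (fun j => Filter.Eventually.of_forall fun x => by
        rw [norm_mul]; exact mul_le_mul_of_nonneg_left (hC j x) (norm_nonneg _))
      (Filter.Eventually.of_forall fun x => by simpa using (h0 x).const_mul (fderiv ℝ χ x (-v)))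
    simpa using this
  rw [Metric.tendsto_atTop] at hlim
  obtain ⟨n, hn2⟩ := hlim (ε / 2) (by positivity)
  refine ⟨n, fun j hj => ?_⟩
  have h1 := hn2 j hj
  rw [Real.dist_eq, sub_zero] at h1 ⊢
  have hb : ∀ x, ‖⟪∇ (f j) x, v⟫_ℝ‖ ≤ K * ‖v‖ := fun x =>
    (norm_inner_le_norm _ _).trans (mul_le_mul_of_nonneg_right (grad_norm_le (hf j) x) (norm_nonneg _))
  have hm : AEStronglyMeasurable (fun x => ⟪∇ (f j) x, v⟫_ℝ) volume :=
    ((meas_grad (f j)).inner measurable_const).aestronglyMeasurable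
  have i1 : Integrable (fun x => (ψ x - χ x) * ⟪∇ (f j) x, v⟫_ℝ) := hd.mul_bdd (c := K * ‖v‖) hm (Filter.Eventually.of_forall hb)
  have i2 : Integrable (fun x => χ x * ⟪∇ (f j) x, v⟫_ℝ) := hχi.mul_bdd (c := K * ‖v‖) hm (Filter.Eventually.of_forall hb)
  have e1 : ∫ x, χ x * ⟪∇ (f j) x, v⟫_ℝ = ∫ x, fderiv ℝ χ x (-v) * f j x := by
    have h := (hf j).integral_lineDeriv_mul_eq (μ := volume) hL hχs v
    rw [integral_congr_ae (g := fun x => χ x * ⟪∇ (f j) x, v⟫_ℝ)] at h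
    · rw [h]
      refine integral_congr_ae (Filter.Eventually.of_forall fun x => ?_)
      simp only
      rw [((hχ.differentiable (by simp)) x).lineDeriv_eq_fderiv]
    · filter_upwards [lineD_ae (hf j) v] with x hx
      rw [hx, mul_comm]
  have e2 : ∫ x, ψ x * ⟪∇ (f j) x, v⟫_ℝ = (∫ x, (ψ x - χ x) * ⟪∇ (f j) x, v⟫_ℝ) + ∫ x, χ x * ⟪∇ (f j) x, v⟫_ℝ := by
    rw [← integral_add i1 i2]
    congr 1; ext x; ring
  rw [e2, e1]
  have h3 : |∫ x, (ψ x - χ x) * ⟪∇ (f j) x, v⟫_ℝ| ≤ (ε / (2 * (K * ‖v‖ + 1))) * (K * ‖v‖) := by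
    calc |∫ x, (ψ x - χ x) * ⟪∇ (f j) x, v⟫_ℝ| ≤ ∫ x, ‖(ψ x - χ x) * ⟪∇ (f j) x, v⟫_ℝ‖ := by
            rw [← Real.norm_eq_abs]; exact norm_integral_le_integral_norm _
      _ ≤ ∫ x, ‖ψ x - χ x‖ * (K * ‖v‖) := by
        refine integral_mono i1.norm (hd.norm.mul_const _) fun x => ?_
        simp only [norm_mul]
        exact mul_le_mul_of_nonneg_left (hb x) (norm_nonneg _)
      _ = (∫ x, ‖ψ x - χ x‖) * (K * ‖v‖) := integral_mul_const _ _
      _ ≤ _ := mul_le_mul_of_nonneg_right hn (by positivity)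
  have h4 : (ε / (2 * (K * ‖v‖ + 1))) * (K * ‖v‖) ≤ ε / 2 := by
    have : (0:ℝ) ≤ K * ‖v‖ := by positivity
    rw [div_mul_eq_mul_div, div_le_div_iff₀ (by positivity) (by positivity)]
    nlinarith
  calc _ ≤ |∫ x, (ψ x - χ x) * ⟪∇ (f j) x, v⟫_ℝ| + |∫ x, fderiv ℝ χ x (-v) * f j x| := abs_add_le _ _
    _ < ε := by linarith
theorem weak_vec {f : ℕ → E → ℝ} (hf : ∀ j, LipschitzWith K (f j)) (C : ℝ) (hC : ∀ j x, |f j x| ≤ C)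
    (h0 : ∀ x, Filter.Tendsto (fun j => f j x) Filter.atTop (nhds 0)) (hψ : Integrable Ψ) :
    Filter.Tendsto (fun j => ∫ x, ⟪Ψ x, ∇ (f j) x⟫_ℝ) Filter.atTop (nhds 0) := by
  let b := stdOrthonormalBasis ℝ E
  have hi : ∀ i, Integrable (fun x => ⟪Ψ x, b i⟫_ℝ) := fun i => hψ.inner_const (b i)
  have h1 := fun i => weak0 hf C hC h0 (hi i) (b i)
  have h2 := tendsto_finsetSum Finset.univ fun i _ => h1 i
  simp only [Finset.sum_const_zero] at h2
  refine h2.congr fun j => ?_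
  rw [← integral_finsetSum]
  · refine integral_congr_ae (Filter.Eventually.of_forall fun x => ?_)
    simp only
    rw [← b.sum_inner_mul_inner]
    refine Finset.sum_congr rfl fun i _ => ?_
    rw [real_inner_comm (b i) (∇ (f j) x)]
  · intro i _
    refine (hi i).mul_bdd (c := K * ‖b i‖) ((meas_grad (f j)).inner measurable_const).aestronglyMeasurable (Filter.Eventually.of_forall fun x => ?_)
    exact (norm_inner_le_norm _ _).trans (mul_le_mul_of_nonneg_right (grad_norm_le (hf j) x) (norm_nonneg _))
theorem int_grad_zero (hφ : LipschitzWith K φ) (hs : HasCompactSupport φ) (v : E) :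
    ∫ x, ⟪∇ φ x, v⟫_ℝ = 0 := by
  have h := (LipschitzWith.const (α := E) (1:ℝ)).integral_lineDeriv_mul_eq (μ := volume) hφ hs (-v)
  simp only [neg_neg, mul_one] at h
  rw [← integral_congr_ae (lineD_ae hφ v), ← h]
  have : ∀ x, lineDeriv ℝ (fun _ : E => (1:ℝ)) x (-v) = 0 := fun x => by simp [lineDeriv]
  simp [this]
theorem aa_sub {F : Type*} [NormedAddCommGroup F] [ProperSpace F] (f : ℕ → E → F)
    (hb : ∀ x, ∃ C, ∀ j, ‖f j x‖ ≤ C)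
    (he : ∀ x ε, 0 < ε → ∃ δ > 0, ∀ y, dist y x < δ → ∀ᶠ j in Filter.atTop, dist (f j x) (f j y) ≤ ε) :
    ∃ φ : ℕ → ℕ, StrictMono φ ∧ ∃ g : E → F, ∀ x, Filter.Tendsto (fun j => f (φ j) x) Filter.atTop (nhds (g x)) := by
  choose C hC using hb
  let D := TopologicalSpace.denseSeq E
  have hcomp : IsCompact (Set.pi univ fun n : ℕ => closedBall (0:F) (C (D n))) :=
    isCompact_univ_pi fun n => isCompact_closedBall _ _
  obtain ⟨a, -, φ, hφ, ha⟩ := hcomp.tendsto_subseq (x := fun j n => f j (D n)) (fun j n _ => by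
    simpa using hC (D n) j)
  rw [tendsto_pi_nhds] at ha
  refine ⟨φ, hφ, ?_⟩
  have : ∀ x, ∃ l, Filter.Tendsto (fun j => f (φ j) x) Filter.atTop (nhds l) := by
    intro x
    apply cauchySeq_tendsto_of_complete
    rw [Metric.cauchySeq_iff']
    intro ε hε
    obtain ⟨δ, hδ, h⟩ := he x (ε / 4) (by positivity)
    obtain ⟨n, hn⟩ := (TopologicalSpace.denseRange_denseSeq E).exists_dist_lt x hδ
    have h1 := h (D n) (by rw [dist_comm]; exact hn)
    have h2 := hφ.tendsto_atTop.eventually h1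
    have h3 := (ha n).cauchySeq
    rw [Metric.cauchySeq_iff] at h3
    obtain ⟨m, hm⟩ := h3 (ε / 4) (by positivity)
    obtain ⟨k, hk⟩ := Filter.eventually_atTop.1 h2
    refine ⟨max m k, fun j hj => ?_⟩
    have a1 := hk j (le_trans (le_max_right _ _) hj)
    have a2 := hk (max m k) (le_max_right _ _)
    have a3 := hm j (le_trans (le_max_left _ _) hj) (max m k) (le_max_left _ _)
    simp only [Function.comp] at a3
    calc _ ≤ dist (f (φ j) x) (f (φ j) (D n)) + dist (f (φ j) (D n)) (f (φ (max m k)) (D n)) +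
        dist (f (φ (max m k)) (D n)) (f (φ (max m k)) x) := dist_triangle4 _ _ _ _
      _ < ε := by rw [dist_comm _ (f (φ (max m k)) x)]; linarith
  choose g hg using this
  exact ⟨g, hg⟩
theorem cross (hx : x ∈ ball c R) (hy : y ∉ ball c R) :
    ∃ z ∈ sphere c R, dist x z + dist z y = dist x y := by
  have hc : ContinuousOn (fun t : ℝ => dist (AffineMap.lineMap x y t) c) (Icc 0 1) := by
    have : Continuous fun t : ℝ => dist (AffineMap.lineMap x y t : E) c := by
      refine Continuous.dist ?_ continuous_const
      exact AffineMap.lineMap_continuous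
    exact this.continuousOn
  have := intermediate_value_Icc (zero_le_one' ℝ) hc
  obtain ⟨t, ht, h⟩ := this (show R ∈ Icc _ _ by
    simp only [AffineMap.lineMap_apply_zero, AffineMap.lineMap_apply_one]
    rw [mem_ball] at hx hy; exact ⟨hx.le, not_lt.1 hy⟩)
  refine ⟨AffineMap.lineMap x y t, h, ?_⟩
  rw [dist_left_lineMap, dist_lineMap_right, Real.norm_of_nonneg ht.1, Real.norm_of_nonneg (by linarith [ht.2])]
  ring
open Classical in
theorem glue {w1 w2 : E → ℝ} (h1 : LipschitzWith K w1) (h2 : LipschitzWith K w2)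
    (h : ∀ x ∈ sphere c R, w1 x = w2 x) : LipschitzWith K (fun x => if x ∈ ball c R then w1 x else w2 x) := by
  have key : ∀ x y, x ∈ ball c R → y ∉ ball c R → dist (w1 x) (w2 y) ≤ K * dist x y := by
    intro x y hx hy
    obtain ⟨z, hz, he⟩ := cross hx hy
    calc _ ≤ dist (w1 x) (w1 z) + dist (w1 z) (w2 y) := dist_triangle _ _ _
      _ ≤ K * dist x z + K * dist z y := add_le_add (h1.dist_le_mul _ _) (by rw [h z hz]; exact h2.dist_le_mul _ _)
      _ = _ := by rw [← he]; ring
  apply LipschitzWith.of_dist_le_mul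
  intro x y
  by_cases hx : x ∈ ball c R <;> by_cases hy : y ∈ ball c R <;> simp only [hx, hy, if_true, if_false]
  · exact h1.dist_le_mul _ _
  · exact key x y hx hy
  · rw [dist_comm, dist_comm x]; exact key y x hy hx
  · exact h2.dist_le_mul _ _
theorem bdd_of_zero (hf : LipschitzWith K f) (hR : 0 < R)
    (h0 : ∀ x, x ∉ ball c R → f x = 0) (x : E) : |f x| ≤ K * (2 * R) := by
  by_cases hx : x ∈ ball c R
  · obtain ⟨y, hy⟩ := NormedSpace.sphere_nonempty (x := c) (r := R).2 hR.le
    have h1 := hf.dist_le_mul x y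
    rw [h0 y (by rw [mem_sphere] at hy; simp [hy]), Real.dist_eq, sub_zero] at h1
    refine h1.trans (mul_le_mul_of_nonneg_left ?_ K.2)
    rw [mem_ball] at hx; rw [mem_sphere] at hy
    linarith [dist_triangle_right x y c]
  · rw [h0 x hx, abs_zero]; positivity
theorem cpt_of_zero (h0 : ∀ x, x ∉ ball c R → f x = 0) : HasCompactSupport f :=
  HasCompactSupport.intro (isCompact_closedBall c R) fun x hx => h0 x fun h => hx (ball_subset_closedBall h)
theorem zero_of_grad (hf : LipschitzWith K f) (hR : 0 < R)
    (h0 : ∀ x, x ∉ ball c R → f x = 0) (h : ∀ᵐ x : E, x ∈ ball c R → ∇ f x = 0) (x : E) : f x = 0 := by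
  by_cases hx : x ∈ ball c R
  · obtain ⟨y, hy⟩ := NormedSpace.sphere_nonempty (x := c) (r := R).2 hR.le
    have h1 : ∀ z ∈ ball c R, f z = f x := by
      intro z hz
      have := ae_lip hf (convex_ball c R) isOpen_ball (le_refl (0:ℝ)) (by filter_upwards [h] with w hw hwb; rw [hw hwb, norm_zero]) hx hz
      rw [zero_mul, abs_nonpos_iff, sub_eq_zero] at this; exact this
    have h2 : y ∈ closure (ball c R) := by
      rw [closure_ball c hR.ne']; exact sphere_subset_closedBall hy
    have h3 : f y = f x := by
      have : IsClosed {z | f z = f x} := isClosed_eq hf.continuous continuous_const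
      exact closure_minimal h1 this h2
    rw [← h3]; exact h0 y (by rw [mem_sphere] at hy; simp [hy])
  · exact h0 x hx
theorem grad_add_at (hf : DifferentiableAt ℝ f x) (hg : DifferentiableAt ℝ g x) :
    ∇ (fun y => f y + g y) x = ∇ f x + ∇ g x := by
  unfold gradient; rw [fderiv_fun_add hf hg, map_add]
theorem grad_smul_at (c : ℝ) :
    ∇ (fun y => c * f y) x = c • ∇ f x := by
  unfold gradient
  rw [show (fun y => c * f y) = c • f from rfl, fderiv_const_smul_field, Pi.smul_apply, map_smul]
theorem grad_add_ae (hf : LipschitzWith K f) (hg : LipschitzWith L g) :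
    ∀ᵐ x : E, ∇ (fun y => f y + g y) x = ∇ f x + ∇ g x := by
  filter_upwards [hf.ae_differentiableAt (μ := volume), hg.ae_differentiableAt (μ := volume)] with x h1 h2
  exact grad_add_at h1 h2
theorem grad_neg_at (f : E → ℝ) (x : E) : ∇ (fun y => - f y) x = - ∇ f x := by
  unfold gradient; rw [fderiv_fun_neg, map_neg]
theorem grad_sub_ae (hf : LipschitzWith K f) (hg : LipschitzWith L g) :
    ∀ᵐ x : E, ∇ (fun y => f y - g y) x = ∇ f x - ∇ g x := by
  filter_upwards [grad_add_ae hf hg.neg] with x h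
  have e : (fun y => f y - g y) = fun y => f y + (-g) y := by ext y; simp [sub_eq_add_neg]
  rw [e, h, sub_eq_add_neg]
  congr 1
  exact grad_neg_at g x
theorem grad_transl (f : E → ℝ) (t x : E) : ∇ (fun y => f (y + t)) x = ∇ f (x + t) := by
  unfold gradient; rw [fderiv_comp_add_right]
theorem lip_transl (hf : LipschitzWith K f) (t : E) : LipschitzWith K (fun x => f (x + t)) :=
  LipschitzWith.of_dist_le_mul fun x y => by
    have := hf.dist_le_mul (x + t) (y + t)
    rwa [dist_add_right] at this
theorem grad_aff (a : ℝ) (b x : E) : ∇ (fun y => a + ⟪b, y⟫_ℝ) x = b := by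
  apply HasGradientAt.gradient
  rw [hasGradientAt_iff_hasFDerivAt]
  exact ((innerSL ℝ b).hasFDerivAt).const_add a
theorem lip_aff (a : ℝ) (b : E) : LipschitzWith ‖b‖₊ (fun y => a + ⟪b, y⟫_ℝ) := by
  apply LipschitzWith.of_dist_le_mul
  intro x y
  rw [Real.dist_eq, show a + ⟪b, x⟫_ℝ - (a + ⟪b, y⟫_ℝ) = ⟪b, x - y⟫_ℝ by rw [inner_sub_right]; ring, dist_eq_norm]
  exact abs_real_inner_le_norm _ _
theorem GG_bd (hp : 1 < p) {Q : ℝ} (h : ‖ξ‖ ≤ Q) : ‖GG δ p ξ‖ ≤ (δ ^ 2 + Q ^ 2) ^ (p / 2) / p := by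
  rw [Real.norm_of_nonneg (GG_nonneg hp ξ)]
  unfold GG
  gcongr
  
theorem Ph_bd (hδ : 0 < δ) {Q : ℝ} (hQ : ‖ξ‖ ≤ Q) : ‖Ph δ p ξ‖ ≤ (1 + |p - 2|) * max (aa δ p 0) (aa δ p Q) * Q := by
  have hQ0 : 0 ≤ Q := (norm_nonneg _).trans hQ
  have h := ell_upper (p := p) hδ (m := max (aa δ p 0) (aa δ p Q)) (0:E) ξ (fun t ht => by
    rw [zero_add]
    refine (aa_le_max hδ le_rfl (norm_nonneg (t • ξ)) ?_ ).2
    rw [norm_smul, Real.norm_of_nonneg ht.1]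
    nlinarith [ht.2, norm_nonneg ξ])
  rw [zero_add] at h
  have h0 : Ph δ p (0:E) = 0 := by simp [Ph]
  rw [h0, sub_zero] at h
  refine h.trans (mul_le_mul_of_nonneg_left hQ ?_)
  have := (aa_pos hδ p 0)
  have := le_max_left (aa δ p 0) (aa δ p Q)
  have := abs_nonneg (p - 2)
  apply mul_nonneg <;> linarith
noncomputable def EE (δ p : ℝ) (c : E) (R : ℝ) (w : E → ℝ) : ℝ := ∫ x in ball c R, GG δ p (∇ w x)
def HX (c : E) (R : ℝ) (g : E → ℝ) (Q : ℝ≥0) (w : E → ℝ) : Prop := LipschitzWith Q w ∧ ∀ x, x ∉ ball c R → w x = g x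
def HM (δ p : ℝ) (c : E) (R : ℝ) (g : E → ℝ) (Q : ℝ≥0) (h : E → ℝ) : Prop := HX c R g Q h ∧ ∀ w, HX c R g Q w → EE δ p c R h ≤ EE δ p c R w
theorem GG_intOn (hp : 1 < p) (c : E) (R : ℝ) (hw : LipschitzWith Q w) :
    IntegrableOn (fun x => GG δ p (∇ w x)) (ball c R) :=
  intOn_of_bdd measurableSet_ball measure_ball_lt_top.ne
    ((GG_cont hp).measurable.comp (meas_grad w)).aestronglyMeasurable _ fun x _ => GG_bd hp (grad_norm_le hw x)
theorem Ph_intOn (hδ : 0 < δ) (c : E) (R : ℝ) (hw : LipschitzWith Q w) (hφ : LipschitzWith L φ) :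
    IntegrableOn (fun x => ⟪Ph δ p (∇ w x), ∇ φ x⟫_ℝ) (ball c R) := by
  refine intOn_of_bdd measurableSet_ball measure_ball_lt_top.ne
    (((Ph_cont hδ).measurable.comp (meas_grad w)).inner (meas_grad φ)).aestronglyMeasurable
    ((1 + |p - 2|) * max (aa δ p 0) (aa δ p Q) * Q * L) fun x _ => ?_
  have h1 := Ph_bd (p := p) hδ (grad_norm_le hw x)
  exact (norm_inner_le_norm _ _).trans (mul_le_mul h1 (grad_norm_le hφ x) (norm_nonneg _) ((norm_nonneg _).trans h1))
theorem HM_exists (hδ : 0 < δ) (hp : 1 < p) (c : E) (hR : 0 < R) (g : E → ℝ) (Q : ℝ≥0)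
    (hg : LipschitzWith Q g) : ∃ h, HM δ p c R g Q h := by
  have hne : (EE δ p c R '' {w | HX c R g Q w}).Nonempty := ⟨_, g, ⟨hg, fun _ _ => rfl⟩, rfl⟩
  have hbd : BddBelow (EE δ p c R '' {w | HX c R g Q w}) := by
    refine ⟨0, ?_⟩
    rintro _ ⟨w, -, rfl⟩
    exact integral_nonneg fun x => GG_nonneg hp _
  obtain ⟨s, -, hs, hsm⟩ := exists_seq_tendsto_sInf hne hbd
  choose w hwX hws using hsm
  have hwX' : ∀ j, HX c R g Q (w j) := hwX
  obtain ⟨φ, hφ, h, hh⟩ := aa_sub w (fun x => ⟨|g x| + (Q + Q) * (2 * R), fun j => by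
      have h1 := bdd_of_zero (c := c) ((hwX' j).1.sub hg) hR (fun x hx => by simp [(hwX' j).2 x hx]) x
      have h2 : ‖w j x‖ ≤ |g x| + |w j x - g x| := by
        rw [Real.norm_eq_abs]
        calc |w j x| = |g x + (w j x - g x)| := by ring_nf
          _ ≤ _ := abs_add_le _ _
      push_cast at h1
      linarith⟩) (fun x ε hε => ⟨ε / (Q + 1), by positivity, fun y hy => Filter.Eventually.of_forall fun j => by
      have h1 := (hwX' j).1.dist_le_mul x y
      rw [dist_comm x y] at h1
      refine h1.trans ?_
      rw [lt_div_iff₀ (by positivity)] at hy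
      nlinarith [dist_nonneg (x := y) (y := x)]⟩)
  have hhX : HX c R g Q h := by
    refine ⟨LipschitzWith.of_dist_le_mul fun x y => ?_, fun x hx => ?_⟩
    · exact le_of_tendsto ((hh x).dist (hh y)) (Filter.Eventually.of_forall fun j => (hwX' (φ j)).1.dist_le_mul x y)
    · refine tendsto_nhds_unique (hh x) ?_
      rw [show (fun j => w (φ j) x) = fun _ => g x from funext fun j => (hwX' (φ j)).2 x hx]
      exact tendsto_const_nhds
  refine ⟨h, hhX, fun v hv => ?_⟩
  have hmin : sInf (EE δ p c R '' {w | HX c R g Q w}) ≤ EE δ p c R v := csInf_le hbd ⟨v, hv, rfl⟩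
  refine le_trans ?_ hmin
  have hΨ : Integrable ((ball c R).indicator fun x => Ph δ p (∇ h x)) := by
    rw [integrable_indicator_iff measurableSet_ball]
    exact intOn_of_bdd measurableSet_ball measure_ball_lt_top.ne
      ((Ph_cont hδ).measurable.comp (meas_grad h)).aestronglyMeasurable _ fun x _ => Ph_bd hδ (grad_norm_le hhX.1 x)
  have hw := weak_vec (f := fun j x => w (φ j) x - h x) (K := Q + Q) (fun j => (hwX' (φ j)).1.sub hhX.1) ((Q + Q : ℝ≥0) * (2 * R))
    (fun j => bdd_of_zero (c := c) ((hwX' (φ j)).1.sub hhX.1) hR fun x hx => by simp [(hwX' (φ j)).2 x hx, hhX.2 x hx])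
    (fun x => by simpa using (hh x).sub_const (h x)) hΨ
  have hs2 := hs.comp hφ.tendsto_atTop
  have := hw.const_add (EE δ p c R h)
  rw [add_zero] at this
  refine le_of_tendsto_of_tendsto' this hs2 fun j => ?_
  simp only [Function.comp, ← hws]
  have e : (∫ x, ⟪(ball c R).indicator (fun x => Ph δ p (∇ h x)) x, ∇ (fun x => w (φ j) x - h x) x⟫_ℝ) =
      ∫ x in ball c R, ⟪Ph δ p (∇ h x), ∇ (fun x => w (φ j) x - h x) x⟫_ℝ := by
    rw [← integral_indicator measurableSet_ball]
    congr 1; ext x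
    by_cases hx : x ∈ ball c R <;> simp [hx]
  rw [e]
  unfold EE
  have i1 := GG_intOn (δ := δ) hp c R hhX.1
  have i2 := Ph_intOn (p := p) hδ c R hhX.1 ((hwX' (φ j)).1.sub hhX.1)
  rw [← integral_add i1 i2]
  refine integral_mono_ae (i1.add i2) (GG_intOn hp c R (hwX' (φ j)).1) ?_
  refine ae_restrict_of_ae ?_
  filter_upwards [grad_sub_ae (hwX' (φ j)).1 hhX.1] with x hx
  rw [hx]
  exact GG_conv hδ hp _ _
theorem HM_uniq (hδ : 0 < δ) (hp : 1 < p) (hR : 0 < R)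
    (hm : HM δ p c R g Q h) (hw : HX c R g Q w) (hE : EE δ p c R w ≤ EE δ p c R h) (x : E) : w x = h x := by
  have hX := hm.1
  set m : E → ℝ := fun x => (2:ℝ)⁻¹ * (h x + w x) with hmdef
  have hmX : HX c R g Q m := by
    refine ⟨LipschitzWith.of_dist_le_mul fun x y => ?_, fun x hx => ?_⟩
    · have h1 := hX.1.dist_le_mul x y
      have h2 := hw.1.dist_le_mul x y
      rw [Real.dist_eq] at *
      rw [show m x - m y = 2⁻¹ * ((h x - h y) + (w x - w y)) by simp [hmdef]; ring, abs_mul, abs_of_pos (by norm_num : (0:ℝ) < 2⁻¹)]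
      have := abs_add_le (h x - h y) (w x - w y)
      linarith
    · simp only [hmdef, hX.2 x hx, hw.2 x hx]; ring
  have h1 := hm.2 m hmX
  have ih := GG_intOn (δ := δ) hp c R hX.1
  have iw := GG_intOn (δ := δ) hp c R hw.1
  have im := GG_intOn (δ := δ) hp c R hmX.1
  have hgm : ∀ᵐ x : E, ∇ m x = (2:ℝ)⁻¹ • (∇ h x + ∇ w x) := by
    filter_upwards [grad_add_ae hX.1 hw.1] with x hx
    rw [hmdef, grad_smul_at, hx]
  have i3 : IntegrableOn (fun x => (GG δ p (∇ h x) + GG δ p (∇ w x)) / 2 - GG δ p (∇ m x)) (ball c R) := ((ih.add iw).div_const 2).sub im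
  have hnn : 0 ≤ᵐ[volume.restrict (ball c R)] fun x => (GG δ p (∇ h x) + GG δ p (∇ w x)) / 2 - GG δ p (∇ m x) := by
    refine ae_restrict_of_ae ?_
    filter_upwards [hgm] with x hx
    simp only [Pi.zero_apply]
    rw [hx]; linarith [(GG_mid hδ hp (∇ h x) (∇ w x)).1]
  have hz : ∫ x in ball c R, ((GG δ p (∇ h x) + GG δ p (∇ w x)) / 2 - GG δ p (∇ m x)) = 0 := by
    apply le_antisymm _ (integral_nonneg_of_ae hnn)
    have i4 : IntegrableOn (fun x => (GG δ p (∇ h x) + GG δ p (∇ w x)) / 2) (ball c R) := (ih.add iw).div_const 2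
    rw [integral_sub i4 im, integral_div]
    have : ∫ x in ball c R, (GG δ p (∇ h x) + GG δ p (∇ w x)) = EE δ p c R h + EE δ p c R w := integral_add ih iw
    rw [show ∫ x in ball c R, GG δ p (∇ m x) = EE δ p c R m from rfl]
    rw [this]
    linarith
  rw [integral_eq_zero_iff_of_nonneg_ae hnn i3] at hz
  have hz2 := (ae_restrict_iff' measurableSet_ball).1 hz
  have := zero_of_grad (hw.1.sub hX.1) hR (c := c) (fun x hx => by simp [hX.2 x hx, hw.2 x hx]) (by
    filter_upwards [hz2, hgm, grad_sub_ae hw.1 hX.1] with x a1 a2 a3 hxb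
    rw [a3, sub_eq_zero]
    have a4 := a1 hxb
    rw [a2] at a4
    simp only [Pi.zero_apply] at a4
    exact ((GG_mid hδ hp (∇ h x) (∇ w x)).2 (by linarith)).symm) x
  linarith
theorem GG_neg (ξ : E) : GG δ p (-ξ) = GG δ p ξ := by simp [GG]
theorem EE_neg (w : E → ℝ) : EE δ p c R (fun x => - w x) = EE δ p c R w := by
  unfold EE
  simp_rw [grad_neg_at, GG_neg]
theorem HX_neg (h : HX c R g Q w) : HX c R (fun x => - g x) Q (fun x => - w x) :=
  ⟨h.1.neg, fun x hx => by simp [h.2 x hx]⟩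
theorem HM_neg (hm : HM δ p c R g Q h) :
    HM δ p c R (fun x => - g x) Q (fun x => - h x) := by
  refine ⟨HX_neg hm.1, fun w hw => ?_⟩
  rw [EE_neg, ← EE_neg w]
  refine hm.2 _ ?_
  simpa using HX_neg hw
open Classical in
theorem HM_cmp (hδ : 0 < δ) (hp : 1 < p) (hR : 0 < R)
    (hm : HM δ p c R g Q h) (a : ℝ) (b : E) (hb : ‖b‖₊ ≤ Q) (hgl : ∀ x ∈ sphere c R, g x ≤ a + ⟪b, x⟫_ℝ) :
    ∀ x ∈ ball c R, h x ≤ a + ⟪b, x⟫_ℝ := by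
  have hX := hm.1
  set l : E → ℝ := fun x => a + ⟪b, x⟫_ℝ with hl
  have hll : LipschitzWith Q l := (lip_aff a b).weaken hb
  set w : E → ℝ := fun x => if x ∈ ball c R then min (h x) (l x) else h x with hw
  have hwX : HX c R g Q w := by
    refine ⟨glue (by simpa using hX.1.min hll) hX.1 fun x hx => ?_, fun x hx => ?_⟩
    · rw [hX.2 x (by rw [mem_sphere] at hx; simp [hx])]
      exact min_eq_left (hgl x hx)
    · simp only [hw, if_neg hx, hX.2 x hx]
  set φ : E → ℝ := fun x => h x - w x with hφ
  have hφl : LipschitzWith (Q + Q) φ := hX.1.sub hwX.1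
  have hφ0 : ∀ x, x ∉ ball c R → φ x = 0 := fun x hx => by simp only [hφ, hw, if_neg hx, sub_self]
  have hφb : ∀ x ∈ ball c R, ∇ φ x = if 0 < h x - l x then ∇ (fun y => h y - l y) x else 0 := by
    intro x hx
    have h1 := grad_pos (W := fun y => h y - l y) (hX.1.continuous.sub hll.continuous) (k := 0) x
    rw [← h1]
    apply grad_congr
    filter_upwards [isOpen_ball.mem_nhds hx] with y hy
    simp only [hφ, hw, if_pos hy, sub_zero]
    rcases le_total (h y) (l y) with h2 | h2
    · rw [min_eq_left h2, max_eq_right (by linarith)]; ring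
    · rw [min_eq_right h2, max_eq_left (by linarith)]
  have hi : ∫ x in ball c R, ⟪∇ φ x, Ph δ p b⟫_ℝ = 0 := by
    rw [← int_grad_zero hφl (cpt_of_zero hφ0) (Ph δ p b)]
    apply setIntegral_eq_integral_of_ae_compl_eq_zero
    have : ∀ᵐ x : E, x ∉ sphere c R := by
      rw [ae_iff]; simp only [not_not]; exact Measure.addHaar_sphere _ _ _
    filter_upwards [this] with x hs hx
    have hxc : x ∈ (closedBall c R)ᶜ := fun hc => by
      rw [mem_closedBall, le_iff_lt_or_eq] at hc
      exact hc.elim (fun h => hx h) fun h => hs h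
    have : ∇ φ x = ∇ (fun _ => (0:ℝ)) x := by
      apply grad_congr
      filter_upwards [isClosed_closedBall.isOpen_compl.mem_nhds hxc] with y hy
      exact hφ0 y fun h => hy (ball_subset_closedBall h)
    rw [this]
    have : ∇ (fun _ : E => (0:ℝ)) x = 0 := by unfold gradient; simp
    rw [this, inner_zero_left]
  have hEE : EE δ p c R w ≤ EE δ p c R h := by
    have ih := GG_intOn (δ := δ) hp c R hX.1
    have iw := GG_intOn (δ := δ) hp c R hwX.1
    have iφ : IntegrableOn (fun x => ⟪∇ φ x, Ph δ p b⟫_ℝ) (ball c R) :=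
      intOn_of_bdd measurableSet_ball measure_ball_lt_top.ne
        ((meas_grad φ).inner measurable_const).aestronglyMeasurable ((Q + Q : ℝ≥0) * ‖Ph δ p b‖) fun x _ =>
          (norm_inner_le_norm _ _).trans (mul_le_mul_of_nonneg_right (grad_norm_le hφl x) (norm_nonneg _))
    have : EE δ p c R w ≤ ∫ x in ball c R, (GG δ p (∇ h x) - ⟪∇ φ x, Ph δ p b⟫_ℝ) := by
      refine integral_mono_ae iw (ih.sub iφ) ?_
      rw [Filter.EventuallyLE, ae_restrict_iff' measurableSet_ball]
      filter_upwards [grad_sub_ae hX.1 hll, grad_sub_ae hX.1 hφl] with x h1 h2 hx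
      have e : (fun y => h y - φ y) = w := by ext y; simp [hφ]
      rw [e] at h2
      rw [h2, hφb x hx]
      split_ifs with h3
      · rw [h1, hl, grad_aff]
        have := GG_conv hδ hp b (∇ h x)
        rw [real_inner_comm (Ph δ p b), sub_sub_cancel]
        linarith
      · simp
    rw [integral_sub ih iφ, hi, sub_zero] at this
    exact this
  intro x hx
  have := HM_uniq hδ hp hR hm hwX hEE x
  simp only [hw, if_pos hx] at this
  rw [← this]; exact min_le_right _ _
theorem HM_cmp' (hδ : 0 < δ) (hp : 1 < p) (hR : 0 < R)
    (hm : HM δ p c R g Q h) (a : ℝ) (b : E) (hb : ‖b‖₊ ≤ Q) (hgl : ∀ x ∈ sphere c R, a + ⟪b, x⟫_ℝ ≤ g x) :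
    ∀ x ∈ ball c R, a + ⟪b, x⟫_ℝ ≤ h x := by
  intro x hx
  have := HM_cmp hδ hp hR (HM_neg hm) (-a) (-b) (by simpa using hb) (fun x hx => by
    have := hgl x hx; simp only [inner_neg_left]; linarith) x hx
  simp only [inner_neg_left] at this
  linarith
theorem HM_bdry (hδ : 0 < δ) (hp : 1 < p) (hR : 0 < R) {Lg : ℝ≥0}
    (hg : LipschitzWith Lg g) (K : ℝ≥0) (hg2 : ∀ x ∈ sphere c R, ∀ y ∈ sphere c R, |g y - g x - ⟪∇ g x, y - x⟫_ℝ| ≤ K * ‖y - x‖ ^ 2)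
    (hQ : (Lg + 2 * K * R : ℝ) ≤ Q) (hm : HM δ p c R g Q h) (x y : E) (hy : y ∉ ball c R) :
    |h x - h y| ≤ (Lg + 2 * K * R) * ‖x - y‖ := by
  have hsph : ∀ z ∈ sphere c R, ∀ x ∈ ball c R, |h x - h z| ≤ (Lg + 2 * K * R) * ‖x - z‖ := by
    intro z hz x hx
    have hzh : h z = g z := hm.1.2 z (by rw [mem_sphere] at hz; simp [hz])
    have hzn : ‖z - c‖ = R := by rw [← dist_eq_norm]; exact hz
    have hsq : ∀ y ∈ sphere c R, ‖y - z‖ ^ 2 = - 2 * ⟪z - c, y - z⟫_ℝ := by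
      intro y hy
      have hyn : ‖y - c‖ = R := by rw [← dist_eq_norm]; exact hy
      have : y - c = (z - c) + (y - z) := by abel
      have h2 := norm_add_sq_real (z - c) (y - z)
      rw [← this, hyn, hzn] at h2
      linarith
    have hbn : ∀ s : ℝ, |s| = 1 → ‖∇ g z - (s * (2 * K)) • (z - c)‖ ≤ Lg + 2 * K * R := by
      intro s hs
      calc _ ≤ ‖∇ g z‖ + ‖(s * (2 * K)) • (z - c)‖ := norm_sub_le _ _
        _ ≤ Lg + 2 * K * R := by
          rw [norm_smul, hzn, norm_mul, Real.norm_eq_abs, hs, one_mul, Real.norm_of_nonneg (by positivity)]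
          exact add_le_add (grad_norm_le hg z) le_rfl
    have hin : ∀ s : ℝ, ∀ y, ⟪∇ g z - (s * (2 * K)) • (z - c), y - z⟫_ℝ = ⟪∇ g z, y - z⟫_ℝ - s * (2 * K) * ⟪z - c, y - z⟫_ℝ := by
      intro s y; rw [inner_sub_left, real_inner_smul_left]
    have hab : ∀ (b : E) y, g z - ⟪b, z⟫_ℝ + ⟪b, y⟫_ℝ = g z + ⟪b, y - z⟫_ℝ := by
      intro b y; rw [inner_sub_right]; ring
    have up := HM_cmp hδ hp hR hm (g z - ⟪∇ g z - ((1:ℝ) * (2 * K)) • (z - c), z⟫_ℝ) (∇ g z - ((1:ℝ) * (2 * K)) • (z - c))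
      (by rw [← NNReal.coe_le_coe, coe_nnnorm]; exact (hbn 1 (by simp)).trans hQ) (fun y hy => by
        rw [hab, hin]
        have h1 := (abs_le.1 (hg2 z hz y hy)).2
        rw [hsq y hy] at h1
        linarith) x hx
    have dn := HM_cmp' hδ hp hR hm (g z - ⟪∇ g z - ((-1:ℝ) * (2 * K)) • (z - c), z⟫_ℝ) (∇ g z - ((-1:ℝ) * (2 * K)) • (z - c))
      (by rw [← NNReal.coe_le_coe, coe_nnnorm]; exact (hbn (-1) (by simp)).trans hQ) (fun y hy => by
        rw [hab, hin]
        have h1 := (abs_le.1 (hg2 z hz y hy)).1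
        rw [hsq y hy] at h1
        linarith) x hx
    rw [hab] at up dn
    rw [hzh]
    have c1 := (abs_real_inner_le_norm (∇ g z - ((1:ℝ) * (2 * K)) • (z - c)) (x - z)).trans (mul_le_mul_of_nonneg_right (hbn 1 (by simp)) (norm_nonneg _))
    have c2 := (abs_real_inner_le_norm (∇ g z - ((-1:ℝ) * (2 * K)) • (z - c)) (x - z)).trans (mul_le_mul_of_nonneg_right (hbn (-1) (by simp)) (norm_nonneg _))
    rw [abs_le] at c1 c2 ⊢
    constructor <;> linarith [c1.2, c2.1]
  have hgQ : ∀ a b : E, |g a - g b| ≤ (Lg + 2 * K * R) * ‖a - b‖ := by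
    intro a b
    have := hg.dist_le_mul a b
    rw [Real.dist_eq, dist_eq_norm] at this
    refine this.trans (mul_le_mul_of_nonneg_right ?_ (norm_nonneg _))
    have : (0:ℝ) ≤ 2 * K * R := by positivity
    linarith
  rw [hm.1.2 y hy]
  by_cases hx : x ∈ ball c R
  · obtain ⟨z, hz, he⟩ := cross hx hy
    have h1 := hsph z hz x hx
    rw [hm.1.2 z (by rw [mem_sphere] at hz; simp [hz])] at h1
    have h2 := hgQ z y
    rw [← dist_eq_norm, ← he, mul_add, dist_eq_norm, dist_eq_norm]
    calc |h x - g y| = |(h x - g z) + (g z - g y)| := by ring_nf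
      _ ≤ |h x - g z| + |g z - g y| := abs_add_le _ _
      _ ≤ _ := add_le_add h1 h2
  · rw [hm.1.2 x hx]; exact hgQ x y
open Classical in
theorem HM_transl (hδ : 0 < δ) (hp : 1 < p) (hR : 0 < R)
    (hm : HM δ p c R g Q h) {Q0 : ℝ} (hb : ∀ x y : E, y ∉ ball c R → |h x - h y| ≤ Q0 * ‖x - y‖) (t x : E) :
    h (x + t) - h x ≤ Q0 * ‖t‖ := by
  have hX := hm.1
  have hht : LipschitzWith Q (fun x => h (x + t)) := by
    exact lip_transl hX.1 t
  have hht' : LipschitzWith Q (fun x => h (x - t)) := by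
    simpa only [sub_eq_add_neg] using lip_transl hX.1 (-t)
  set c0 := Q0 * ‖t‖ with hc0
  set W : E → ℝ := fun x => h (x + t) - h x with hW
  have hWl : LipschitzWith (Q + Q) W := hht.sub hX.1
  set P : E → ℝ := fun x => max (W x - c0) 0 with hP
  have hPl : LipschitzWith (Q + Q) P := by
    have := (hWl.sub (LipschitzWith.const c0)).max_const 0
    simpa using this
  have hPt : LipschitzWith (Q + Q) (fun x => P (x + -t)) := by
    exact lip_transl hPl (-t)
  have hb1 : ∀ x, x ∉ ball c R → W x ≤ c0 := fun x hx => by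
    have := (abs_le.1 (hb (x + t) x hx)).2
    simpa [hW, hc0] using this
  have hb2 : ∀ x, x ∉ ball c R → W (x + -t) ≤ c0 := fun x hx => by
    have := (abs_le.1 (hb (x + -t) x hx)).1
    simp only [hW, hc0, neg_add_cancel_right]
    simp only [add_sub_cancel_left, norm_neg] at this
    linarith
  set h1 : E → ℝ := fun x => h x + P x with hh1
  set h2 : E → ℝ := fun x => h x - P (x + -t) with hh2
  have h1X : HX c R g Q h1 := by
    refine ⟨?_, fun x hx => ?_⟩
    · have e : h1 = fun x => max (h (x + t) - c0) (h x) := by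
        ext x; simp only [hh1, hP, hW]
        rcases le_total (h (x + t) - h x - c0) 0 with h3 | h3
        · rw [max_eq_right h3, max_eq_right (by linarith)]; ring
        · rw [max_eq_left h3, max_eq_left (by linarith)]; ring
      rw [e]
      have := (hht.sub (LipschitzWith.const c0)).max hX.1
      simpa using this
    · simp only [hh1, hP]; rw [max_eq_right (by linarith [hb1 x hx]), add_zero, hX.2 x hx]
  have h2X : HX c R g Q h2 := by
    refine ⟨?_, fun x hx => ?_⟩
    · have e : h2 = fun x => min (h (x - t) + c0) (h x) := by
        ext x; simp only [hh2, hP, hW, neg_add_cancel_right, ← sub_eq_add_neg, sub_add_cancel]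
        rcases le_total (h x - h (x - t) - c0) 0 with h3 | h3
        · rw [max_eq_right h3, min_eq_right (by linarith)]; ring
        · rw [max_eq_left h3, min_eq_left (by linarith)]; ring
      rw [e]
      have := (hht'.add (LipschitzWith.const c0)).min hX.1
      simpa using this
    · simp only [hh2, hP]; rw [max_eq_right (by linarith [hb2 x hx]), sub_zero, hX.2 x hx]
  set D : E → ℝ := fun x => if c0 < W x then GG δ p (∇ h (x + t)) - GG δ p (∇ h x) else 0 with hD
  have hgW : ∀ᵐ x : E, ∇ W x = ∇ h (x + t) - ∇ h x := by
    filter_upwards [grad_sub_ae hht hX.1] with x hx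
    rw [hW, hx, grad_transl]
  have hgP : ∀ᵐ x : E, ∇ P x = if c0 < W x then ∇ h (x + t) - ∇ h x else 0 := by
    filter_upwards [hgW] with x hx
    rw [hP, grad_pos hWl.continuous, hx]
  have e1 : ∀ᵐ x : E, GG δ p (∇ h1 x) = GG δ p (∇ h x) + D x := by
    filter_upwards [hgP, grad_add_ae hX.1 hPl] with x a1 a2
    rw [hh1, a2, a1]; simp only [hD]
    split_ifs
    · rw [add_sub_cancel]; ring
    · simp
  have hgP2 : ∀ᵐ x : E, ∇ P (x + -t) = if c0 < W (x + -t) then ∇ h x - ∇ h (x + -t) else 0 := by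
    have := (measurePreserving_add_right (volume : Measure E) (-t)).quasiMeasurePreserving.ae hgP
    filter_upwards [this] with x hx
    rw [hx]; simp
  have e2 : ∀ᵐ x : E, GG δ p (∇ h2 x) = GG δ p (∇ h x) - D (x + -t) := by
    filter_upwards [hgP2, grad_sub_ae hX.1 hPt] with x a1 a2
    rw [hh2, a2, grad_transl P, a1]; simp only [hD]
    split_ifs
    · rw [sub_sub_cancel, neg_add_cancel_right]; ring
    · simp
  have hDm : Measurable D := by
    refine Measurable.ite (measurableSet_lt measurable_const hWl.continuous.measurable) ?_ measurable_const
    exact (((GG_cont hp).measurable.comp (meas_grad h)).comp (measurable_id.add_const t)).sub ((GG_cont hp).measurable.comp (meas_grad h))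
  have hDb : ∀ x, ‖D x‖ ≤ (δ ^ 2 + (Q:ℝ) ^ 2) ^ (p / 2) / p + (δ ^ 2 + (Q:ℝ) ^ 2) ^ (p / 2) / p := by
    intro x; simp only [hD]
    split_ifs
    · exact (norm_sub_le _ _).trans (add_le_add (GG_bd hp (grad_norm_le hX.1 _)) (GG_bd hp (grad_norm_le hX.1 _)))
    · rw [norm_zero]; have : 0 < p := by linarith
      positivity
  have hD0 : ∀ x, x ∉ ball c R → D x = 0 := fun x hx => if_neg (not_lt.2 (hb1 x hx))
  have hD0' : ∀ x, x ∉ ball c R → D (x + -t) = 0 := fun x hx => if_neg (not_lt.2 (hb2 x hx))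
  have iD : IntegrableOn D (ball c R) := intOn_of_bdd measurableSet_ball measure_ball_lt_top.ne hDm.aestronglyMeasurable _ fun x _ => hDb x
  have iD' : IntegrableOn (fun x => D (x + -t)) (ball c R) := intOn_of_bdd measurableSet_ball measure_ball_lt_top.ne
    (hDm.comp (measurable_id.add_const (-t))).aestronglyMeasurable _ fun x _ => hDb _
  have ih := GG_intOn (δ := δ) hp c R hX.1
  have E1 : EE δ p c R h1 = EE δ p c R h + ∫ x in ball c R, D x := by
    unfold EE; rw [← integral_add ih iD]
    exact integral_congr_ae (ae_restrict_of_ae e1)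
  have E2 : EE δ p c R h2 = EE δ p c R h - ∫ x in ball c R, D (x + -t) := by
    unfold EE; rw [← integral_sub ih iD']
    exact integral_congr_ae (ae_restrict_of_ae e2)
  have E3 : ∫ x in ball c R, D (x + -t) = ∫ x in ball c R, D x := by
    rw [setIntegral_eq_integral_of_forall_compl_eq_zero hD0, setIntegral_eq_integral_of_forall_compl_eq_zero hD0']
    exact integral_add_right_eq_self D (-t)
  have F1 := hm.2 h1 h1X
  have F2 := hm.2 h2 h2X
  have := HM_uniq hδ hp hR hm h1X (by linarith) x
  simp only [hh1, hP, hW] at this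
  have h5 := le_max_left (h (x + t) - h x - c0) 0
  linarith
theorem HM_EL (hδ : 0 < δ) (hp : 1 < p) {Q0 : ℝ≥0}
    (hm : HM δ p c R g Q h) (hQ : Q0 < Q) (hl : LipschitzWith Q0 h) (hφ : LipschitzWith L φ)
    (h0 : ∀ x, x ∉ ball c R → φ x = 0) : 0 ≤ ∫ x in ball c R, ⟪Ph δ p (∇ h x), ∇ φ x⟫_ℝ := by
  have hs : ∀ s : ℝ, 0 < s → s * L ≤ Q - Q0 → 0 ≤ ∫ x in ball c R, ⟪Ph δ p (∇ h x + s • ∇ φ x), ∇ φ x⟫_ℝ := by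
    intro s hs hsL
    have hw : HX c R g Q (fun x => h x + s * φ x) := by
      refine ⟨LipschitzWith.of_dist_le_mul fun x y => ?_, fun x hx => by simp [h0 x hx, hm.1.2 x hx]⟩
      have h1 := hl.dist_le_mul x y
      have h2 := hφ.dist_le_mul x y
      rw [Real.dist_eq] at *
      calc _ = |(h x - h y) + s * (φ x - φ y)| := by ring_nf
        _ ≤ |h x - h y| + |s * (φ x - φ y)| := abs_add_le _ _
        _ ≤ Q0 * dist x y + s * (L * dist x y) := by
          rw [abs_mul, abs_of_pos hs]; gcongr
        _ ≤ Q * dist x y := by nlinarith [dist_nonneg (x := x) (y := y)]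
    have h1 := hm.2 _ hw
    have hsφ : LipschitzWith (Real.toNNReal s * L) (fun x => s * φ x) := by
      apply LipschitzWith.of_dist_le_mul
      intro x y
      have h2 := hφ.dist_le_mul x y
      rw [Real.dist_eq] at *
      rw [← mul_sub, abs_mul, abs_of_pos hs]
      push_cast; rw [Real.coe_toNNReal s hs.le, mul_assoc]; gcongr
    have hgr : ∀ᵐ x : E, ∇ (fun x => h x + s * φ x) x = ∇ h x + s • ∇ φ x := by
      filter_upwards [grad_add_ae hl hsφ] with x hx
      rw [hx, grad_smul_at]
    have iφ := Ph_intOn (p := p) hδ c R hw.1 hφ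
    have h2 : EE δ p c R (fun x => h x + s * φ x) - EE δ p c R h ≤ s * ∫ x in ball c R, ⟪Ph δ p (∇ (fun x => h x + s * φ x) x), ∇ φ x⟫_ℝ := by
      unfold EE
      rw [← integral_sub (GG_intOn hp c R hw.1) (GG_intOn hp c R hl), ← integral_const_mul]
      refine integral_mono_ae ((GG_intOn hp c R hw.1).sub (GG_intOn hp c R hl)) (iφ.const_mul s) (ae_restrict_of_ae ?_)
      filter_upwards [hgr] with x hx
      have := GG_conv hδ hp (∇ (fun x => h x + s * φ x) x) (∇ h x)
      rw [hx] at this ⊢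
      rw [show ∇ h x - (∇ h x + s • ∇ φ x) = -(s • ∇ φ x) by abel, inner_neg_right, real_inner_smul_right] at this
      linarith
    have h3 : 0 ≤ ∫ x in ball c R, ⟪Ph δ p (∇ (fun x => h x + s * φ x) x), ∇ φ x⟫_ℝ := by
      by_contra! hc
      have := mul_neg_of_pos_of_neg hs hc
      linarith
    refine h3.trans_eq (integral_congr_ae (ae_restrict_of_ae ?_))
    filter_upwards [hgr] with x hx
    rw [hx]
  have hlim : Filter.Tendsto (fun n : ℕ => ∫ x in ball c R, ⟪Ph δ p (∇ h x + (((Q - Q0 : ℝ) / (L + 1)) * (1 / ((n:ℝ) + 1))) • ∇ φ x), ∇ φ x⟫_ℝ) Filter.atTop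
      (nhds (∫ x in ball c R, ⟪Ph δ p (∇ h x), ∇ φ x⟫_ℝ)) := by
    have hqq : (0:ℝ) ≤ Q - Q0 := by have : (Q0:ℝ) < Q := hQ; linarith
    refine tendsto_integral_of_dominated_convergence (fun _ => (1 + |p - 2|) * max (aa δ p 0) (aa δ p (Q0 + (Q - Q0) / (L + 1) * L)) * (Q0 + (Q - Q0) / (L + 1) * L) * L) ?_ ?_ ?_ ?_
    · intro n
      exact (((Ph_cont hδ).measurable.comp ((meas_grad h).add ((meas_grad φ).const_smul _))).inner (meas_grad φ)).aestronglyMeasurable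
    · exact integrableOn_const measure_ball_lt_top.ne
    · intro n
      refine Filter.Eventually.of_forall fun x => ?_
      have hn : (1:ℝ) / (n + 1) ≤ 1 := by rw [div_le_one (by positivity)]; linarith [(Nat.cast_nonneg n : (0:ℝ) ≤ n)]
      have hb : ‖∇ h x + (((Q - Q0 : ℝ) / (L + 1)) * (1 / ((n:ℝ) + 1))) • ∇ φ x‖ ≤ Q0 + (Q - Q0) / (L + 1) * L := by
        refine (norm_add_le _ _).trans (add_le_add (grad_norm_le hl x) ?_)
        rw [norm_smul, Real.norm_of_nonneg (by positivity)]
        refine mul_le_mul (mul_le_of_le_one_right (by positivity) hn) (grad_norm_le hφ x) (norm_nonneg _) (by positivity)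
      have h1 := Ph_bd (p := p) hδ hb
      exact (norm_inner_le_norm _ _).trans (mul_le_mul h1 (grad_norm_le hφ x) (norm_nonneg _) ((norm_nonneg _).trans h1))
    · refine Filter.Eventually.of_forall fun x => ?_
      have h1 : Filter.Tendsto (fun n : ℕ => ∇ h x + (((Q - Q0 : ℝ) / (L + 1)) * (1 / ((n:ℝ) + 1))) • ∇ φ x) Filter.atTop (nhds (∇ h x)) := by
        have h2 := ((tendsto_one_div_add_atTop_nhds_zero_nat (𝕜 := ℝ)).const_mul ((Q - Q0 : ℝ) / (L + 1))).smul_const (∇ φ x)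
        simpa using h2.const_add (∇ h x)
      exact (((Ph_cont (p := p) hδ).tendsto _).comp h1).inner tendsto_const_nhds
  refine ge_of_tendsto' hlim fun n => hs _ ?_ ?_
  · have : (0:ℝ) < Q - Q0 := by have : (Q0:ℝ) < Q := hQ; linarith
    positivity
  · have : (0:ℝ) < Q - Q0 := by have : (Q0:ℝ) < Q := hQ; linarith
    have hn : (1:ℝ) / (n + 1) ≤ 1 := by rw [div_le_one (by positivity)]; linarith [(Nat.cast_nonneg n : (0:ℝ) ≤ n)]
    calc (Q - Q0 : ℝ) / (L + 1) * (1 / ((n:ℝ) + 1)) * L ≤ (Q - Q0 : ℝ) / (L + 1) * L := by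
          gcongr; exact mul_le_of_le_one_right (by positivity) hn
      _ ≤ Q - Q0 := by
        rw [div_mul_eq_mul_div, div_le_iff₀ (by positivity)]; nlinarith
theorem HH_exists (hδ : 0 < δ) (hp : 1 < p) (hR : 0 < R) {Lg : ℝ≥0}
    (hg : LipschitzWith Lg g) (K : ℝ≥0) (hg2 : ∀ x ∈ sphere c R, ∀ y ∈ sphere c R, |g y - g x - ⟪∇ g x, y - x⟫_ℝ| ≤ K * ‖y - x‖ ^ 2) :
    ∃ (h : E → ℝ) (Q : ℝ≥0), LipschitzWith Q h ∧ (∀ x, x ∉ ball c R → h x = g x) ∧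
      (∀ (φ : E → ℝ) (L : ℝ≥0), LipschitzWith L φ → (∀ x, x ∉ ball c R → φ x = 0) → ∫ x in ball c R, ⟪Ph δ p (∇ h x), ∇ φ x⟫_ℝ = 0) ∧
      (∀ m, (∀ x ∈ sphere c R, g x ≤ m) → ∀ x ∈ ball c R, h x ≤ m) ∧
      (∀ m, (∀ x ∈ sphere c R, m ≤ g x) → ∀ x ∈ ball c R, m ≤ h x) := by
  set Q0 : ℝ≥0 := Lg + 2 * K * Real.toNNReal R with hQ0
  have hQ0' : (Q0 : ℝ) = Lg + 2 * K * R := by rw [hQ0]; push_cast; rw [Real.coe_toNNReal R hR.le]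
  have hLQ : Lg ≤ Q0 + 1 := by rw [hQ0]; rw [add_assoc]; exact le_self_add
  obtain ⟨h, hm⟩ := HM_exists hδ hp c hR g (Q0 + 1) (hg.weaken hLQ)
  have hb := HM_bdry hδ hp hR hg K hg2 (by rw [← hQ0']; push_cast; linarith) hm
  have hl : LipschitzWith Q0 h := by
    apply LipschitzWith.of_dist_le_mul
    intro x y
    have h1 := HM_transl hδ hp hR hm hb (x - y) y
    have h2 := HM_transl hδ hp hR hm hb (y - x) x
    rw [add_sub_cancel] at h1 h2
    rw [norm_sub_rev] at h2
    rw [Real.dist_eq, hQ0', dist_eq_norm, abs_le]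
    constructor <;> linarith
  refine ⟨h, Q0, hl, hm.1.2, fun φ L hφ h0 => ?_, fun m hm' x hx => ?_, fun m hm' x hx => ?_⟩
  · apply le_antisymm _ (HM_EL hδ hp hm (by simp) hl hφ h0)
    have := HM_EL hδ hp hm (by simp) hl hφ.neg (fun x hx => by simp [h0 x hx])
    have e : ∀ x, ∇ (-φ) x = - ∇ φ x := fun x => grad_neg_at φ x
    simp only [e, inner_neg_right] at this
    rw [integral_neg] at this
    linarith
  · have := HM_cmp hδ hp hR hm m 0 (by simp) (by simpa using hm') x hx
    simpa using this
  · have := HM_cmp' hδ hp hR hm m 0 (by simp) (by simpa using hm') x hx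
    simpa using this
theorem grad_zero_off (h0 : ∀ x, x ∉ ball c R → φ x = 0) :
    ∀ᵐ x : E, x ∉ ball c R → ∇ φ x = 0 := by
  have : ∀ᵐ x : E, x ∉ sphere c R := by
    rw [ae_iff]; simp only [not_not]; exact Measure.addHaar_sphere _ _ _
  filter_upwards [this] with x hs hx
  have hxc : x ∈ (closedBall c R)ᶜ := fun hc => by
    rw [mem_closedBall, le_iff_lt_or_eq] at hc
    exact hc.elim (fun h => hx h) fun h => hs h
  have : ∇ φ x = ∇ (fun _ => (0:ℝ)) x := by
    apply grad_congr
    filter_upwards [isClosed_closedBall.isOpen_compl.mem_nhds hxc] with y hy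
    exact h0 y fun h => hy (ball_subset_closedBall h)
  rw [this]; unfold gradient; simp
theorem set_int_full (h0 : ∀ x, x ∉ ball c R → φ x = 0) :
    ∫ x in ball c R, ⟪Ψ x, ∇ φ x⟫_ℝ = ∫ x, ⟪Ψ x, ∇ φ x⟫_ℝ := by
  apply setIntegral_eq_integral_of_ae_compl_eq_zero
  filter_upwards [grad_zero_off h0] with x hx h
  rw [hx h, inner_zero_right]
theorem int_test (hm : Measurable Ψ) (C : ℝ) (hC : ∀ x, ‖Ψ x‖ ≤ C) (hφ : LipschitzWith L φ)
      (h0 : ∀ x, x ∉ ball c R → φ x = 0) : Integrable (fun x => ⟪Ψ x, ∇ φ x⟫_ℝ) := by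
  have h1 : IntegrableOn (fun x => ⟪Ψ x, ∇ φ x⟫_ℝ) (ball c R) :=
    intOn_of_bdd measurableSet_ball measure_ball_lt_top.ne (hm.inner (meas_grad φ)).aestronglyMeasurable (C * L) fun x _ =>
      (norm_inner_le_norm _ _).trans (mul_le_mul (hC x) (grad_norm_le hφ x) (norm_nonneg _) ((norm_nonneg _).trans (hC x)))
  refine (integrable_indicator_iff measurableSet_ball).2 h1 |>.congr ?_
  filter_upwards [grad_zero_off h0] with x hx
  by_cases h : x ∈ ball c R
  · rw [indicator_of_mem h]
  · rw [indicator_of_notMem h, hx h, inner_zero_right]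
def Sol (δ p : ℝ) (h : E → ℝ) (c : E) (R : ℝ) : Prop := (∃ Q : ℝ≥0, LipschitzWith Q h) ∧
  ∀ (φ : E → ℝ) (L : ℝ≥0), LipschitzWith L φ → (∀ x, x ∉ ball c R → φ x = 0) → ∫ x, ⟪Ph δ p (∇ h x), ∇ φ x⟫_ℝ = 0
theorem Sol.mono {c' : E} {R' : ℝ} (hs : Sol δ p h c R) (hb : ball c' R' ⊆ ball c R) : Sol δ p h c' R' :=
  ⟨hs.1, fun φ L hφ h0 => hs.2 φ L hφ fun x hx => h0 x fun h => hx (hb h)⟩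
noncomputable def dq (h : E → ℝ) (e : E) (τ : ℝ) (x : E) : ℝ := τ⁻¹ * (h (x + τ • e) - h x)
noncomputable def JJ (δ p : ℝ) (h : E → ℝ) (e : E) (τ : ℝ) (x : E) : E := τ⁻¹ • (Ph δ p (∇ h (x + τ • e)) - Ph δ p (∇ h x))
theorem dq_lip (hh : LipschitzWith Q h) (e : E) (hτ : 0 < τ) : ∃ K : ℝ≥0, LipschitzWith K (dq h e τ) := by
  have h1 := (lip_transl hh (τ • e)).sub hh
  refine ⟨_, ((lipschitzWith_smul (τ⁻¹ : ℝ)).comp h1)⟩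
theorem dq_grad (hh : LipschitzWith Q h) (e : E) (τ : ℝ) :
    ∀ᵐ x : E, ∇ (dq h e τ) x = τ⁻¹ • (∇ h (x + τ • e) - ∇ h x) := by
  filter_upwards [grad_sub_ae (lip_transl hh (τ • e)) hh] with x hx
  unfold dq
  rw [grad_smul_at, hx, grad_transl]
theorem dq_bd (hh : LipschitzWith Q h) (he : ‖e‖ = 1) (hτ : 0 < τ) (x : E) : |dq h e τ x| ≤ Q := by
  unfold dq
  have := hh.dist_le_mul (x + τ • e) x
  rw [Real.dist_eq, dist_eq_norm, add_sub_cancel_left, norm_smul, he, mul_one, Real.norm_of_nonneg hτ.le] at this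
  rw [abs_mul, abs_of_pos (inv_pos.2 hτ), inv_mul_le_iff₀ hτ]
  linarith
theorem JJ_meas (hδ : 0 < δ) (h : E → ℝ) (e : E) (τ : ℝ) : Measurable (JJ δ p h e τ) := by
  have h1 := (Ph_cont (p := p) hδ).measurable.comp (meas_grad h)
  exact ((h1.comp (measurable_id.add_const (τ • e))).sub h1).const_smul _
theorem JJ_bd (hδ : 0 < δ) (hh : LipschitzWith Q h) (e : E) (hτ : 0 < τ) :
    ∃ C : ℝ, ∀ x, ‖JJ δ p h e τ x‖ ≤ C := by
  refine ⟨τ⁻¹ * (((1 + |p - 2|) * max (aa δ p 0) (aa δ p Q) * Q) + ((1 + |p - 2|) * max (aa δ p 0) (aa δ p Q) * Q)), fun x => ?_⟩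
  unfold JJ
  rw [norm_smul, Real.norm_of_nonneg (inv_pos.2 hτ).le]
  exact mul_le_mul_of_nonneg_left ((norm_sub_le _ _).trans (add_le_add (Ph_bd hδ (grad_norm_le hh _)) (Ph_bd hδ (grad_norm_le hh _)))) (inv_pos.2 hτ).le
theorem sol_dq (hδ : 0 < δ) (hs : Sol δ p h c R) (he : ‖e‖ = 1) (hτ : 0 < τ) (hρ : ρ + τ ≤ R)
    (φ : E → ℝ) (L : ℝ≥0) (hφ : LipschitzWith L φ) (h0 : ∀ x, x ∉ ball c ρ → φ x = 0) : ∫ x, ⟪JJ δ p h e τ x, ∇ φ x⟫_ℝ = 0 := by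
  obtain ⟨Q, hQ⟩ := hs.1
  have hm := (Ph_cont (p := p) hδ).measurable.comp (meas_grad h)
  have h1 : ∫ x, ⟪Ph δ p (∇ h x), ∇ φ x⟫_ℝ = 0 := hs.2 φ L hφ fun x hx => h0 x fun h => hx (ball_subset_ball (by linarith) h)
  have h2 : ∫ x, ⟪Ph δ p (∇ h x), ∇ (fun y => φ (y + -(τ • e))) x⟫_ℝ = 0 := by
    refine hs.2 _ L (lip_transl hφ _) fun x hx => h0 _ fun h => hx ?_
    rw [mem_ball] at h ⊢
    have : dist x (x + -(τ • e)) = τ := by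
      rw [dist_eq_norm, show x - (x + -(τ • e)) = τ • e by abel, norm_smul, he, mul_one, Real.norm_of_nonneg hτ.le]
    linarith [dist_triangle x (x + -(τ • e)) c]
  have h3 : ∫ x, ⟪Ph δ p (∇ h (x + τ • e)), ∇ φ x⟫_ℝ = 0 := by
    rw [← h2, ← integral_add_right_eq_self (fun x => ⟪Ph δ p (∇ h x), ∇ (fun y => φ (y + -(τ • e))) x⟫_ℝ) (τ • e)]
    congr 1; ext x
    rw [grad_transl, add_neg_cancel_right]
  have i1 := int_test hm _ (fun x => Ph_bd hδ (grad_norm_le hQ x)) hφ h0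
  have i2 := int_test (hm.comp (measurable_id.add_const (τ • e))) _ (fun x => Ph_bd hδ (grad_norm_le hQ _)) hφ h0
  have e1 : ∀ x, ⟪JJ δ p h e τ x, ∇ φ x⟫_ℝ = τ⁻¹ * (⟪Ph δ p (∇ h (x + τ • e)), ∇ φ x⟫_ℝ - ⟪Ph δ p (∇ h x), ∇ φ x⟫_ℝ) := by
    intro x; unfold JJ; rw [real_inner_smul_left, inner_sub_left]
  simp_rw [e1]
  rw [integral_const_mul]
  have : ∫ x, (⟪Ph δ p (∇ h (x + τ • e)), ∇ φ x⟫_ℝ - ⟪Ph δ p (∇ h x), ∇ φ x⟫_ℝ) = 0 := by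
    have := integral_sub i2 i1
    simp only [Function.comp, id] at this
    rw [this, h3, h1, sub_zero]
  rw [this, mul_zero]
theorem cacc (hw : LipschitzWith K w) {Cw : ℝ} (hwb : ∀ x, |w x| ≤ Cw) {J : E → E} (hJm : Measurable J) {CJ : ℝ} (hJb : ∀ x, ‖J x‖ ≤ CJ)
      (heq : ∀ (φ : E → ℝ) (L : ℝ≥0), LipschitzWith L φ → (∀ x, x ∉ ball c ρ → φ x = 0) → ∫ x, ⟪J x, ∇ φ x⟫_ℝ = 0)
    {ψ ψ' : ℝ → ℝ} (hψ : ∀ s, HasDerivAt ψ (ψ' s) s) (hψ0 : ∀ s, 0 < ψ' s) {Kψ : ℝ≥0} (hψl : LipschitzWith Kψ ψ)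
    {Λ T : ℝ} (hl : 0 < l) (hΛ : 0 ≤ Λ) (hT : 0 ≤ T) {Y : E → ℝ} (hYm : Measurable Y) {CY : ℝ} (hYb : ∀ x, Y x ≤ CY) (hY0 : ∀ x, 0 ≤ Y x)
    (hpt : ∀ᵐ x : E, x ∈ ball c ρ → k < w x → ∃ A, 0 ≤ A ∧ l * A * ‖∇ w x‖ ^ 2 ≤ ⟪J x, ∇ w x⟫_ℝ ∧ ‖J x‖ ≤ Λ * A * ‖∇ w x‖ ∧
      A * (ψ (w x) - ψ k) ^ 2 ≤ T * ψ' (w x) ∧ Y x ≤ A * ψ' (w x) * ‖∇ w x‖ ^ 2)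
     (hr : 0 < r) (hrs : r < s) (hs : s ≤ ρ) :
    ∫ x in ball c r ∩ {x | k < w x}, Y x ≤ 4 * (Λ / l) ^ 2 * T / (s - r) ^ 2 * volume.real (ball c s ∩ {x | k < w x}) := by
  set η := cut c r s with hη
  set P : E → ℝ := fun x => max (ψ (w x) - ψ k) 0 with hP
  have hψm : StrictMono ψ := strictMono_of_hasDerivAt_pos hψ fun s => hψ0 s
  have hψw : LipschitzWith (Kψ * K) (fun x => ψ (w x)) := hψl.comp hw
  have hPl : LipschitzWith (Kψ * K) P := by
    simpa using (hψw.sub (LipschitzWith.const (ψ k))).max_const 0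
  have hηl := cut_lip c hrs
  have hη1 : ∀ x, |η x| ≤ (1:ℝ≥0) := fun x => by
    rw [abs_of_nonneg (cut_nonneg c r s x)]; exact cut_le_one c r s x
  have hη2 := lip_mul_bdd hηl hηl 1 1 hη1 hη1
  have hη21 : ∀ x, |η x * η x| ≤ (1:ℝ≥0) := fun x => by
    rw [abs_mul]; have := hη1 x; push_cast at *; nlinarith [abs_nonneg (η x)]
  have hPb : ∀ x, |P x| ≤ (Kψ * Real.toNNReal (Cw + |k|) : ℝ≥0) := fun x => by
    rw [abs_of_nonneg (le_max_right _ _)]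
    have h1 := hψl.dist_le_mul (w x) k
    rw [Real.dist_eq, Real.dist_eq] at h1
    have h2 : |w x - k| ≤ Cw + |k| := (abs_sub _ _).trans (by linarith [hwb x])
    push_cast
    rw [Real.coe_toNNReal _ ((abs_nonneg _).trans h2)]
    refine max_le ((le_abs_self _).trans (h1.trans (by gcongr))) ?_
    exact mul_nonneg Kψ.2 ((abs_nonneg _).trans h2)
  set φ : E → ℝ := fun x => (η x * η x) * P x with hφ
  have hφl := lip_mul_bdd hη2 hPl 1 _ hη21 hPb
  have hφ0 : ∀ x, x ∉ ball c s → φ x = 0 := fun x hx => by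
    rw [hφ]; simp only; rw [hη, cut_zero hrs (by simpa using hx)]; ring
  have h0 := heq φ _ hφl fun x hx => hφ0 x fun h => hx (ball_subset_ball hs h)
  set κ := 2 * Λ ^ 2 * T / (l * (s - r) ^ 2) with hκ
  have hsr : 0 < s - r := by linarith
  have hκ0 : 0 ≤ κ := by positivity
  have hmS : ∀ t, MeasurableSet (ball c t ∩ {x | k < w x}) := fun t =>
    measurableSet_ball.inter (measurableSet_lt measurable_const hw.continuous.measurable)
  have hfin : ∀ t, volume (ball c t ∩ {x | k < w x}) ≠ ∞ := fun t => ((measure_mono inter_subset_left).trans_lt measure_ball_lt_top).ne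
  have hle : ∀ᵐ x : E, (ball c r ∩ {x | k < w x}).indicator (fun x => l / 2 * Y x) x - (ball c s ∩ {x | k < w x}).indicator (fun _ => κ) x ≤ ⟪J x, ∇ φ x⟫_ℝ := by
    filter_upwards [hpt, grad_mul_le hη2 hPl, grad_mul_le hηl hηl, hw.ae_differentiableAt (μ := volume), grad_zero_off hφ0] with x a1 a2 a3 a4 a5
    by_cases hxs : x ∈ ball c s
    swap
    · rw [a5 hxs, inner_zero_right, indicator_of_notMem (fun h => hxs (ball_subset_ball hrs.le h.1)), indicator_of_notMem (fun h => hxs h.1)]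
      simp
    have gP := grad_pos (W := fun x => ψ (w x)) hψw.continuous (k := ψ k) x
    by_cases hk : k < w x
    swap
    · rw [indicator_of_notMem (fun h => hk h.2), indicator_of_notMem (fun h => hk h.2)]
      have hk' : ¬ (ψ k < ψ (w x)) := not_lt.2 (hψm.monotone (not_lt.1 hk))
      rw [if_neg hk'] at gP
      have hP0 : P x = 0 := max_eq_right (by linarith [not_lt.1 hk'])
      rw [hφ, a2, hP, gP, ← hP, hP0]; simp
    have hk' : ψ k < ψ (w x) := hψm hk
    rw [if_pos hk'] at gP
    have gw : ∇ (fun x => ψ (w x)) x = ψ' (w x) • ∇ w x := by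
      apply HasGradientAt.gradient
      rw [hasGradientAt_iff_hasFDerivAt, map_smul, toDual_gradient]
      exact (hψ (w x)).comp_hasFDerivAt x a4.hasFDerivAt
    have hPx : P x = ψ (w x) - ψ k := max_eq_left (by linarith)
    obtain ⟨A, hA0, hA1, hA2, hA3, hA4⟩ := a1 (ball_subset_ball hs hxs) hk
    have hP0 : 0 < P x := by rw [hPx]; linarith
    have hms : x ∈ ball c s ∩ {x | k < w x} := ⟨hxs, hk⟩
    rw [indicator_of_mem hms]
    have e1 : ⟪J x, ∇ φ x⟫_ℝ = η x ^ 2 * ψ' (w x) * ⟪J x, ∇ w x⟫_ℝ + 2 * η x * P x * ⟪J x, ∇ η x⟫_ℝ := by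
      rw [hφ, a2, a3]
      rw [show ∇ P x = _ from gP, gw]
      simp only [inner_add_right, real_inner_smul_right]
      ring
    have hη0 := cut_nonneg c r s x
    have hgη := cut_grad c hrs x
    have h1 : (ball c r ∩ {x | k < w x}).indicator (fun x => l / 2 * Y x) x ≤ l / 2 * (η x ^ 2 * Y x) := by
      by_cases hxr : x ∈ ball c r
      · have hmr : x ∈ ball c r ∩ {x | k < w x} := ⟨hxr, hk⟩
        rw [indicator_of_mem hmr, hη, cut_one hrs (le_of_lt hxr)]; simp
      · rw [indicator_of_notMem (fun h => hxr h.1)]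
        have := hY0 x; positivity
    set X := η x * ‖∇ w x‖ with hX
    have hX0 : 0 ≤ X := mul_nonneg hη0 (norm_nonneg _)
    have hψx := hψ0 (w x)
    have h2 : η x ^ 2 * Y x ≤ A * ψ' (w x) * X ^ 2 := by
      have := mul_le_mul_of_nonneg_left hA4 (sq_nonneg (η x))
      rw [hX]; linarith
    have h3 : l * A * ψ' (w x) * X ^ 2 ≤ η x ^ 2 * ψ' (w x) * ⟪J x, ∇ w x⟫_ℝ := by
      have := mul_le_mul_of_nonneg_left hA1 (mul_nonneg (sq_nonneg (η x)) hψx.le)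
      rw [hX]; linarith
    have h4 : - (2 * P x * Λ * A * X / (s - r)) ≤ 2 * η x * P x * ⟪J x, ∇ η x⟫_ℝ := by
      have h5 : |⟪J x, ∇ η x⟫_ℝ| ≤ Λ * A * ‖∇ w x‖ * (1 / (s - r)) :=
        (abs_real_inner_le_norm _ _).trans (mul_le_mul hA2 hgη (norm_nonneg _) ((norm_nonneg _).trans hA2))
      have h6 := mul_le_mul_of_nonneg_left (abs_le.1 h5).1 (by positivity : 0 ≤ 2 * η x * P x)
      refine le_trans (le_of_eq ?_) h6
      rw [hX]; field_simp
    have h7 : A * (2 * P x * Λ * X / (s - r)) ≤ A * (l / 2 * ψ' (w x) * X ^ 2) + κ := by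
      have h8 : 2 * P x * Λ * X / (s - r) ≤ l / 2 * ψ' (w x) * X ^ 2 + 2 * Λ ^ 2 / (l * (s - r) ^ 2) * (P x ^ 2 / ψ' (w x)) := by
        have h9 : l / 2 * ψ' (w x) * X ^ 2 + 2 * Λ ^ 2 / (l * (s - r) ^ 2) * (P x ^ 2 / ψ' (w x)) - 2 * P x * Λ * X / (s - r) =
            (l * ψ' (w x) * (s - r) * X - 2 * Λ * P x) ^ 2 / (2 * l * ψ' (w x) * (s - r) ^ 2) := by
          field_simp; ring
        have : 0 ≤ (l * ψ' (w x) * (s - r) * X - 2 * Λ * P x) ^ 2 / (2 * l * ψ' (w x) * (s - r) ^ 2) := by positivity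
        linarith
      have h10 : A * (P x ^ 2 / ψ' (w x)) ≤ T := by
        rw [← mul_div_assoc, div_le_iff₀ hψx, hPx]; exact hA3
      have h11 := mul_le_mul_of_nonneg_left h10 (by positivity : 0 ≤ 2 * Λ ^ 2 / (l * (s - r) ^ 2))
      have h12 := mul_le_mul_of_nonneg_left h8 hA0
      have : κ = 2 * Λ ^ 2 / (l * (s - r) ^ 2) * T := by rw [hκ]; ring
      rw [this]; linarith
    rw [e1]
    have : A * (2 * P x * Λ * X / (s - r)) = 2 * P x * Λ * A * X / (s - r) := by ring
    have h13 := mul_le_mul_of_nonneg_left h2 (by positivity : 0 ≤ l / 2)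
    linarith
  have iY : IntegrableOn (fun x => l / 2 * Y x) (ball c r ∩ {x | k < w x}) :=
    intOn_of_bdd (hmS r) (hfin r) (hYm.const_mul _).aestronglyMeasurable (l / 2 * CY) fun x _ => by
      rw [Real.norm_of_nonneg (mul_nonneg (by positivity) (hY0 x))]
      exact mul_le_mul_of_nonneg_left (hYb x) (by positivity)
  have iκ : IntegrableOn (fun _ : E => κ) (ball c s ∩ {x | k < w x}) := integrableOn_const (hfin s)
  have j1 := iY.integrable_indicator (hmS r)
  have j2 := iκ.integrable_indicator (hmS s)
  have hint := integral_mono_ae (j1.sub j2) (int_test hJm CJ hJb hφl hφ0) hle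
  have e2 : ∫ x, ((ball c r ∩ {x | k < w x}).indicator (fun x => l / 2 * Y x) - (ball c s ∩ {x | k < w x}).indicator (fun _ => κ)) x =
      (l / 2 * ∫ x in ball c r ∩ {x | k < w x}, Y x) - volume.real (ball c s ∩ {x | k < w x}) * κ := by
    simp only [Pi.sub_apply]
    rw [integral_sub j1 j2, integral_indicator (hmS r), integral_indicator (hmS s), integral_const_mul, setIntegral_const, smul_eq_mul]
  have hint2 := e2.symm.le.trans hint
  rw [h0] at hint2
  have e3 : 4 * (Λ / l) ^ 2 * T / (s - r) ^ 2 = 2 / l * κ := by rw [hκ]; field_simp; ring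
  rw [e3]
  have h14 := mul_le_mul_of_nonneg_left hint2 (by positivity : 0 ≤ 2 / l)
  have : 2 / l * ((l / 2 * ∫ x in ball c r ∩ {x | k < w x}, Y x) - volume.real (ball c s ∩ {x | k < w x}) * κ) =
    (∫ x in ball c r ∩ {x | k < w x}, Y x) - 2 / l * κ * volume.real (ball c s ∩ {x | k < w x}) := by field_simp
  linarith
theorem Ph_smul (δ p a : ℝ) (ξ : E) : Ph (|a| * δ) p (a • ξ) = ((a ^ 2) ^ ((p - 2) / 2) * a) • Ph δ p ξ := by
  unfold Ph aa
  rw [norm_smul, mul_pow, mul_pow, Real.norm_eq_abs, sq_abs, ← mul_add, Real.mul_rpow (by positivity) (by positivity), smul_smul, smul_smul]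
  congr 1; ring
theorem Sol.smul (hs : Sol δ p h c R) (a : ℝ) : Sol (|a| * δ) p (fun y => a * h y) c R := by
  obtain ⟨⟨Q, hQ⟩, h2⟩ := hs
  refine ⟨⟨_, (lipschitzWith_smul a).comp hQ⟩, fun φ L hφ h0 => ?_⟩
  simp_rw [grad_smul_at, Ph_smul, real_inner_smul_left]
  rw [integral_const_mul, h2 φ L hφ h0, mul_zero]
theorem Sol.neg (hs : Sol δ p h c R) : Sol δ p (fun y => - h y) c R := by
  have := hs.smul (-1)
  simpa using this
theorem dq_neg (h : E → ℝ) (e : E) (τ : ℝ) (x : E) : dq (fun y => - h y) e τ x = - dq h e τ x := by unfold dq; ring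
noncomputable def mm (p a b : ℝ) : ℝ := min (a ^ ((p - 2) / 2)) (b ^ ((p - 2) / 2))
noncomputable def MM (p a b : ℝ) : ℝ := max (a ^ ((p - 2) / 2)) (b ^ ((p - 2) / 2))
theorem rp_rng (ha : 0 < a) (h1 : a ≤ X) (h2 : X ≤ b) : mm p a b ≤ X ^ ((p - 2) / 2) ∧ X ^ ((p - 2) / 2) ≤ MM p a b := by
  unfold mm MM
  rcases le_total p 2 with h | h
  · exact ⟨(min_le_right _ _).trans (Real.rpow_le_rpow_of_nonpos (by linarith) h2 (by linarith)),
      (Real.rpow_le_rpow_of_nonpos ha h1 (by linarith)).trans (le_max_left _ _)⟩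
  · exact ⟨(min_le_left _ _).trans (Real.rpow_le_rpow ha.le h1 (by linarith)),
      (Real.rpow_le_rpow (by linarith) h2 (by linarith)).trans (le_max_right _ _)⟩
theorem mm_pos (ha : 0 < a) (hb : 0 < b) : 0 < mm p a b := lt_min (Real.rpow_pos_of_pos ha _) (Real.rpow_pos_of_pos hb _)
theorem MM_pos (ha : 0 < a) : 0 < MM p a b := lt_max_of_lt_left (Real.rpow_pos_of_pos ha _)
noncomputable def Gm (p a b : ℝ) : ℝ := 2 * ((1 + |p - 2|) * MM p a b / mm p a b) / min 1 (p - 1)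
theorem Gm_nonneg (hp : 1 < p) (ha : 0 < a) (hb : 0 < b) : 0 ≤ Gm p a b := by
  have := mm_pos (p := p) ha hb
  have := MM_pos (p := p) (b := b) ha
  have : 0 < min 1 (p - 1) := lt_min one_pos (by linarith)
  unfold Gm; positivity
theorem JJ_ell (hδ : 0 < δ) (hp : 1 < p) {m1 m2 : ℝ} (hm0 : 0 ≤ m1)
    (hg : ∇ (dq h e τ) x = τ⁻¹ • (∇ h (x + τ • e) - ∇ h x))
    (hm : ∀ t ∈ Icc (0:ℝ) 1, m1 ≤ aa δ p ‖∇ h x + t • (∇ h (x + τ • e) - ∇ h x)‖ ∧ aa δ p ‖∇ h x + t • (∇ h (x + τ • e) - ∇ h x)‖ ≤ m2) :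
    min 1 (p - 1) * m1 * ‖∇ (dq h e τ) x‖ ^ 2 ≤ ⟪JJ δ p h e τ x, ∇ (dq h e τ) x⟫_ℝ ∧ ‖JJ δ p h e τ x‖ ≤ (1 + |p - 2|) * m2 * ‖∇ (dq h e τ) x‖ := by
  have h1 := ell_lower hδ hp hm0 _ _ fun t ht => (hm t ht).1
  have h2 := ell_upper hδ _ _ fun t ht => (hm t ht).2
  rw [add_sub_cancel] at h1 h2
  unfold JJ
  rw [hg, real_inner_smul_left, real_inner_smul_right, norm_smul, norm_smul, mul_pow, Real.norm_eq_abs, sq_abs]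
  constructor
  · have := mul_le_mul_of_nonneg_left h1 (sq_nonneg (τ⁻¹))
    linarith
  · have := mul_le_mul_of_nonneg_left h2 (abs_nonneg (τ⁻¹))
    linarith
theorem dg_lin (hδ : 0 < δ) (hp : 1 < p) {k0 S : ℝ} (hs : Sol δ p h y R) (he : ‖e‖ = 1) (hτ : 0 < τ) (hρ : ρ + τ ≤ R)
    (ha : 0 < a) (hb : 0 < b) (H : ∀ x ∈ ball y ρ, k0 < dq h e τ x → ∀ t ∈ Icc (0:ℝ) 1, a ≤ δ ^ 2 + ‖∇ h x + t • (∇ h (x + τ • e) - ∇ h x)‖ ^ 2 ∧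
      δ ^ 2 + ‖∇ h x + t • (∇ h (x + τ • e) - ∇ h x)‖ ^ 2 ≤ b) (hS : ∀ x ∈ ball y ρ, dq h e τ x ≤ S) :
    DG (dq h e τ) y ρ k0 S (fun k => Gm p a b * (S - k)) := by
  intro k hk0 hkS r s hr hrs hs'
  obtain ⟨Q, hQ⟩ := hs.1
  obtain ⟨K, hK⟩ := dq_lip hQ e hτ
  obtain ⟨CJ, hCJ⟩ := JJ_bd (p := p) hδ hQ e hτ
  have hmp := mm_pos (p := p) ha hb
  have hMp := MM_pos (p := p) (b := b) ha
  have hl : 0 < min 1 (p - 1) := lt_min one_pos (by linarith)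
  have := cacc hK (dq_bd hQ he hτ) (JJ_meas hδ h e τ) hCJ (sol_dq hδ hs he hτ hρ) (ψ := id) (ψ' := fun _ => 1) (fun s => hasDerivAt_id s) (fun _ => one_pos)
    LipschitzWith.id hl (by positivity : 0 ≤ (1 + |p - 2|) * MM p a b / mm p a b) (by positivity : 0 ≤ mm p a b * (S - k) ^ 2)
    (Y := fun x => mm p a b * ‖∇ (dq h e τ) x‖ ^ 2) (((meas_grad _).norm.pow_const 2).const_mul _) (CY := mm p a b * K ^ 2)
    (fun x => by have := grad_norm_le hK x; gcongr) (fun x => by positivity) (k := k) (by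
      filter_upwards [dq_grad hQ e τ] with x hx hxb hkx
      obtain ⟨h1, h2⟩ := JJ_ell (m1 := mm p a b) (m2 := MM p a b) hδ hp hmp.le hx fun t ht => by
        obtain ⟨h3, h4⟩ := H x hxb (hk0.trans_lt hkx) t ht
        exact rp_rng ha h3 h4
      refine ⟨mm p a b, hmp.le, h1, ?_, ?_, ?_⟩
      · rw [div_mul_cancel₀ _ hmp.ne']; exact h2
      · simp only [id, mul_one]
        have := hS x hxb
        have : (dq h e τ x - k) ^ 2 ≤ (S - k) ^ 2 := by apply pow_le_pow_left₀ <;> linarith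
        gcongr
      · simp) hr hrs hs'
  rw [integral_const_mul, ← le_div_iff₀' hmp] at this
  refine this.trans (le_of_eq ?_)
  unfold Gm
  have : s - r ≠ 0 := by linarith
  field_simp; ring
theorem osc_dec (Γ : ℝ) (hΓ : 0 ≤ Γ) : ∃ θ : ℝ, 0 < θ ∧ θ < 1 ∧ ∀ (w : E → ℝ) (K : ℝ≥0), LipschitzWith K w → ∀ (y : E) (ρ m : ℝ), 0 < ρ →
    (∀ ρ', ρ' ≤ ρ → ∀ k0 S, (∀ x ∈ ball y ρ', w x ≤ S) → DG w y ρ' k0 S (fun k => Γ * (S - k))) →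
    (∀ ρ', ρ' ≤ ρ → ∀ k0 S, (∀ x ∈ ball y ρ', - w x ≤ S) → DG (fun x => - w x) y ρ' k0 S (fun k => Γ * (S - k))) →
    (∀ x ∈ ball y ρ, |w x| ≤ m) → ∀ j : ℕ, ∃ I S, S - I ≤ 2 * m * (1 - θ) ^ j ∧ ∀ x ∈ ball y (ρ / 4 ^ j), I ≤ w x ∧ w x ≤ S := by
  obtain ⟨θ, h0, h1, H⟩ := dg2 (E := E) Γ (1 / 2) hΓ (by norm_num)
  refine ⟨θ / 2, by linarith, by linarith, fun w K hw y ρ m hρ d1 d2 hm j => ?_⟩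
  induction j with
  | zero => exact ⟨-m, m, by simp; linarith, fun x hx => abs_le.1 (hm x (by simpa using hx))⟩
  | succ j ih =>
    obtain ⟨I, S, hIS, hb⟩ := ih
    set ρ' := ρ / 4 ^ j with hρ'
    have hρ0 : 0 < ρ' := by positivity
    have hρ1 : ρ' ≤ ρ := div_le_self hρ.le (one_le_pow₀ (by norm_num))
    have e1 : ρ / 4 ^ (j + 1) = ρ' / 4 := by rw [hρ', pow_succ]; field_simp
    have hI : I < S ∨ S - I ≤ 0 := by
      rcases lt_or_ge I S with h | h
      · exact Or.inl h
      · exact Or.inr (by linarith)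
    have hfac : (1 - θ / 2) * (S - I) ≤ 2 * m * (1 - θ / 2) ^ (j + 1) := by
      have := mul_le_mul_of_nonneg_left hIS (by linarith : 0 ≤ 1 - θ / 2)
      rw [pow_succ]; linarith
    rw [e1]
    rcases hI with hI | hI
    swap
    · have hy := hb y (mem_ball_self hρ0)
      have : S - I = 0 := by linarith
      refine ⟨I, S, by rw [this] at hfac ⊢; linarith, fun x hx => hb x (ball_subset_ball (by linarith) hx)⟩
    have hv : 1 / 2 * volume.real (ball y (ρ' / 2)) ≤ volume.real (ball y (ρ' / 2) ∩ {x | w x ≤ (S + I) / 2}) ∨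
        1 / 2 * volume.real (ball y (ρ' / 2)) ≤ volume.real (ball y (ρ' / 2) ∩ {x | - w x ≤ -((S + I) / 2)}) := by
      by_contra! hc
      have h3 : ball y (ρ' / 2) ⊆ (ball y (ρ' / 2) ∩ {x | w x ≤ (S + I) / 2}) ∪ (ball y (ρ' / 2) ∩ {x | - w x ≤ -((S + I) / 2)}) := fun x hx => by
        rcases le_total (w x) ((S + I) / 2) with h | h
        · exact Or.inl ⟨hx, h⟩
        · exact Or.inr ⟨hx, neg_le_neg h⟩
      have h4 := (measureReal_mono h3 (measure_union_ne_top ((measure_mono inter_subset_left).trans_lt measure_ball_lt_top).ne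
        ((measure_mono inter_subset_left).trans_lt measure_ball_lt_top).ne)).trans (measureReal_union_le _ _ (μ := volume))
      linarith [hc.1, hc.2]
    rcases hv with hv | hv
    · have := H w K hw y ρ' ((S + I) / 2) S hρ0 (by linarith) (d1 ρ' hρ1 _ _ fun x hx => (hb x hx).2) (fun x hx => (hb x hx).2) hv
      refine ⟨I, S - θ * (S - (S + I) / 2), by linarith, fun x hx => ⟨(hb x (ball_subset_ball (by linarith) hx)).1, this x hx⟩⟩
    · have := H (fun x => - w x) K hw.neg y ρ' (-((S + I) / 2)) (-I) hρ0 (by linarith) (d2 ρ' hρ1 _ _ fun x hx => neg_le_neg (hb x hx).1) (fun x hx => neg_le_neg (hb x hx).1) hv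
      refine ⟨I + θ * (-I - -((S + I) / 2)), S, by linarith, fun x hx => ⟨by linarith [this x hx], (hb x (ball_subset_ball (by linarith) hx)).2⟩⟩
theorem osc_dq (hp : 1 < p) (ha : 0 < a) (hb : 0 < b) : ∃ θ : ℝ, 0 < θ ∧ θ < 1 ∧ ∀ (δ : ℝ) (h : E → ℝ) (y e : E) (R ρ τ m : ℝ), 0 < δ → Sol δ p h y R →
    ‖e‖ = 1 → 0 < τ → 0 < ρ → ρ + τ ≤ R → (∀ x ∈ ball y ρ, ∀ t ∈ Icc (0:ℝ) 1, a ≤ δ ^ 2 + ‖∇ h x + t • (∇ h (x + τ • e) - ∇ h x)‖ ^ 2 ∧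
      δ ^ 2 + ‖∇ h x + t • (∇ h (x + τ • e) - ∇ h x)‖ ^ 2 ≤ b) → (∀ x ∈ ball y ρ, |dq h e τ x| ≤ m) →
    ∀ j : ℕ, ∀ x ∈ ball y (ρ / 4 ^ j), ∀ x' ∈ ball y (ρ / 4 ^ j), dq h e τ x - dq h e τ x' ≤ 2 * m * (1 - θ) ^ j := by
  obtain ⟨θ, h0, h1, H⟩ := osc_dec (E := E) (Gm p a b) (Gm_nonneg hp ha hb)
  refine ⟨θ, h0, h1, fun δ h y e R ρ τ m hδ hs he hτ hρ hR hab hm j x hx x' hx' => ?_⟩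
  obtain ⟨Q, hQ⟩ := hs.1
  obtain ⟨K, hK⟩ := dq_lip hQ e hτ
  obtain ⟨I, S, h2, h3⟩ := H (dq h e τ) K hK y ρ m hρ (fun ρ' hρ' k0 S hS => dg_lin hδ hp hs he hτ (by linarith) ha hb
      (fun x hx _ => hab x (ball_subset_ball hρ' hx)) hS) (fun ρ' hρ' k0 S hS => by
      have e1 : (fun x => - dq h e τ x) = dq (fun y => - h y) e τ := by ext x; rw [dq_neg]
      rw [e1]
      refine dg_lin hδ hp hs.neg he hτ (by linarith) ha hb (fun x hx _ t ht => ?_) (fun x hx => by rw [dq_neg]; exact hS x hx)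
      rw [grad_neg_at, grad_neg_at, show -∇ h x + t • (-∇ h (x + τ • e) - -∇ h x) = -(∇ h x + t • (∇ h (x + τ • e) - ∇ h x)) by module, norm_neg]
      exact hab x (ball_subset_ball hρ' hx) t ht) hm j
  linarith [(h3 x hx).2, (h3 x' hx').1]
theorem dq_lim (hd : DifferentiableAt ℝ h x) (e : E) : Filter.Tendsto (fun τ => dq h e τ x) (nhdsWithin 0 (Ioi 0)) (nhds ⟪∇ h x, e⟫_ℝ) := by
  have := hd.hasFDerivAt.hasLineDerivAt e
  rw [← inner_gradient_left] at this
  have h2 := this.tendsto_slope_zero_right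
  simpa [dq] using h2
theorem taylor (hf : LipschitzWith K f) (hε : 0 ≤ ε) (h : ∀ᵐ y : E, y ∈ ball x r → ‖∇ f y - ξ‖ ≤ ε) (hy : y ∈ ball x r) :
    |f y - f x - ⟪ξ, y - x⟫_ℝ| ≤ ε * ‖y - x‖ := by
  have h1 := hf.sub (lip_aff 0 ξ)
  have := ae_lip h1 (convex_ball x r) isOpen_ball hε (by
    filter_upwards [h, grad_sub_ae hf (lip_aff 0 ξ)] with z hz1 hz2 hz
    rw [hz2, grad_aff]; exact hz1 hz) (mem_ball_self (pos_of_mem_ball hy)) hy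
  simp only [zero_add] at this
  rw [inner_sub_right]
  rwa [show f y - f x - (⟪ξ, y⟫_ℝ - ⟪ξ, x⟫_ℝ) = f y - ⟪ξ, y⟫_ℝ - (f x - ⟪ξ, x⟫_ℝ) by ring]
theorem diff_of_unif (hf : LipschitzWith K f)
    (h : ∀ ε > 0, ∃ r > 0, ∀ x ∈ ball x0 r, ∀ x' ∈ ball x0 r, DifferentiableAt ℝ f x → DifferentiableAt ℝ f x' → ‖∇ f x - ∇ f x'‖ ≤ ε) :
    DifferentiableAt ℝ f x0 := by
  have hd := Measure.dense_of_ae (hf.ae_differentiableAt (μ := volume))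
  have hex : ∀ n : ℕ, ∃ x, DifferentiableAt ℝ f x ∧ dist x x0 < 1 / ((n:ℝ) + 1) := fun n => by
    obtain ⟨x, hx, h2⟩ := hd.exists_dist_lt x0 (by positivity : (0:ℝ) < 1 / ((n:ℝ) + 1))
    exact ⟨x, hx, by rwa [dist_comm]⟩
  choose x hx1 hx2 using hex
  obtain ⟨ξ, _, φ, hφ, hlim⟩ := (isCompact_closedBall (0:E) K).tendsto_subseq (x := fun n => ∇ f (x n)) fun n => by simpa using grad_norm_le hf _
  refine HasGradientAt.differentiableAt (f' := ξ) ?_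
  rw [hasGradientAt_iff_isLittleO]
  refine Asymptotics.IsLittleO.of_bound fun ε hε => ?_
  obtain ⟨r, hr, H⟩ := h ε hε
  have hxr : ∀ᶠ n in Filter.atTop, x (φ n) ∈ ball x0 r := by
    obtain ⟨n, hn⟩ := exists_nat_one_div_lt hr
    filter_upwards [hφ.tendsto_atTop.eventually_ge_atTop n] with m hm
    refine (hx2 _).trans (lt_of_le_of_lt ?_ hn)
    gcongr
  filter_upwards [ball_mem_nhds x0 hr] with y hy
  refine taylor hf hε.le ?_ hy
  filter_upwards [hf.ae_differentiableAt (μ := volume)] with z hz hzr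
  refine le_of_tendsto ((tendsto_const_nhds.sub hlim).norm) ?_
  filter_upwards [hxr] with n hn
  exact H z hzr _ hn hz (hx1 _)
theorem norm_le_of_inner {v : E} (hm : 0 ≤ m) (h : ∀ e : E, ‖e‖ = 1 → ⟪v, e⟫_ℝ ≤ m) : ‖v‖ ≤ m := by
  by_cases hv : v = 0
  · rw [hv, norm_zero]; exact hm
  have hv' : ‖v‖ ≠ 0 := norm_ne_zero_iff.2 hv
  have := h (‖v‖⁻¹ • v) (by rw [norm_smul, norm_inv, norm_norm, inv_mul_cancel₀ hv'])
  rwa [real_inner_smul_right, real_inner_self_eq_norm_sq, sq, inv_mul_cancel_left₀ hv'] at this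
theorem sol_C1 (hδ : 0 < δ) (hp : 1 < p) (hs : Sol δ p h c R) (hx : x ∈ ball c R) :
    DifferentiableAt ℝ h x ∧ ContinuousAt (fun x => ∇ h x) x := by
  obtain ⟨Q, hQ⟩ := hs.1
  obtain ⟨θ, h0, h1, H⟩ := osc_dq (E := E) (a := δ ^ 2) (b := δ ^ 2 + Q ^ 2) hp (by positivity) (by positivity)
  have key : ∀ x0 ∈ ball c R, ∀ ε > 0, ∃ r > 0, ∀ x ∈ ball x0 r, ∀ x' ∈ ball x0 r, DifferentiableAt ℝ h x → DifferentiableAt ℝ h x' → ‖∇ h x - ∇ h x'‖ ≤ ε := by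
    intro x0 hx0 ε hε
    obtain ⟨r, hr, hrb⟩ := Metric.isOpen_iff.1 (isOpen_ball (x := c) (ε := R)) x0 hx0
    have hs0 := hs.mono hrb
    have ht : Filter.Tendsto (fun j : ℕ => 2 * (Q:ℝ) * (1 - θ) ^ j) Filter.atTop (nhds (2 * Q * 0)) :=
      (tendsto_pow_atTop_nhds_zero_of_lt_one (by linarith) (by linarith)).const_mul _
    rw [mul_zero] at ht
    obtain ⟨j, hj⟩ := (ht.eventually_lt_const hε).exists
    refine ⟨r / 2 / 4 ^ j, by positivity, fun x hx x' hx' hd hd' => ?_⟩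
    refine (norm_le_of_inner (m := 2 * Q * (1 - θ) ^ j) (mul_nonneg (by positivity) (pow_nonneg (by linarith) _)) fun e he => ?_).trans hj.le
    rw [inner_sub_left]
    refine le_of_tendsto ((dq_lim hd e).sub (dq_lim hd' e)) ?_
    filter_upwards [Ioo_mem_nhdsGT (by positivity : 0 < r / 2)] with τ hτ
    refine H δ h x0 e r (r / 2) τ Q hδ hs0 he hτ.1 (by positivity) (by linarith [hτ.2]) (fun x _ t ht => ?_) (fun x _ => dq_bd hQ he hτ.1 x) j x hx x' hx'
    have := seg_norm (∇ h x) (∇ h (x + τ • e) - ∇ h x) ht (grad_norm_le hQ x) (by rw [add_sub_cancel]; exact grad_norm_le hQ _)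
    constructor
    · nlinarith
    · gcongr
  have hd : ∀ x0 ∈ ball c R, DifferentiableAt ℝ h x0 := fun x0 hx0 => diff_of_unif hQ (key x0 hx0)
  refine ⟨hd x hx, Metric.continuousAt_iff.2 fun ε hε => ?_⟩
  obtain ⟨r, hr, H⟩ := key x hx (ε / 2) (by positivity)
  obtain ⟨r', hr', hrb⟩ := Metric.isOpen_iff.1 (isOpen_ball (x := c) (ε := R)) x hx
  refine ⟨min r r', by positivity, fun y hy => ?_⟩
  have := H y (lt_of_lt_of_le hy (min_le_left _ _)) x (mem_ball_self hr) (hd y (hrb (lt_of_lt_of_le hy (min_le_right _ _)))) (hd x hx)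
  rw [dist_eq_norm]; linarith
theorem vmono {A : Set E} (h : A ⊆ B) : volume.real (ball c r ∩ A) ≤ volume.real (ball c r ∩ B) :=
  measureReal_mono (inter_subset_inter_right _ h) ((measure_mono inter_subset_left).trans_lt measure_ball_lt_top).ne
theorem vmono' {A : Set E} (h : ∀ x ∈ ball c r, x ∈ A → x ∈ B) : volume.real (ball c r ∩ A) ≤ volume.real (ball c r ∩ B) :=
  measureReal_mono (fun x hx => ⟨hx.1, h x hx.1 hx.2⟩) ((measure_mono inter_subset_left).trans_lt measure_ball_lt_top).ne
theorem shift_mem (he : ‖e‖ = 1) (hτ : 0 < τ) (hR : ρ + τ ≤ R) (hx : x ∈ ball c ρ) : x + τ • e ∈ ball c R := by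
  rw [mem_ball] at *
  have : dist (x + τ • e) x = τ := by rw [dist_eq_norm, add_sub_cancel_left, norm_smul, he, mul_one, Real.norm_of_nonneg hτ.le]
  linarith [dist_triangle (x + τ • e) x c]
theorem unifC1 (hδ : 0 < δ) (hp : 1 < p) (hs : Sol δ p h c R) (hρ : ρ < R) (hε : 0 < ε) :
    ∃ τ0 > 0, ∀ τ ∈ Ioo 0 τ0, ρ + τ ≤ R ∧ ∀ e : E, ‖e‖ = 1 → ∀ x ∈ ball c ρ, ‖∇ h (x + τ • e) - ∇ h x‖ ≤ ε ∧ |dq h e τ x - ⟪∇ h x, e⟫_ℝ| ≤ ε := by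
  obtain ⟨Q, hQ⟩ := hs.1
  have hc : ContinuousOn (fun x => ∇ h x) (closedBall c ((ρ + R) / 2)) := fun x hx =>
    (sol_C1 hδ hp hs (closedBall_subset_ball (by linarith) hx)).2.continuousWithinAt
  obtain ⟨d, hd, H⟩ := Metric.uniformContinuousOn_iff.1 ((isCompact_closedBall _ _).uniformContinuousOn_of_continuous hc) ε hε
  refine ⟨min d ((R - ρ) / 2), lt_min hd (by linarith), fun τ hτ => ?_⟩
  have h1 : τ < d := hτ.2.trans_le (min_le_left _ _)
  have h2 : τ < (R - ρ) / 2 := hτ.2.trans_le (min_le_right _ _)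
  refine ⟨by linarith, fun e he x hx => ?_⟩
  have key : ∀ y ∈ ball x (min d ((R - ρ) / 2)), ‖∇ h y - ∇ h x‖ ≤ ε := fun y hy => by
    have h3 : dist y x < d := lt_of_lt_of_le hy (min_le_left _ _)
    have h4 : dist y x < (R - ρ) / 2 := lt_of_lt_of_le hy (min_le_right _ _)
    rw [mem_ball] at hx
    have := H y (by rw [mem_closedBall]; linarith [dist_triangle y x c]) x (by rw [mem_closedBall]; linarith) h3
    rw [dist_eq_norm] at this; exact this.le
  have hm : x + τ • e ∈ ball x (min d ((R - ρ) / 2)) := by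
    rw [mem_ball, dist_eq_norm, add_sub_cancel_left, norm_smul, he, mul_one, Real.norm_of_nonneg hτ.1.le]; exact hτ.2
  refine ⟨key _ hm, ?_⟩
  have := taylor hQ hε.le (Filter.Eventually.of_forall key) hm
  rw [add_sub_cancel_left, norm_smul, he, mul_one, Real.norm_of_nonneg hτ.1.le, real_inner_smul_right] at this
  have e1 : dq h e τ x - ⟪∇ h x, e⟫_ℝ = τ⁻¹ * (h (x + τ • e) - h x - τ * ⟪∇ h x, e⟫_ℝ) := by
    unfold dq; have := hτ.1.ne'; field_simp
  rw [e1, abs_mul, abs_of_pos (inv_pos.2 hτ.1), inv_mul_le_iff₀ hτ.1]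
  linarith
theorem dq_bd' (hQ : LipschitzWith Q h) (hm0 : 0 ≤ m) (hm : ∀ x ∈ ball c R, ‖∇ h x‖ ≤ m) (he : ‖e‖ = 1)
    (hτ : 0 < τ) (hR : ρ + τ ≤ R) (hx : x ∈ ball c ρ) : |dq h e τ x| ≤ m := by
  have := ae_lip hQ (convex_ball c R) isOpen_ball hm0 (Filter.Eventually.of_forall hm) (ball_subset_ball (by linarith) hx) (shift_mem he hτ hR hx)
  rw [add_sub_cancel_left, norm_smul, he, mul_one, Real.norm_of_nonneg hτ.le] at this
  unfold dq
  rw [abs_mul, abs_of_pos (inv_pos.2 hτ), inv_mul_le_iff₀ hτ]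
  linarith
theorem dq_lim_le (hd : DifferentiableAt ℝ h x) {τ0 : ℝ} (h0 : 0 < τ0) (H : ∀ τ ∈ Ioo 0 τ0, dq h e τ x ≤ m) : ⟪∇ h x, e⟫_ℝ ≤ m := by
  refine le_of_tendsto (dq_lim hd e) ?_
  filter_upwards [Ioo_mem_nhdsGT h0] with τ hτ using H τ hτ
theorem seg_lower (ht : t ∈ Icc (0:ℝ) 1) (hD : ‖D‖ ≤ ε) : ‖ξ‖ - ε ≤ ‖ξ + t • D‖ := by
  have h1 : ‖t • D‖ ≤ ε := by
    rw [norm_smul, Real.norm_of_nonneg ht.1]; nlinarith [ht.2, norm_nonneg D]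
  have h2 := norm_sub_le (ξ + t • D) (t • D)
  rw [add_sub_cancel_right] at h2
  linarith
theorem osc_grad (hp : 1 < p) : ∃ θ : ℝ, 0 < θ ∧ θ < 1 ∧ ∀ (δ : ℝ) (h : E → ℝ) (c : E) (R ρ m : ℝ), 0 < δ → δ ≤ 1 → Sol δ p h c R → 0 < ρ → ρ < R →
    0 ≤ m → m ≤ 1 → (∀ x ∈ ball c R, ‖∇ h x‖ ≤ m) → (∀ x ∈ ball c R, 1 / 16 ≤ δ ^ 2 + ‖∇ h x‖ ^ 2) →
    ∀ j : ℕ, ∀ x ∈ ball c (ρ / 4 ^ j), ∀ x' ∈ ball c (ρ / 4 ^ j), ‖∇ h x - ∇ h x'‖ ≤ 2 * m * (1 - θ) ^ j := by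
  obtain ⟨θ, h0, h1, H⟩ := osc_dq (E := E) (a := 1 / 32) (b := 2) hp (by norm_num) (by norm_num)
  refine ⟨θ, h0, h1, fun δ h c R ρ m hδ hδ1 hs hρ hρR hm0 hm1 hm hlow j x hx x' hx' => ?_⟩
  obtain ⟨Q, hQ⟩ := hs.1
  obtain ⟨τ0, hτ0, hu⟩ := unifC1 hδ hp hs hρR (by norm_num : (0:ℝ) < 1 / 64)
  have hsub : ball c (ρ / 4 ^ j) ⊆ ball c R := ball_subset_ball ((div_le_self hρ.le (one_le_pow₀ (by norm_num))).trans hρR.le)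
  refine norm_le_of_inner (mul_nonneg (by positivity) (pow_nonneg (by linarith) _)) fun e he => ?_
  rw [inner_sub_left]
  refine le_of_tendsto ((dq_lim (sol_C1 hδ hp hs (hsub hx)).1 e).sub (dq_lim (sol_C1 hδ hp hs (hsub hx')).1 e)) ?_
  filter_upwards [Ioo_mem_nhdsGT hτ0] with τ hτ
  obtain ⟨hR, hu2⟩ := hu τ hτ
  refine H δ h c e R ρ τ m hδ hs he hτ.1 hρ hR (fun x hx t ht => ?_) (fun x hx => dq_bd' hQ hm0 hm he hτ.1 hR hx) j x hx x' hx'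
  have hxR := ball_subset_ball hρR.le hx
  have h2 := seg_norm (∇ h x) (∇ h (x + τ • e) - ∇ h x) ht (hm x hxR) (by rw [add_sub_cancel]; exact hm _ (shift_mem he hτ.1 hR hx))
  have h3 := seg_lower (ξ := ∇ h x) ht (hu2 e he x hx).1
  have h4 := hlow x hxR
  have h5 := hm x hxR
  have h6 := norm_nonneg (∇ h x)
  have h7 := norm_nonneg (∇ h x + t • (∇ h (x + τ • e) - ∇ h x))
  constructor
  · nlinarith
  · nlinarith
theorem dgB (hδ : 0 < δ) (hδ1 : δ ≤ 1) (hp : 1 < p) (hs : Sol δ p h c R) (hρ : ρ < R) (hm : ∀ x ∈ ball c R, ‖∇ h x‖ ≤ 1) :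
    ∃ τ0 > 0, ∀ τ ∈ Ioo 0 τ0, ρ + τ ≤ R ∧ ∀ e : E, ‖e‖ = 1 → (∀ x ∈ ball c ρ, dq h e τ x ≤ 1 ∧ |dq h e τ x - ⟪∇ h x, e⟫_ℝ| ≤ 1 / 16) ∧
      DG (dq h e τ) c ρ (3 / 8) 1 (fun k => Gm p (1 / 16) 2 * (1 - k)) := by
  obtain ⟨Q, hQ⟩ := hs.1
  obtain ⟨τ0, hτ0, hu⟩ := unifC1 hδ hp hs hρ (by norm_num : (0:ℝ) < 1 / 16)
  refine ⟨τ0, hτ0, fun τ hτ => ⟨(hu τ hτ).1, fun e he => ?_⟩⟩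
  obtain ⟨hR, hu2⟩ := hu τ hτ
  have h1 : ∀ x ∈ ball c ρ, dq h e τ x ≤ 1 := fun x hx => (le_abs_self _).trans (dq_bd' hQ zero_le_one hm he hτ.1 hR hx)
  refine ⟨fun x hx => ⟨h1 x hx, (hu2 e he x hx).2⟩, dg_lin hδ hp hs he hτ.1 hR (by norm_num) (by norm_num) (fun x hx hk t ht => ?_) h1⟩
  have hxR := ball_subset_ball hρ.le hx
  have h2 := seg_norm (∇ h x) (∇ h (x + τ • e) - ∇ h x) ht (hm x hxR) (by rw [add_sub_cancel]; exact hm _ (shift_mem he hτ.1 hR hx))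
  have h3 := seg_lower (ξ := ∇ h x) ht (hu2 e he x hx).1
  have h4 := (abs_le.1 (hu2 e he x hx).2).2
  have h5 := real_inner_le_norm (∇ h x) e
  rw [he, mul_one] at h5
  have h7 := norm_nonneg (∇ h x + t • (∇ h (x + τ • e) - ∇ h x))
  have h8 : 1 / 4 ≤ ‖∇ h x + t • (∇ h (x + τ • e) - ∇ h x)‖ := by linarith
  constructor <;> nlinarith
theorem caseB {μ : ℝ} (hp : 1 < p) (hμ : 0 < μ) : ∃ θ : ℝ, 0 < θ ∧ θ < 1 ∧ ∀ (δ : ℝ) (h : E → ℝ) (c e : E) (R ρ : ℝ), 0 < δ → δ ≤ 1 → Sol δ p h c R → 0 < ρ → ρ < R →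
    (∀ x ∈ ball c R, ‖∇ h x‖ ≤ 1) → ‖e‖ = 1 → μ * volume.real (ball c (ρ / 2)) ≤ volume.real (ball c (ρ / 2) ∩ {x | ⟪∇ h x, e⟫_ℝ ≤ 1 / 2}) →
    ∀ x ∈ ball c (ρ / 4), ⟪∇ h x, e⟫_ℝ ≤ 1 - θ := by
  obtain ⟨θ, h0, h1, H⟩ := dg2 (E := E) (Gm p (1 / 16) 2) μ (Gm_nonneg hp (by norm_num) (by norm_num)) hμ
  refine ⟨θ / 4, by linarith, by linarith, fun δ h c e R ρ hδ hδ1 hs hρ hρR hm he hv x hx => ?_⟩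
  obtain ⟨Q, hQ⟩ := hs.1
  obtain ⟨τ0, hτ0, hu⟩ := dgB hδ hδ1 hp hs hρR hm
  refine dq_lim_le (sol_C1 hδ hp hs (ball_subset_ball (by linarith) hx)).1 hτ0 fun τ hτ => ?_
  obtain ⟨hb, hdg⟩ := (hu τ hτ).2 e he
  obtain ⟨K, hK⟩ := dq_lip hQ e hτ.1
  have := H _ K hK c ρ (3 / 4) 1 hρ (by norm_num) (fun k hk => hdg k (by linarith)) (fun x hx => (hb x hx).1) (hv.trans (vmono' fun x hx hx2 => by
    have h2 := (abs_le.1 (hb x (ball_subset_ball (by linarith) hx)).2).2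
    have h3 : ⟪∇ h x, e⟫_ℝ ≤ 1 / 2 := hx2
    show dq h e τ x ≤ 3 / 4
    linarith)) x hx
  linarith
theorem caseR (hp : 1 < p) : ∃ ν : ℝ, 0 < ν ∧ ∀ (δ : ℝ) (h : E → ℝ) (c : E) (R ρ : ℝ), 0 < δ → δ ≤ 1 → Sol δ p h c R → 0 < ρ → ρ < R →
    (∀ x ∈ ball c R, ‖∇ h x‖ ≤ 1) → volume.real (ball c ρ ∩ {x | 1 / 4 < ‖∇ h x‖}) ≤ ν * volume.real (ball c ρ) → ‖∇ h c‖ ≤ 1 / 2 := by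
  have hG := Gm_nonneg (p := p) (a := 1 / 16) (b := 2) hp (by norm_num) (by norm_num)
  obtain ⟨ν, h0, H⟩ := dg1 (E := E) (Gm p (1 / 16) 2 * 5) (by positivity)
  refine ⟨ν, h0, fun δ h c R ρ hδ hδ1 hs hρ hρR hm hv => ?_⟩
  obtain ⟨Q, hQ⟩ := hs.1
  obtain ⟨τ0, hτ0, hu⟩ := dgB hδ hδ1 hp hs hρR hm
  refine norm_le_of_inner (by norm_num) fun e he => ?_
  refine dq_lim_le (sol_C1 hδ hp hs (mem_ball_self (by linarith))).1 hτ0 fun τ hτ => ?_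
  obtain ⟨hb, hdg⟩ := (hu τ hτ).2 e he
  obtain ⟨K, hK⟩ := dq_lip hQ e hτ.1
  refine H _ K hK c ρ (3 / 8) (1 / 2) hρ (by norm_num) (fun k hk hk2 r s hr hrs hsρ => ?_) (le_trans (vmono' fun x hx hx2 => ?_) hv) c (mem_ball_self (by linarith))
  · refine (hdg k hk (by linarith) r s hr hrs hsρ).trans ?_
    have : 0 < s - r := by linarith
    have h3 : 0 ≤ 1 - k := by linarith
    have : Gm p (1 / 16) 2 * (1 - k) ≤ Gm p (1 / 16) 2 * 5 * (1 / 2 - 3 / 8) := by nlinarith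
    gcongr
  · have h2 := (abs_le.1 (hb x hx).2).2
    have h3 : 3 / 8 < dq h e τ x := hx2
    have h5 := real_inner_le_norm (∇ h x) e
    rw [he, mul_one] at h5
    show 1 / 4 < ‖∇ h x‖
    linarith
theorem rp_rat {Z : ℝ} (hX : 0 < X) (h1 : X / 2 ≤ Z) (h2 : Z ≤ 2 * X) :
    mm p (1 / 2) 2 * X ^ ((p - 2) / 2) ≤ Z ^ ((p - 2) / 2) ∧ Z ^ ((p - 2) / 2) ≤ MM p (1 / 2) 2 * X ^ ((p - 2) / 2) := by
  obtain ⟨h3, h4⟩ := rp_rng (p := p) (X := Z / X) (by norm_num : (0:ℝ) < 1 / 2) (by rw [le_div_iff₀ hX]; linarith) (by rw [div_le_iff₀ hX]; linarith : Z / X ≤ 2)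
  have hZ : 0 < Z := by linarith
  rw [Real.div_rpow hZ.le hX.le] at h3 h4
  have := Real.rpow_pos_of_pos hX ((p - 2) / 2)
  rw [le_div_iff₀ this] at h3
  rw [div_le_iff₀ this] at h4
  exact ⟨h3, h4⟩
noncomputable def ps (δ q s : ℝ) : ℝ := aa δ q s * s
noncomputable def ps' (δ q s : ℝ) : ℝ := aa δ q s * (1 + (q - 2) * (s ^ 2 / (δ ^ 2 + s ^ 2)))
theorem ps_deriv (hδ : 0 < δ) (q s : ℝ) : HasDerivAt (ps δ q) (ps' δ q s) s := by
  have hX := dpos hδ s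
  have h1 : HasDerivAt (fun s : ℝ => δ ^ 2 + s ^ 2) (2 * s) s := by
    simpa using (hasDerivAt_pow 2 s).const_add (δ ^ 2)
  have h2 := (h1.rpow_const (p := (q - 2) / 2) (Or.inl hX.ne')).mul (hasDerivAt_id s)
  refine h2.congr_deriv ?_
  unfold ps' aa
  rw [Real.rpow_sub_one hX.ne']
  simp only [id]
  field_simp
  ring
theorem ps_bd (hδ : 0 < δ) (h1 : 1 < q) (h2 : q ≤ 2) (s : ℝ) : (q - 1) * aa δ q s ≤ ps' δ q s ∧ ps' δ q s ≤ aa δ q s := by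
  have ha := aa_pos hδ q s
  have hX := dpos hδ s
  have h3 : s ^ 2 / (δ ^ 2 + s ^ 2) ≤ 1 := by rw [div_le_one hX]; nlinarith
  have h4 : 0 ≤ s ^ 2 / (δ ^ 2 + s ^ 2) := by positivity
  unfold ps'
  set Z := s ^ 2 / (δ ^ 2 + s ^ 2)
  constructor
  · nlinarith [mul_nonneg ha.le (mul_nonneg (sub_nonneg.2 h2) (sub_nonneg.2 h3))]
  · nlinarith [mul_nonneg ha.le (mul_nonneg (sub_nonneg.2 h2) h4)]
theorem ps_pos (hδ : 0 < δ) (h1 : 1 < q) (h2 : q ≤ 2) (s : ℝ) : 0 < ps' δ q s :=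
  lt_of_lt_of_le (mul_pos (by linarith) (aa_pos hδ q s)) (ps_bd hδ h1 h2 s).1
theorem ps_lip (hδ : 0 < δ) (h1 : 1 < q) (h2 : q ≤ 2) : LipschitzWith (Real.toNNReal (aa δ q 0)) (ps δ q) := by
  refine lipschitzWith_of_nnnorm_deriv_le (fun s => (ps_deriv hδ q s).differentiableAt) fun s => ?_
  rw [(ps_deriv hδ q s).deriv, ← NNReal.coe_le_coe, coe_nnnorm, Real.coe_toNNReal _ (aa_pos hδ q 0).le, Real.norm_of_nonneg (ps_pos hδ h1 h2 s).le]
  refine (ps_bd hδ h1 h2 s).2.trans ?_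
  exact Real.rpow_le_rpow_of_nonpos (dpos hδ 0) (by nlinarith) (by linarith)
theorem ps_sq (hδ : 0 < δ) (hδ1 : δ ≤ 1) (h1 : 1 < q) (h2 : q ≤ 2) (hs : |s| ≤ 1) : ps δ q s ^ 2 ≤ 2 := by
  have hX := dpos hδ s
  have hs2 : s ^ 2 ≤ 1 := by rw [← sq_abs]; nlinarith [abs_nonneg s]
  have hX2 : δ ^ 2 + s ^ 2 ≤ 2 := by nlinarith
  unfold ps aa
  rw [mul_pow, ← Real.rpow_natCast (_ ^ _), ← Real.rpow_mul hX.le]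
  have e : (q - 2) / 2 * ((2:ℕ):ℝ) = (q - 1) - 1 := by push_cast; ring
  rw [e, Real.rpow_sub_one hX.ne']
  have h3 : (δ ^ 2 + s ^ 2) ^ (q - 1) ≤ 2 := by
    calc (δ ^ 2 + s ^ 2) ^ (q - 1) ≤ 2 ^ (q - 1) := Real.rpow_le_rpow hX.le hX2 (by linarith)
      _ ≤ 2 ^ (1:ℝ) := Real.rpow_le_rpow_of_exponent_le (by norm_num) (by linarith)
      _ = 2 := Real.rpow_one 2
  have h4 : s ^ 2 / (δ ^ 2 + s ^ 2) ≤ 1 := by rw [div_le_one hX]; nlinarith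
  have h5 : 0 ≤ s ^ 2 / (δ ^ 2 + s ^ 2) := by positivity
  rw [div_mul_eq_mul_div, mul_div_assoc]
  nlinarith [Real.rpow_pos_of_pos hX (q - 1)]
theorem sqa {n z : ℝ} (h0 : 0 ≤ n) (h1 : n ≤ 1) (h2 : 0 ≤ d) (h3 : d ≤ 1) (hz : 0 ≤ z) (h4 : z ≤ n + d / 8) : z ^ 2 ≤ n ^ 2 + d / 2 := by
  have := pow_le_pow_left₀ hz h4 2
  nlinarith [mul_nonneg h2 (sub_nonneg.2 h1), mul_nonneg h2 (sub_nonneg.2 h3)]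
theorem caseC_pt (hδ : 0 < δ) (hδ1 : δ ≤ 1) (hp : 1 < p) (hq : q = min p 2) {g J : E} {w : ℝ} (hξ1 : ‖ξ‖ ≤ 1) (hξD : ‖ξ + D‖ ≤ 1)
    (hD : ‖D‖ ≤ δ ^ 2 / 8) (hw1 : |w| ≤ 1) (hwξ : |w| ≤ ‖ξ‖ + δ ^ 2 / 8) (hk : |k| ≤ 1)
    (hell : ∀ m1 m2, 0 ≤ m1 → (∀ t ∈ Icc (0:ℝ) 1, m1 ≤ aa δ p ‖ξ + t • D‖ ∧ aa δ p ‖ξ + t • D‖ ≤ m2) →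
      min 1 (p - 1) * m1 * ‖g‖ ^ 2 ≤ ⟪J, g⟫_ℝ ∧ ‖J‖ ≤ (1 + |p - 2|) * m2 * ‖g‖) :
    ∃ A, 0 ≤ A ∧ min 1 (p - 1) * mm p (1 / 2) 2 * A * ‖g‖ ^ 2 ≤ ⟪J, g⟫_ℝ ∧ ‖J‖ ≤ (1 + |p - 2|) * MM p (1 / 2) 2 * A * ‖g‖ ∧
      A * (ps δ q w - ps δ q k) ^ 2 ≤ (2 ^ (|p - 2| / 2) * 8 / (q - 1)) * ps' δ q w ∧
      (w < - 1 / 8 → mm p (1 / 64) 2 * ((q - 1) * mm q (1 / 64) 2) ≤ A * ps' δ q w) := by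
  have hq1 : 1 < q := by rw [hq]; exact lt_min hp (by norm_num)
  have hq2 : q ≤ 2 := by rw [hq]; exact min_le_right _ _
  have hq1' : 0 < q - 1 := by linarith
  have hδ2 : δ ^ 2 ≤ 1 := by nlinarith
  have hn0 := norm_nonneg ξ
  have hd0 := sq_nonneg δ
  obtain ⟨X, hX⟩ : ∃ X, X = δ ^ 2 + ‖ξ‖ ^ 2 := ⟨_, rfl⟩
  have hXp : 0 < X := by rw [hX]; exact dpos hδ _
  have hX2 : X ≤ 2 := by nlinarith
  have hwx := abs_le.1 hw1
  have hYX : δ ^ 2 + w ^ 2 ≤ 2 * X := by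
    have := sqa hn0 hξ1 hd0 hδ2 (abs_nonneg _) hwξ
    rw [sq_abs] at this
    linarith [sq_nonneg ‖ξ‖]
  have hYp := dpos hδ w
  have hY2 : δ ^ 2 + w ^ 2 ≤ 2 := by nlinarith
  obtain ⟨A, hA⟩ : ∃ A, A = X ^ ((p - 2) / 2) := ⟨_, rfl⟩
  have hAp : 0 < A := by rw [hA]; exact Real.rpow_pos_of_pos hXp _
  obtain ⟨C, hC⟩ : ∃ C : ℝ, C = 2 ^ (|p - 2| / 2) := ⟨_, rfl⟩
  have hCp : 0 < C := by rw [hC]; exact Real.rpow_pos_of_pos (by norm_num) _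
  have hell := hell (mm p (1 / 2) 2 * A) (MM p (1 / 2) 2 * A) (mul_nonneg (mm_pos (by norm_num) (by norm_num)).le hAp.le) fun t ht => by
    have h2 := seg_norm ξ D ht hξ1 hξD
    have h3 := seg_lower (ξ := ξ) ht hD
    have h4 : ‖ξ + t • D‖ ≤ ‖ξ‖ + δ ^ 2 / 8 := by
      refine (norm_add_le _ _).trans ?_
      rw [norm_smul, Real.norm_of_nonneg ht.1]; nlinarith [ht.2, norm_nonneg D]
    have h7 := norm_nonneg (ξ + t • D)
    have h8 := sqa hn0 hξ1 hd0 hδ2 h7 h4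
    have h9 := sqa h7 h2 hd0 hδ2 hn0 (by linarith)
    rw [hA]
    exact rp_rat hXp (by linarith [sq_nonneg ‖ξ + t • D‖]) (by linarith [sq_nonneg ‖ξ‖])
  have hps := ps_bd hδ hq1 hq2 w
  have hAa : A ≤ C * aa δ q w := by
    rw [hA]
    rcases le_total p 2 with hp2 | hp2
    · have hqp : q = p := by rw [hq]; exact min_eq_left hp2
      have h5 : X ^ ((p - 2) / 2) ≤ ((δ ^ 2 + w ^ 2) / 2) ^ ((p - 2) / 2) :=
        Real.rpow_le_rpow_of_nonpos (by positivity) (by linarith) (by linarith)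
      refine h5.trans (le_of_eq ?_)
      rw [Real.div_rpow hYp.le (by norm_num), hC, abs_of_nonpos (by linarith), hqp, show -(p - 2) / 2 = -((p - 2) / 2) by ring, Real.rpow_neg (by norm_num)]
      unfold aa
      rw [div_eq_inv_mul]
    · have hqp : q = 2 := by rw [hq]; exact min_eq_right hp2
      unfold aa
      rw [hqp, sub_self, zero_div, Real.rpow_zero, mul_one, hC, abs_of_nonneg (by linarith)]
      exact Real.rpow_le_rpow hXp.le hX2 (by linarith)
  refine ⟨A, hAp.le, ?_, ?_, ?_, fun hwk => ?_⟩
  · exact le_trans (le_of_eq (by ring)) hell.1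
  · exact hell.2.trans (le_of_eq (by ring))
  · have h5 := ps_sq hδ hδ1 hq1 hq2 hw1
    have h6 := ps_sq hδ hδ1 hq1 hq2 hk
    have h7 : (ps δ q w - ps δ q k) ^ 2 ≤ 8 := by nlinarith [sq_nonneg (ps δ q w + ps δ q k)]
    rw [← hC]
    calc A * (ps δ q w - ps δ q k) ^ 2 ≤ (C * aa δ q w) * 8 := by gcongr; exact (mul_pos hCp (aa_pos hδ _ _)).le
      _ = C * 8 / (q - 1) * ((q - 1) * aa δ q w) := by field_simp
      _ ≤ C * 8 / (q - 1) * ps' δ q w := by gcongr; exact hps.1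
  · have h5 : ‖ξ‖ ≥ 1 / 8 - δ ^ 2 / 8 := by
      have : 1 / 8 ≤ |w| := by rw [abs_of_neg (by linarith)]; linarith
      linarith
    have h6 : 1 / 64 ≤ X := by
      have : (1 / 8 - δ ^ 2 / 8) ^ 2 ≤ ‖ξ‖ ^ 2 := pow_le_pow_left₀ (by linarith) h5 2
      nlinarith only [sq_nonneg (δ ^ 2), this, hX, hd0]
    have h7 : 1 / 64 ≤ δ ^ 2 + w ^ 2 := by nlinarith only [hwk, hd0]
    have h8 := (rp_rng (p := p) (by norm_num) h6 hX2).1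
    have h9 := (rp_rng (p := q) (by norm_num) h7 hY2).1
    rw [hA]
    refine mul_le_mul h8 (le_trans ?_ hps.1) (mul_nonneg hq1'.le (mm_pos (by norm_num) (by norm_num)).le) (hA ▸ hAp.le)
    exact mul_le_mul_of_nonneg_left h9 hq1'.le
set_option maxHeartbeats 400000 in
theorem caseC (hp : 1 < p) : ∃ ν : ℝ, 0 < ν ∧ ∀ (δ : ℝ) (h : E → ℝ) (c e : E) (R ρ : ℝ), 0 < δ → δ ≤ 1 → Sol δ p h c R → 0 < ρ → ρ < R →
    (∀ x ∈ ball c R, ‖∇ h x‖ ≤ 1) → ‖e‖ = 1 → volume.real (ball c ρ ∩ {x | - 1 / 2 < ⟪∇ h x, e⟫_ℝ}) ≤ ν * volume.real (ball c ρ) →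
    ∀ x ∈ ball c (ρ / 2), ⟪∇ h x, e⟫_ℝ ≤ - 1 / 4 := by
  obtain ⟨q, hq⟩ : ∃ q, q = min p 2 := ⟨_, rfl⟩
  have hq1 : 1 < q := by rw [hq]; exact lt_min hp (by norm_num)
  have hq2 : q ≤ 2 := by rw [hq]; exact min_le_right _ _
  have hl0 : 0 < min 1 (p - 1) := lt_min one_pos (by linarith)
  obtain ⟨l, hl⟩ : ∃ x, x = min 1 (p - 1) * mm p (1 / 2) 2 := ⟨_, rfl⟩
  obtain ⟨Λ, hΛ⟩ : ∃ x, x = (1 + |p - 2|) * MM p (1 / 2) 2 := ⟨_, rfl⟩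
  have hlp : 0 < l := hl ▸ mul_pos hl0 (mm_pos (by norm_num) (by norm_num))
  have hΛp : 0 ≤ Λ := hΛ ▸ mul_nonneg (by positivity) (MM_pos (by norm_num)).le
  obtain ⟨T, hT⟩ : ∃ x, x = 2 ^ (|p - 2| / 2) * 8 / (q - 1) := ⟨_, rfl⟩
  have hq1' : 0 < q - 1 := by linarith
  have hTp : 0 ≤ T := by rw [hT]; positivity
  obtain ⟨c0, hc0⟩ : ∃ x, x = mm p (1 / 64) 2 * ((q - 1) * mm q (1 / 64) 2) := ⟨_, rfl⟩
  have hm1 : 0 < mm p (1 / 64) 2 := mm_pos (by norm_num) (by norm_num)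
  have hm2 : 0 < mm q (1 / 64) 2 := mm_pos (by norm_num) (by norm_num)
  have hc0p : 0 < c0 := by rw [hc0]; positivity
  obtain ⟨Γ, hΓ⟩ : ∃ x, x = 16 * (Λ / l) * √(T / c0) := ⟨_, rfl⟩
  obtain ⟨ν, h0, H⟩ := dg1 (E := E) Γ (by rw [hΓ]; positivity)
  refine ⟨ν, h0, fun δ h c e R ρ hδ hδ1 hs hρ hρR hm he hv x hx => ?_⟩
  obtain ⟨Q, hQ⟩ := hs.1
  have hδ2 : δ ^ 2 ≤ 1 := by nlinarith
  obtain ⟨τ0, hτ0, hu⟩ := unifC1 hδ hp hs hρR (by positivity : 0 < δ ^ 2 / 8)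
  refine dq_lim_le (sol_C1 hδ hp hs (ball_subset_ball (by linarith) hx)).1 hτ0 fun τ hτ => ?_
  obtain ⟨hR, hu2⟩ := hu τ hτ
  replace hu2 := hu2 e he
  obtain ⟨K, hK⟩ := dq_lip hQ e hτ.1
  obtain ⟨CJ, hCJ⟩ := JJ_bd (p := p) hδ hQ e hτ.1
  have hgq := dq_grad hQ e τ
  have hbd : ∀ x ∈ ball c ρ, |dq h e τ x| ≤ 1 := fun x hx => dq_bd' hQ zero_le_one hm he hτ.1 hR hx
  have heq := sol_dq hδ hs he hτ.1 hR
  have hell := fun x m1 m2 hm0 hg => JJ_ell (h := h) (e := e) (x := x) (τ := τ) (m1 := m1) (m2 := m2) hδ hp hm0 hg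
  have hwb := dq_bd hQ he hτ.1
  have hJm := JJ_meas (p := p) hδ h e τ
  set w := dq h e τ with hw
  clear_value w
  set W : E → ℝ := fun x => - max (- w x - 1 / 8) 0 with hW
  have hWl : LipschitzWith K W := by
    have := ((hK.neg.sub (LipschitzWith.const (1 / 8 : ℝ))).max_const 0).neg
    rw [add_zero] at this; exact this
  have hgW : ∀ x, ∇ W x = if w x < - 1 / 8 then ∇ w x else 0 := fun x => by
    have h1 := grad_pos (W := fun x => - w x) hK.continuous.neg (k := 1 / 8) x
    rw [hW, grad_neg_at, h1, grad_neg_at]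
    have : (1 / 8 < - w x) = (w x < - 1 / 8) := by
      apply propext; constructor <;> intro h <;> linarith
    simp only [this]
    split_ifs <;> simp
  have hWk : ∀ k < 0, {x | k < W x} = {x | k - 1 / 8 < w x} := fun k hk => by
    ext x
    simp only [hW, mem_ofPred_eq]
    constructor
    · intro h; linarith [le_max_left (- w x - 1 / 8) 0]
    · intro h; have : max (- w x - 1 / 8) 0 < -k := max_lt (by linarith) (by linarith)
      linarith
  have hdg : DG W c ρ (-1 / 4) (-1 / 8) (fun _ => Γ * (-1 / 8 - -1 / 4)) := by
    intro k hk1 hk2 r s hr hrs hsρ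
    rw [hWk k (by linarith)]
    have := cacc hK hwb hJm hCJ heq (ps_deriv hδ q) (ps_pos hδ hq1 hq2) (ps_lip hδ hq1 hq2) hlp hΛp hTp
      (Y := fun x => c0 * ‖∇ W x‖ ^ 2) (((meas_grad _).norm.pow_const 2).const_mul _) (CY := c0 * K ^ 2)
      (fun x => by have := grad_norm_le hWl x; gcongr) (fun x => by positivity) (k := k - 1 / 8) (by
        filter_upwards [hgq] with x hx hxb hkx
        have hxR := ball_subset_ball hρR.le hxb
        obtain ⟨hD, hdw⟩ := hu2 x hxb
        have hiw : |⟪∇ h x, e⟫_ℝ| ≤ ‖∇ h x‖ := by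
          have := abs_real_inner_le_norm (∇ h x) e
          rwa [he, mul_one] at this
        have hwξ : |w x| ≤ ‖∇ h x‖ + δ ^ 2 / 8 := by
          have := abs_sub_abs_le_abs_sub (w x) ⟪∇ h x, e⟫_ℝ
          linarith
        obtain ⟨A, hA, h1, h2, h3, h4⟩ := caseC_pt (k := k - 1 / 8) hδ hδ1 hp hq (hm x hxR) (by rw [add_sub_cancel]; exact hm _ (shift_mem he hτ.1 hR hxb)) hD (hbd x hxb) hwξ
          (by rw [abs_le]; constructor <;> linarith) (fun m1 m2 hm0 hg => hell x m1 m2 hm0 hx hg)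
        rw [← hl] at h1; rw [← hΛ] at h2; rw [← hT] at h3; rw [← hc0] at h4
        refine ⟨A, hA, h1, h2, h3, ?_⟩
        · rw [hgW x]
          split_ifs with hwk
          · have := h4 hwk
            gcongr
          · simp only [norm_zero]
            have := ps_pos hδ hq1 hq2 (w x)
            have h5 : c0 * (0:ℝ) ^ 2 = 0 := by ring
            rw [h5]; positivity) hr hrs hsρ
    rw [integral_const_mul, ← le_div_iff₀' hc0p] at this
    refine this.trans (le_of_eq ?_)
    have hsr : s - r ≠ 0 := by linarith
    have hsq : √(T / c0) ^ 2 = T / c0 := Real.sq_sqrt (by positivity)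
    have e0 : ∀ L q d : ℝ, (16 * L * q * (-1 / 8 - -1 / 4) / d) ^ 2 = 4 * L ^ 2 * q ^ 2 / d ^ 2 := by intros; ring
    rw [hΓ, e0, hsq]
    ring
  have hfin := H W K hWl c ρ (-1 / 4) (-1 / 8) hρ (by norm_num) hdg (le_trans (by
    rw [hWk (-1 / 4) (by norm_num)]
    refine vmono' fun x hx hx2 => ?_
    have h1 : -1 / 4 - 1 / 8 < w x := hx2
    have h2 := (abs_le.1 (hu2 x hx).2).2
    show -1 / 2 < ⟪∇ h x, e⟫_ℝ
    linarith) hv) x hx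
  by_contra! hc
  have : W x > -1 / 8 := by
    have := hWk (-1 / 8) (by norm_num)
    have h3 : x ∈ {x | -1 / 8 - 1 / 8 < w x} := by show _ < w x; linarith
    rw [← this] at h3; exact h3
  linarith
theorem alt (hp : 1 < p) : ∃ θ : ℝ, 0 < θ ∧ θ < 1 ∧ ∀ (δ : ℝ) (h : E → ℝ) (c : E) (R : ℝ), 0 < δ → δ ≤ 1 → Sol δ p h c R → 0 < R →
    (∀ x ∈ ball c R, ‖∇ h x‖ ≤ 1) → (∀ x ∈ ball c (R / 5), ‖∇ h x‖ ≤ 1 - θ) ∨ (∀ x ∈ ball c (R / 5), 1 / 4 ≤ ‖∇ h x‖) := by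
  obtain ⟨ν, hν, HC⟩ := caseC (E := E) hp
  obtain ⟨θ, h0, h1, HB⟩ := caseB (E := E) hp hν
  refine ⟨θ, h0, h1, fun δ h c R hδ hδ1 hs hR hm => ?_⟩
  by_cases hall : ∀ e : E, ‖e‖ = 1 → ν * volume.real (ball c (4 * R / 5 / 2)) ≤ volume.real (ball c (4 * R / 5 / 2) ∩ {x | ⟪∇ h x, e⟫_ℝ ≤ 1 / 2})
  · left
    intro x hx
    refine norm_le_of_inner (by linarith) fun e he => ?_
    refine HB δ h c e R (4 * R / 5) hδ hδ1 hs (by linarith) (by linarith) hm he (hall e he) x ?_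
    rwa [show 4 * R / 5 / 4 = R / 5 by ring]
  · right
    push Not at hall
    obtain ⟨e, he, hv⟩ := hall
    intro x hx
    have hg : ∀ y, ∇ (fun y => - h y) y = - ∇ h y := fun y => grad_neg_at h y
    have := HC δ (fun y => - h y) c e R (4 * R / 5 / 2) hδ hδ1 hs.neg (by linarith) (by linarith) (fun y hy => by rw [hg, norm_neg]; exact hm y hy) he
      (le_trans (vmono' fun y _ hy => by
        have h2 : - 1 / 2 < ⟪∇ (fun y => - h y) y, e⟫_ℝ := hy
        rw [hg, inner_neg_left] at h2
        show ⟪∇ h y, e⟫_ℝ ≤ 1 / 2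
        linarith) hv.le) x (by rwa [show 4 * R / 5 / 2 / 2 = R / 5 by ring])
    rw [hg, inner_neg_left] at this
    have h3 := real_inner_le_norm (∇ h x) e
    rw [he, mul_one] at h3
    linarith
theorem gradHolder (hp : 1 < p) : ∃ κ : ℝ, 0 < κ ∧ κ < 1 ∧ ∀ (j : ℕ) (δ : ℝ) (h : E → ℝ) (c : E) (R M : ℝ), 0 < δ → 0 < M → Sol δ p h c R → 0 < R →
    (∀ x ∈ ball c R, ‖∇ h x‖ ≤ M) → ∀ x ∈ ball c (R / 5 ^ j), ‖∇ h x - ∇ h c‖ ≤ 2 / κ ^ 2 * M * κ ^ j := by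
  obtain ⟨θ1, h10, h11, HA⟩ := alt (E := E) hp
  obtain ⟨θ2, h20, h21, HO⟩ := osc_grad (E := E) hp
  obtain ⟨κ, hκ⟩ : ∃ κ, κ = max (1 - θ1) (1 - θ2) := ⟨_, rfl⟩
  have hk1 : 1 - θ1 ≤ κ := hκ ▸ le_max_left _ _
  have hk2 : 1 - θ2 ≤ κ := hκ ▸ le_max_right _ _
  have hk0 : 0 < κ := by linarith
  have hk3 : κ < 1 := by rw [hκ]; exact max_lt (by linarith) (by linarith)
  refine ⟨κ, hk0, hk3, fun j => ?_⟩
  have hosc : ∀ (j : ℕ) (δ : ℝ) (h : E → ℝ) (c : E) (R : ℝ), 0 < δ → δ ≤ 1 → Sol δ p h c R → 0 < R → ∀ m : ℝ, 0 ≤ m → m ≤ 1 →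
      (∀ x ∈ ball c R, ‖∇ h x‖ ≤ m) → (∀ x ∈ ball c R, 1 / 16 ≤ δ ^ 2 + ‖∇ h x‖ ^ 2) → ∀ x ∈ ball c (R / 5 ^ (j + 1)), ‖∇ h x - ∇ h c‖ ≤ 2 * m * κ ^ j := by
    intro j δ h c R hδ hδ1 hs hR m hm0 hm1 hm hlow x hx
    have hsub : R / 5 ^ (j + 1) ≤ 4 * R / 5 / 4 ^ j := by
      rw [pow_succ, div_le_div_iff₀ (by positivity) (by positivity)]
      have : (4:ℝ) ^ j ≤ 5 ^ j := pow_le_pow_left₀ (by norm_num) (by norm_num) j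
      nlinarith [pow_pos (show (0:ℝ) < 5 by norm_num) j, mul_le_mul_of_nonneg_left this hR.le]
    refine (HO δ h c R (4 * R / 5) m hδ hδ1 hs (by linarith) (by linarith) hm0 hm1 hm hlow j x (ball_subset_ball hsub hx) c (mem_ball_self (by positivity))).trans ?_
    have : (1 - θ2) ^ j ≤ κ ^ j := pow_le_pow_left₀ (by linarith) hk2 j
    gcongr
  have htriv : ∀ (h : E → ℝ) (c : E) (R M : ℝ), 0 < R → (∀ x ∈ ball c R, ‖∇ h x‖ ≤ M) → ∀ x ∈ ball c R, ‖∇ h x - ∇ h c‖ ≤ 2 * M := by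
    intro h c R M hR hm x hx
    have := norm_sub_le (∇ h x) (∇ h c)
    linarith [hm x hx, hm c (mem_ball_self hR)]
  have hgs : ∀ (a : ℝ) (h : E → ℝ) (x : E), ∇ (fun y => a * h y) x = a • ∇ h x := fun a h x => grad_smul_at a
  have hkk : ∀ (M : ℝ) (j : ℕ), 0 < M → 2 * M * κ ^ j ≤ 2 / κ ^ 2 * M * κ ^ (j + 1) ∧ 2 * M * κ ^ j = 2 / κ ^ 2 * M * κ ^ (j + 2) := by
    intro M j hM
    have h2 : 2 * M * κ ^ j = 2 / κ ^ 2 * M * κ ^ (j + 2) := by field_simp; ring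
    refine ⟨?_, h2⟩
    rw [h2]
    have : κ ^ (j + 2) ≤ κ ^ (j + 1) := pow_le_pow_of_le_one hk0.le hk3.le (by omega)
    gcongr
  induction j with
  | zero =>
    intro δ h c R M hδ hM hs hR hm x hx
    rw [pow_zero, div_one] at hx
    refine (htriv h c R M hR hm x hx).trans ?_
    have := (hkk M 0 hM).2
    have h2 : κ ^ 2 ≤ 1 := pow_le_one₀ hk0.le hk3.le
    rw [pow_zero, mul_one]
    have h3 : 2 ≤ 2 / κ ^ 2 := by rw [le_div_iff₀ (by positivity)]; linarith
    gcongr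
  | succ j ih =>
    intro δ h c R M hδ hM hs hR hm x hx
    rcases le_or_gt M δ with hMδ | hMδ
    · have := hosc j 1 (fun y => δ⁻¹ * h y) c R one_pos le_rfl (by
        have := hs.smul δ⁻¹
        rwa [abs_of_pos (inv_pos.2 hδ), inv_mul_cancel₀ hδ.ne'] at this) hR (M / δ) (by positivity) (by rw [div_le_one hδ]; exact hMδ) (fun y hy => by
          rw [hgs, norm_smul, Real.norm_of_nonneg (inv_pos.2 hδ).le, inv_mul_eq_div]; have := hm y hy; gcongr) (fun y hy => by
          nlinarith [sq_nonneg ‖∇ (fun y => δ⁻¹ * h y) y‖]) x hx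
      rw [hgs, hgs, ← smul_sub, norm_smul, Real.norm_of_nonneg (inv_pos.2 hδ).le, inv_mul_eq_div, div_le_iff₀ hδ] at this
      refine this.trans (le_trans (le_of_eq ?_) (hkk M j hM).1)
      field_simp
    · have hs1 : Sol (δ / M) p (fun y => M⁻¹ * h y) c R := by
        have := hs.smul M⁻¹
        rwa [abs_of_pos (inv_pos.2 hM), inv_mul_eq_div] at this
      have hn : ∀ y, ‖∇ (fun y => M⁻¹ * h y) y‖ = ‖∇ h y‖ / M := fun y => by
        rw [hgs, norm_smul, Real.norm_of_nonneg (inv_pos.2 hM).le, inv_mul_eq_div]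
      have hδ' : 0 < δ / M := by positivity
      have hδ1 : δ / M ≤ 1 := by rw [div_le_one hM]; exact hMδ.le
      have hm1 : ∀ x ∈ ball c R, ‖∇ (fun y => M⁻¹ * h y) x‖ ≤ 1 := fun x hx => by rw [hn, div_le_one hM]; exact hm x hx
      rcases HA (δ / M) _ c R hδ' hδ1 hs1 hR hm1 with H | H
      · have h5 : ball c (R / 5) ⊆ ball c R := ball_subset_ball (by linarith)
        have := ih δ h c (R / 5) (κ * M) hδ (by positivity) (hs.mono h5) (by positivity) (fun y hy => by
          have := H y hy
          rw [hn, div_le_iff₀ hM] at this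
          exact this.trans (by gcongr)) x (by rwa [div_div, ← pow_succ'])
        refine this.trans (le_of_eq ?_)
        ring
      · cases j with
        | zero =>
          have := htriv h c R M hR hm x (ball_subset_ball (by rw [zero_add, pow_one]; linarith) hx)
          refine this.trans (le_trans (le_of_eq ?_) (hkk M 0 hM).1)
          ring
        | succ j =>
          have h5 : ball c (R / 5) ⊆ ball c R := ball_subset_ball (by linarith)
          have := hosc j (δ / M) _ c (R / 5) hδ' hδ1 (hs1.mono h5) (by positivity) 1 zero_le_one le_rfl (fun y hy => hm1 y (h5 hy)) (fun y hy => by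
            have := pow_le_pow_left₀ (by norm_num) (H y hy) 2
            nlinarith [sq_nonneg (δ / M)]) x (by rwa [div_div, ← pow_succ'])
          rw [hgs, hgs, ← smul_sub, norm_smul, Real.norm_of_nonneg (inv_pos.2 hM).le, inv_mul_eq_div, div_le_iff₀ hM] at this
          refine this.trans (le_of_eq ?_)
          rw [← (hkk M j hM).2]; ring
theorem caseR' (hp : 1 < p) : ∃ ν : ℝ, 0 < ν ∧ ∀ (δ : ℝ) (h : E → ℝ) (c : E) (R ρ M : ℝ), 0 < δ → 0 < M → δ ≤ M → Sol δ p h c R → 0 < ρ → ρ < R →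
    (∀ x ∈ ball c R, ‖∇ h x‖ ≤ M) → volume.real (ball c ρ ∩ {x | M / 4 < ‖∇ h x‖}) ≤ ν * volume.real (ball c ρ) → ‖∇ h c‖ ≤ M / 2 := by
  obtain ⟨ν, h0, H⟩ := caseR (E := E) hp
  refine ⟨ν, h0, fun δ h c R ρ M hδ hM hδM hs hρ hρR hm hv => ?_⟩
  have hs1 : Sol (δ / M) p (fun y => M⁻¹ * h y) c R := by
    have := hs.smul M⁻¹
    rwa [abs_of_pos (inv_pos.2 hM), inv_mul_eq_div] at this
  have hn : ∀ y, ‖∇ (fun y => M⁻¹ * h y) y‖ = ‖∇ h y‖ / M := fun y => by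
    rw [grad_smul_at, norm_smul, Real.norm_of_nonneg (inv_pos.2 hM).le, inv_mul_eq_div]
  have := H (δ / M) _ c R ρ (by positivity) (by rw [div_le_one hM]; exact hδM) hs1 hρ hρR (fun x hx => by rw [hn, div_le_one hM]; exact hm x hx) (le_trans (vmono' fun x _ hx => by
    have h2 : 1 / 4 < ‖∇ (fun y => M⁻¹ * h y) x‖ := hx
    rw [hn, lt_div_iff₀ hM] at h2
    show M / 4 < ‖∇ h x‖
    linarith) hv)
  rw [hn, div_le_iff₀ hM] at this
  linarith
theorem gradBound (hp : 1 < p) {C1 : ℝ} (hC1 : 0 ≤ C1) : ∃ U : ℝ, 0 < U ∧ ∀ (δ : ℝ) (h : E → ℝ) (c : E) (R : ℝ), 0 < δ → δ ≤ 1 → 0 < R → Sol δ p h c R →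
    ∫ x in ball c R, ‖∇ h x‖ ^ p ≤ C1 * R ^ Module.finrank ℝ E → ∀ x ∈ ball c (R / 2), ‖∇ h x‖ ≤ U := by
  obtain ⟨ν, hν, HR⟩ := caseR' (E := E) hp
  obtain ⟨N, hN⟩ : ∃ N, N = Module.finrank ℝ E := ⟨_, rfl⟩
  have hN1 : 1 ≤ N := by rw [hN]; exact Module.finrank_pos
  have hN1' : (1:ℝ) ≤ N := by exact_mod_cast hN1
  obtain ⟨σ, hσ⟩ : ∃ σ : ℝ, σ = 1 / (3 * N) := ⟨_, rfl⟩
  have hσ0 : 0 < σ := by rw [hσ]; positivity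
  have hσN : N * σ = 1 / 3 := by rw [hσ]; field_simp
  have hσ1 : σ ≤ 1 / 3 := by nlinarith
  have hσ2 : 1 ≤ (1 - σ) ^ N * (3 / 2 : ℝ) ^ p := by
    have h1 := one_add_mul_le_pow (a := -σ) (by linarith) N
    have h2 : (3 / 2 : ℝ) ^ (1:ℝ) ≤ (3 / 2 : ℝ) ^ p := Real.rpow_le_rpow_of_exponent_le (by norm_num) hp.le
    rw [Real.rpow_one] at h2
    have h3 : 2 / 3 ≤ (1 - σ) ^ N := by rw [sub_eq_add_neg]; linarith
    nlinarith
  set ω := volume.real (ball (0:E) 1) with hω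
  have hω0 : 0 < ω := vol_ball_pos (0:E) one_pos
  obtain ⟨q, hq⟩ : ∃ q, q = (3 / 8 : ℝ) ^ p * (ν * ((σ / 2) ^ N * ω)) := ⟨_, rfl⟩
  have hq0 : 0 < q := by rw [hq]; positivity
  obtain ⟨C2, hC2⟩ : ∃ C2, C2 = 4 ^ N * max 1 (C1 / q) := ⟨_, rfl⟩
  have hC20 : 0 < C2 := by rw [hC2]; have := le_max_left 1 (C1 / q); positivity
  refine ⟨C2 ^ p⁻¹, by positivity, fun δ h c R hδ hδ1 hR hs hint x hx => ?_⟩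
  rw [← hN] at hint
  have hp0 : 0 < p := by linarith
  rw [Real.le_rpow_inv_iff_of_pos (norm_nonneg _) hC20.le hp0]
  obtain ⟨Q, hQ⟩ := hs.1
  have hsub : closedBall c (3 * R / 4) ⊆ ball c R := closedBall_subset_ball (by linarith)
  have hcont : ContinuousOn (fun x => ‖∇ h x‖ ^ p * (3 * R / 4 - dist x c) ^ N) (closedBall c (3 * R / 4)) := by
    refine ContinuousOn.mul (fun y hy => ?_) (by fun_prop)
    exact ((sol_C1 hδ hp hs (hsub hy)).2.norm.rpow_const (Or.inr hp0.le)).continuousWithinAt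
  obtain ⟨z, hz, hmax⟩ := (isCompact_closedBall c (3 * R / 4)).exists_isMaxOn ⟨c, mem_closedBall_self (by linarith)⟩ hcont
  have hmax : ∀ y ∈ closedBall c (3 * R / 4), ‖∇ h y‖ ^ p * (3 * R / 4 - dist y c) ^ N ≤ ‖∇ h z‖ ^ p * (3 * R / 4 - dist z c) ^ N := fun y hy => hmax hy
  obtain ⟨t, ht⟩ : ∃ t, t = 3 * R / 4 - dist z c := ⟨_, rfl⟩
  obtain ⟨L, hL⟩ : ∃ L, L = ‖∇ h z‖ := ⟨_, rfl⟩
  rw [← ht, ← hL] at hmax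
  have hL0 : 0 ≤ L := hL ▸ norm_nonneg _
  have ht0 : 0 ≤ t := by have := mem_closedBall.1 hz; linarith
  have htR : t ≤ R := by have := dist_nonneg (x := z) (y := c); linarith
  suffices hkey : L ^ p * t ^ N ≤ max 1 (C1 / q) * R ^ N by
    have h1 := hmax x (ball_subset_closedBall (ball_subset_ball (by linarith) hx))
    have h2 : (R / 4) ^ N ≤ (3 * R / 4 - dist x c) ^ N := pow_le_pow_left₀ (by linarith) (by have := mem_ball.1 hx; linarith) N
    have h3 : ‖∇ h x‖ ^ p * (R / 4) ^ N ≤ max 1 (C1 / q) * R ^ N := by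
      refine le_trans ?_ (h1.trans hkey)
      gcongr
    rw [div_pow, mul_div_assoc', div_le_iff₀ (by positivity)] at h3
    have h4 : 0 < R ^ N := by positivity
    rw [hC2]
    refine le_of_mul_le_mul_right (h3.trans (le_of_eq ?_)) h4
    ring
  have hRN : t ^ N ≤ R ^ N := pow_le_pow_left₀ ht0 htR N
  rcases le_or_gt L 1 with hL1 | hL1
  · have : L ^ p ≤ 1 := Real.rpow_le_one hL0 hL1 hp0.le
    exact mul_le_mul (this.trans (le_max_left _ _)) hRN (by positivity) (by positivity)
  rcases ht0.eq_or_lt with ht1 | ht1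
  · rw [← ht1, zero_pow (by omega), mul_zero]; positivity
  have hLp : 0 < L := by linarith
  have hsub2 : ball z (σ * t) ⊆ ball c (3 * R / 4) := by
    refine ball_subset_ball' ?_
    nlinarith
  have hsub3 : ball z (σ * t) ⊆ ball c R := hsub2.trans (ball_subset_ball (by linarith))
  have hM : ∀ y ∈ ball z (σ * t), ‖∇ h y‖ ≤ 3 / 2 * L := by
    intro y hy
    have h1 := hmax y (ball_subset_closedBall (hsub2 hy))
    have h2 : (1 - σ) * t ≤ 3 * R / 4 - dist y c := by
      have := dist_triangle y z c
      have := mem_ball.1 hy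
      linarith
    have h3 := pow_le_pow_left₀ (by nlinarith) h2 N
    rw [mul_pow] at h3
    have h4 : ‖∇ h y‖ ^ p * (1 - σ) ^ N ≤ L ^ p := by
      refine le_of_mul_le_mul_right (le_trans ?_ h1) (pow_pos ht1 N)
      rw [mul_assoc]; gcongr
    rw [← Real.rpow_le_rpow_iff (norm_nonneg _) (by positivity) hp0, Real.mul_rpow (by norm_num) hL0]
    have h5 : 0 ≤ ‖∇ h y‖ ^ p := by positivity
    calc ‖∇ h y‖ ^ p ≤ ‖∇ h y‖ ^ p * ((1 - σ) ^ N * (3 / 2 : ℝ) ^ p) := le_mul_of_one_le_right h5 hσ2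
      _ = (‖∇ h y‖ ^ p * (1 - σ) ^ N) * (3 / 2 : ℝ) ^ p := by ring
      _ ≤ L ^ p * (3 / 2 : ℝ) ^ p := by gcongr
      _ = _ := mul_comm _ _
  have hσt : 0 < σ * t := by positivity
  by_cases hv : volume.real (ball z (σ * t / 2) ∩ {x | 3 / 2 * L / 4 < ‖∇ h x‖}) ≤ ν * volume.real (ball z (σ * t / 2))
  · have := HR δ h z (σ * t) (σ * t / 2) (3 / 2 * L) hδ (by positivity) (by linarith) (hs.mono hsub3) (by positivity) (by linarith) hM hv
    rw [← hL] at this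
    linarith
  · push Not at hv
    set S := ball z (σ * t / 2) ∩ {x | 3 / 2 * L / 4 < ‖∇ h x‖} with hS
    have hSm : MeasurableSet S := measurableSet_ball.inter (measurableSet_lt measurable_const (meas_grad h).norm)
    have hSs : S ⊆ ball c R := fun y hy => hsub3 (ball_subset_ball (by linarith) hy.1)
    have hi : IntegrableOn (fun x => ‖∇ h x‖ ^ p) (ball c R) := intOn_of_bdd measurableSet_ball measure_ball_lt_top.ne
      ((meas_grad h).norm.pow_const p).aestronglyMeasurable ((Q:ℝ) ^ p) fun x _ => by
        rw [Real.norm_of_nonneg (by positivity)]; exact Real.rpow_le_rpow (norm_nonneg _) (grad_norm_le hQ x) hp0.le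
    have h1 : ∫ x in S, ‖∇ h x‖ ^ p ≤ ∫ x in ball c R, ‖∇ h x‖ ^ p :=
      setIntegral_mono_set hi (Filter.Eventually.of_forall fun x => by positivity) (HasSubset.Subset.eventuallyLE hSs)
    have h2 : (3 / 2 * L / 4) ^ p * volume.real S ≤ ∫ x in S, ‖∇ h x‖ ^ p :=
      setIntegral_ge_of_const_le_real hSm (ne_top_of_le_ne_top measure_ball_lt_top.ne (measure_mono hSs)) (fun x hx => by
        have : 3 / 2 * L / 4 < ‖∇ h x‖ := hx.2
        exact Real.rpow_le_rpow (by positivity) this.le hp0.le) (hi.mono_set hSs)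
    rw [vol_ball z (by positivity), ← hN, ← hω] at hv
    have h3 : q * (L ^ p * t ^ N) ≤ C1 * R ^ N := by
      refine le_trans ?_ (h2.trans (h1.trans hint))
      rw [show 3 / 2 * L / 4 = 3 / 8 * L by ring, Real.mul_rpow (by norm_num) hL0]
      refine le_trans (le_of_eq ?_) (mul_le_mul_of_nonneg_left hv.le (by positivity))
      rw [hq, show σ * t / 2 = σ / 2 * t by ring, mul_pow]
      ring
    have h4 : L ^ p * t ^ N ≤ C1 / q * R ^ N := by
      rw [div_mul_eq_mul_div, le_div_iff₀ hq0]; linarith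
    exact h4.trans (by gcongr; exact le_max_right _ _)
theorem fd_grad (f : E → ℝ) : fderiv ℝ f = fun x => InnerProductSpace.toDual ℝ E (∇ f x) := by
  ext1 x
  rw [toDual_gradient]
theorem fd_sub (f g : E → ℝ) (x y : E) : ‖fderiv ℝ f x - fderiv ℝ g y‖ = ‖∇ f x - ∇ g y‖ := by
  rw [fd_grad, fd_grad, ← map_sub, LinearIsometryEquiv.norm_map]
open scoped Convolution in
theorem mollify (hw : ContDiff ℝ 1 w) (hc : HasCompactSupport w) (hσ : 0 < σ) :
    ∃ (g : E → ℝ) (L K : ℝ≥0), LipschitzWith L g ∧ Differentiable ℝ g ∧ (∀ x y, |g y - g x - ⟪∇ g x, y - x⟫_ℝ| ≤ K * ‖y - x‖ ^ 2) ∧ ∀ x, |g x - w x| ≤ σ ∧ ‖∇ g x - ∇ w x‖ ≤ σ := by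
  have hfc : Continuous (fderiv ℝ w) := hw.continuous_fderiv one_ne_zero
  obtain ⟨r1, hr1, h1⟩ := Metric.uniformContinuous_iff.1 (hw.continuous.uniformContinuous_of_tendsto_cocompact hc.is_zero_at_infty) σ hσ
  obtain ⟨r2, hr2, h2⟩ := Metric.uniformContinuous_iff.1 (hfc.uniformContinuous_of_tendsto_cocompact (hc.fderiv ℝ).is_zero_at_infty) σ hσ
  set r := min r1 r2 with hr
  have hr0 : 0 < r := lt_min hr1 hr2
  let φ : ContDiffBump (0:E) := ⟨r / 2, r, by linarith, by linarith⟩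
  set g := (φ.normed volume ⋆[ContinuousLinearMap.lsmul ℝ ℝ, volume] w) with hg
  have hgc : HasCompactSupport g := HasCompactSupport.convolution _ φ.hasCompactSupport_normed hc
  have hgs : ContDiff ℝ 2 g := HasCompactSupport.contDiff_convolution_left _ φ.hasCompactSupport_normed φ.contDiff_normed hw.continuous.locallyIntegrable
  have hfd : ∀ x, fderiv ℝ g x = (φ.normed volume ⋆[ContinuousLinearMap.lsmul ℝ ℝ, volume] (fderiv ℝ w)) x := fun x => by
    have := (HasCompactSupport.hasFDerivAt_convolution_right (ContinuousLinearMap.lsmul ℝ ℝ) hc ((φ.continuous_normed (μ := volume)).locallyIntegrable (μ := volume)) hw x).fderiv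
    rw [hg, this]
    rfl
  obtain ⟨L, hL⟩ := ContDiff.lipschitzWith_of_hasCompactSupport hgc hgs (by norm_num)
  obtain ⟨K, hK⟩ := ContDiff.lipschitzWith_of_hasCompactSupport (hgc.fderiv ℝ) (hgs.fderiv_right (m := 1) (by norm_num)) one_ne_zero
  refine ⟨g, L, 2 * K, hL, hgs.differentiable (by norm_num), fun x y => ?_, fun x => ⟨?_, ?_⟩⟩
  · rcases eq_or_ne y x with rfl | hyx
    · simp
    have h0 : 0 < ‖y - x‖ := norm_pos_iff.2 (sub_ne_zero.2 hyx)
    refine (taylor hL (ε := K * (2 * ‖y - x‖)) (r := 2 * ‖y - x‖) (by positivity) (Filter.Eventually.of_forall fun z hz => ?_) (by rw [mem_ball, dist_eq_norm]; linarith)).trans (le_of_eq ?_)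
    · rw [← fd_sub, ← dist_eq_norm]
      refine (hK.dist_le_mul z x).trans ?_
      have := (mem_ball.1 hz).le
      gcongr
    · push_cast; ring
  · rw [← Real.dist_eq]
    refine φ.dist_normed_convolution_le hw.continuous.aestronglyMeasurable fun z hz => (h1 ?_).le
    exact (mem_ball.1 hz).trans_le (min_le_left _ _)
  · rw [← fd_sub, ← dist_eq_norm, hfd]
    refine φ.dist_normed_convolution_le hfc.aestronglyMeasurable fun z hz => (h2 ?_).le
    exact (mem_ball.1 hz).trans_le (min_le_right _ _)
theorem c1_at (hΩ : IsOpen Ω) (hd : ∀ x ∈ Ω, DifferentiableAt ℝ u x) (hc : ContinuousOn (fun x => ∇ u x) Ω) (hx : x ∈ Ω) : ContDiffAt ℝ 1 u x := by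
  have : ContDiffOn ℝ 1 u Ω := by
    rw [← zero_add 1, contDiffOn_succ_iff_fderiv_of_isOpen hΩ, contDiffOn_zero]
    refine ⟨fun x hx => (hd x hx).differentiableWithinAt, by simp, ?_⟩
    rw [fd_grad]
    exact (LinearIsometryEquiv.continuous _).comp_continuousOn hc
  exact this.contDiffAt (hΩ.mem_nhds hx)
theorem approx (hΩ : IsOpen Ω) (hd : ∀ x ∈ Ω, DifferentiableAt ℝ u x) (hc : ContinuousOn (fun x => ∇ u x) Ω) (hR : 0 < R) (hs : closedBall c R ⊆ Ω) (hσ : 0 < σ) :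
    ∃ (g : E → ℝ) (L K : ℝ≥0), LipschitzWith L g ∧ Differentiable ℝ g ∧ (∀ x y, |g y - g x - ⟪∇ g x, y - x⟫_ℝ| ≤ K * ‖y - x‖ ^ 2) ∧ ∀ x ∈ closedBall c R, |g x - u x| ≤ σ ∧ ‖∇ g x - ∇ u x‖ ≤ σ := by
  obtain ⟨η, hη, hη2⟩ := (isCompact_closedBall c R).exists_cthickening_subset_open hΩ hs
  rw [cthickening_closedBall hη.le hR.le] at hη2
  let χ : ContDiffBump c := ⟨R + η / 2, R + η, by linarith, by linarith⟩
  have ht : tsupport (χ : E → ℝ) = closedBall c (R + η) := χ.tsupport_eq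
  have hw : ContDiff ℝ 1 (fun x => χ x * u x) := by
    rw [contDiff_iff_contDiffAt]
    intro x
    by_cases hx : x ∈ tsupport (fun x => χ x * u x)
    swap
    · exact contDiffAt_const.congr_of_eventuallyEq (notMem_tsupport_iff_eventuallyEq.1 hx)
    have : x ∈ Ω := hη2 (by rw [add_comm, ← ht]; exact (tsupport_mul_subset_left (f := (χ : E → ℝ)) (g := u)) hx)
    exact χ.contDiff.contDiffAt.mul (c1_at hΩ hd hc this)
  obtain ⟨g, L, K, h1, h2, h3, h4⟩ := mollify hw (χ.hasCompactSupport.mul_right (f' := u)) hσ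
  refine ⟨g, L, K, h1, h2, h3, fun x hx => ?_⟩
  have he : (fun x => χ x * u x) =ᶠ[nhds x] u := by
    filter_upwards [isOpen_ball.mem_nhds (show x ∈ ball c (R + η / 2) from (mem_closedBall.1 hx).trans_lt (by linarith))] with y hy
    rw [χ.one_of_mem_closedBall (ball_subset_closedBall hy), one_mul]
  have h5 := h4 x
  have h6 := he.eq_of_nhds
  change χ x * u x = u x at h6
  rwa [grad_congr he, h6] at h5
def LMin (p : ℝ) (F : ℝ → ℝ) (Ω : Set E) (u : E → ℝ) : Prop :=
  IsOpen Ω ∧ (∀ x ∈ Ω, DifferentiableAt ℝ u x) ∧ ContinuousOn (fun x => ∇ u x) Ω ∧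
  ∀ (z : E) (r : ℝ), 0 < r → closedBall z r ⊆ Ω → ∀ (v : E → ℝ) (K : ℝ≥0), LipschitzOnWith K v (closedBall z r) → EqOn v u (sphere z r) →
    ∫ x in ball z r, (‖∇ u x‖ ^ p / p + F (u x)) ≤ ∫ x in ball z r, (‖∇ v x‖ ^ p / p + F (v x))
theorem pw (ha : 0 ≤ a) (hs : 0 ≤ s) (hp : 1 < p) : (a + s) ^ p ≤ (1 + s) ^ p * (a ^ p + s) := by
  have h1 : 0 < 1 + s := by linarith
  have h := (convexOn_rpow hp.le).2 (show a ∈ Ici (0:ℝ) from mem_Ici.2 ha) (show (1:ℝ) ∈ Ici (0:ℝ) from mem_Ici.2 zero_le_one) (show 0 ≤ 1 / (1 + s) by positivity) (show 0 ≤ s / (1 + s) by positivity)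
    (by field_simp)
  simp only [smul_eq_mul, Real.one_rpow, mul_one] at h
  have e : a + s = (1 + s) * (1 / (1 + s) * a + s / (1 + s)) := by field_simp
  rw [e, Real.mul_rpow h1.le (by positivity)]
  refine mul_le_mul_of_nonneg_left (h.trans ?_) (by positivity)
  rw [div_mul_eq_mul_div, one_mul]
  have h2 : 0 ≤ a ^ p := by positivity
  gcongr <;> rw [div_le_iff₀ h1] <;> nlinarith
theorem qpow (ha : 0 ≤ a) (hb : 0 ≤ b) (hq : 0 ≤ q) : (a + b) ^ q ≤ 2 ^ q * (a ^ q + b ^ q) := by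
  have h1 : 0 ≤ a ^ q := by positivity
  have h2 : 0 ≤ b ^ q := by positivity
  have h3 : (0:ℝ) ≤ 2 ^ q := by positivity
  rcases le_total a b with h | h
  · calc (a + b) ^ q ≤ (2 * b) ^ q := Real.rpow_le_rpow (by linarith) (by linarith) hq
      _ = 2 ^ q * b ^ q := Real.mul_rpow (by norm_num) hb
      _ ≤ _ := by gcongr; linarith
  · calc (a + b) ^ q ≤ (2 * a) ^ q := Real.rpow_le_rpow (by linarith) (by linarith) hq
      _ = 2 ^ q * a ^ q := Real.mul_rpow (by norm_num) ha
      _ ≤ _ := by gcongr; linarith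
theorem iB {a b : E → E} (ha : Measurable a) (hb : Measurable b) {H : E × E → ℝ} (hH : Continuous H) {C : ℝ} (hbd : ∀ x ∈ ball c R, ‖a x‖ ≤ C ∧ ‖b x‖ ≤ C) :
    IntegrableOn (fun x => H (a x, b x)) (ball c R) := by
  obtain ⟨M, hM⟩ := ((isCompact_closedBall (0 : E × E) C).image hH).isBounded.exists_norm_le
  refine intOn_of_bdd measurableSet_ball measure_ball_lt_top.ne (hH.measurable.comp (ha.prodMk hb)).aestronglyMeasurable M fun x hx => hM _ ⟨_, ?_, rfl⟩
  rw [mem_closedBall_zero_iff, Prod.norm_def]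
  exact max_le (hbd x hx).1 (hbd x hx).2
theorem int_le_aff (hf : IntegrableOn f (ball c R)) (hg : IntegrableOn g (ball c R)) (h : ∀ x ∈ ball c R, f x ≤ k * g x + b) :
    ∫ x in ball c R, f x ≤ k * (∫ x in ball c R, g x) + b * volume.real (ball c R) := by
  have hb : IntegrableOn (fun _ : E => b) (ball c R) := integrableOn_const measure_ball_lt_top.ne
  calc ∫ x in ball c R, f x ≤ ∫ x in ball c R, (k * g x + b) := setIntegral_mono_on hf ((hg.const_mul k).add hb) measurableSet_ball h
    _ = _ := by rw [integral_add (hg.const_mul k) hb, integral_const_mul, setIntegral_const, smul_eq_mul]; ring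
theorem small_e {G0 : ℝ} (hr : 0 < r) (hm : 0 < m) : ∃ σ : ℝ, 0 < σ ∧ σ ≤ m ∧ ((1 + 2 * σ) ^ p - 1) * (1 / p + G0) + 4 * (1 + 2 * σ) ^ p * σ / p ≤ r := by
  have hc : ContinuousAt (fun σ : ℝ => ((1 + 2 * σ) ^ p - 1) * (1 / p + G0) + 4 * (1 + 2 * σ) ^ p * σ / p) 0 := by
    have : ContinuousAt (fun σ : ℝ => (1 + 2 * σ) ^ p) 0 := ContinuousAt.rpow_const (by fun_prop) (Or.inl (by norm_num))
    fun_prop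
  have h0 : ∀ᶠ σ in nhdsWithin 0 (Ioi (0:ℝ)), ((1 + 2 * σ) ^ p - 1) * (1 / p + G0) + 4 * (1 + 2 * σ) ^ p * σ / p < r :=
    (hc.tendsto.eventually_lt_const (u := r) (by simpa using hr)).filter_mono nhdsWithin_le_nhds
  obtain ⟨σ, h1, h2, h3⟩ := (h0.and (Ioc_mem_nhdsGT hm)).exists
  exact ⟨σ, h2, h3, h1.le⟩
theorem GG_up (hσ : 0 ≤ σ) (hp : 1 < p) {ζ : E} (h : ‖ξ - ζ‖ ≤ σ) (hζ : ‖ζ‖ ≤ 1) :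
    GG σ p ξ ≤ 1 * (‖ζ‖ ^ p / p) + (((1 + 2 * σ) ^ p - 1) / p + 2 * (1 + 2 * σ) ^ p * σ / p) := by
  have hp0 : 0 < p := by linarith
  have h1 : ‖ξ‖ ≤ ‖ζ‖ + σ := by have := norm_sub_norm_le ξ ζ; linarith
  have h2 : (σ ^ 2 + ‖ξ‖ ^ 2) ^ (p / 2) ≤ (‖ζ‖ + 2 * σ) ^ p := by
    have : ((‖ζ‖ + 2 * σ) ^ 2) ^ (p / 2) = (‖ζ‖ + 2 * σ) ^ p := by
      rw [← Real.rpow_natCast, ← Real.rpow_mul (by positivity)]; congr 1; push_cast; ring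
    rw [← this]
    refine Real.rpow_le_rpow (by positivity) ?_ (by positivity)
    nlinarith [norm_nonneg ξ, norm_nonneg ζ]
  have h3 := h2.trans (pw (norm_nonneg ζ) (by positivity) hp)
  have h4 : ‖ζ‖ ^ p ≤ 1 := Real.rpow_le_one (norm_nonneg _) hζ hp0.le
  have h5 : 1 ≤ (1 + 2 * σ) ^ p := Real.one_le_rpow (by linarith) hp0.le
  unfold GG
  rw [one_mul, ← add_div, ← add_div]
  gcongr
  nlinarith
theorem lip_u (hd : ∀ x ∈ Ω, DifferentiableAt ℝ u x) {s : Set E} (hs : s ⊆ Ω) (hc : Convex ℝ s) {G : ℝ} (hG : 0 ≤ G) (hu : ∀ x ∈ s, ‖∇ u x‖ ≤ G) :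
    LipschitzOnWith (Real.toNNReal G) u s := by
  refine hc.lipschitzOnWith_of_nnnorm_fderiv_le (fun x hx => hd x (hs hx)) fun x hx => ?_
  rw [← NNReal.coe_le_coe, coe_nnnorm, ← grad_norm, Real.coe_toNNReal _ hG]
  exact hu x hx
theorem cmp_core {Iu Iv Ih Ig Fu Fv V G0 : ℝ} (hp : 1 < p) (hV : 0 ≤ V) (hσ : 0 ≤ σ) (hG0 : 0 ≤ G0) (ha : Iu + Fu ≤ Iv + Fv) (hb : Ig ≤ 1 * Iu + (((1 + 2 * σ) ^ p - 1) / p + 2 * (1 + 2 * σ) ^ p * σ / p) * V)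
    (hc : Iv ≤ (1 + 2 * σ) ^ p * Ih + (2 * (1 + 2 * σ) ^ p * σ / p) * V) (hd : Fv ≤ 1 * Fu + 3 * A * R ^ β * V) (he : Ih ≤ G0 * V) (hs : ((1 + 2 * σ) ^ p - 1) * (1 / p + G0) + 4 * (1 + 2 * σ) ^ p * σ / p ≤ R ^ β) :
    Ig - Ih ≤ (3 * A + 1) * R ^ β * V := by
  have hk : 1 ≤ (1 + 2 * σ) ^ p := Real.one_le_rpow (by linarith) (by linarith)
  set k := (1 + 2 * σ) ^ p
  have h1 : (k - 1) * Ih ≤ (k - 1) * (G0 * V) := mul_le_mul_of_nonneg_left he (by linarith)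
  have h2 := mul_le_mul_of_nonneg_right hs hV
  have h3 : ((k - 1) / p + 2 * k * σ / p) * V + (k - 1) * (G0 * V) + (2 * k * σ / p) * V = ((k - 1) * (1 / p + G0) + 4 * k * σ / p) * V := by ring
  linarith
theorem cmp (hp : 1 < p) (hA : 0 ≤ A) (hβ : 0 < β) (hβ1 : β ≤ 1) : ∃ U C : ℝ, 0 < U ∧ 0 ≤ C ∧ ∀ (F : ℝ → ℝ) (U0 : ℝ) (Ω : Set E) (u : E → ℝ) (c : E) (R : ℝ),
    0 < R → R ≤ 1 → LMin p F Ω u → Continuous F → (∀ s t, |s| ≤ U0 + 3 → |t| ≤ U0 + 3 → |F s - F t| ≤ A * |s - t| ^ β) → closedBall c R ⊆ Ω →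
    (∀ x ∈ closedBall c R, ‖∇ u x‖ ≤ 1 ∧ |u x| ≤ U0) →
    ∃ (δ : ℝ) (h : E → ℝ), 0 < δ ∧ Sol δ p h c R ∧ (∀ x ∈ ball c (R / 2), ‖∇ h x‖ ≤ U) ∧
      ∫ x in ball c (R / 2), ‖∇ u x - ∇ h x‖ ^ (max p 2) ≤ C * R ^ β * R ^ Module.finrank ℝ E := by
  have hp0 : 0 < p := by linarith
  set ω := volume.real (ball (0:E) 1) with hω
  have hω0 : 0 < ω := vol_ball_pos (0:E) one_pos
  obtain ⟨G0, hG0⟩ : ∃ G0 : ℝ, G0 = (1 + 2 ^ 2) ^ (p / 2) / p := ⟨_, rfl⟩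
  have hG00 : 0 ≤ G0 := by rw [hG0]; positivity
  obtain ⟨U, hU, HU⟩ := gradBound (E := E) hp (C1 := p * G0 * ω) (by positivity)
  obtain ⟨c0, hc0, HQ⟩ := GG_quant (E := E) p hp (max U 2) (lt_max_of_lt_left hU)
  obtain ⟨q, hq⟩ : ∃ q, q = max p 2 := ⟨_, rfl⟩
  have hq2 : 2 ≤ q := hq ▸ le_max_right _ _
  rw [← hq] at HQ ⊢
  refine ⟨U, 2 ^ q * ((3 * A + 1) / c0 + 1) * ω, hU, by positivity, fun F U0 Ω u c R hR hR1 hu hF hFH hs hub => ?_⟩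
  obtain ⟨hΩ, hd, hgc, hmin⟩ := hu
  have hRβ : R ≤ R ^ β := by
    have := Real.rpow_le_rpow_of_exponent_ge hR hR1 hβ1
    rwa [Real.rpow_one] at this
  have hRβ0 : 0 < R ^ β := by positivity
  obtain ⟨σ, hσ, hσR, hσe⟩ := small_e (p := p) (G0 := G0) hRβ0 (by linarith : 0 < R / 4)
  have hσ1 : σ ≤ 1 := by linarith
  obtain ⟨g, Lg, K, hg, hgd, hgK, hgu⟩ := approx hΩ hd hgc hR hs hσ
  obtain ⟨h, Q, hh, hhg, hEL, hmax, hmn⟩ := HH_exists hσ hp hR hg K (c := c) fun x _ y _ => hgK x y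
  have hsol : Sol σ p h c R := ⟨⟨Q, hh⟩, fun φ L hφ h0 => by rw [← set_int_full h0]; exact hEL φ L hφ h0⟩
  have hbc : ball c R ⊆ closedBall c R := ball_subset_closedBall
  have hgu1 : ∀ x ∈ ball c R, ‖∇ u x‖ ≤ 1 := fun x hx => (hub x (hbc hx)).1
  have hgg2 : ∀ x ∈ ball c R, ‖∇ g x‖ ≤ 2 := fun x hx => by
    have h1 := norm_sub_norm_le (∇ g x) (∇ u x)
    linarith [(hgu x (hbc hx)).2, hgu1 x hx]
  have hgh : ∀ x, ‖∇ h x‖ ≤ Q := grad_norm_le hh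
  obtain ⟨V, hV⟩ : ∃ V, V = volume.real (ball c R) := ⟨_, rfl⟩
  have hV2 : V = R ^ Module.finrank ℝ E * ω := by rw [hV, vol_ball c hR.le]
  have hV0 : 0 ≤ V := by rw [hV2]; positivity
  have ib2 : ∀ x ∈ ball c R, ‖∇ g x‖ ≤ max (Q:ℝ) 2 ∧ ‖∇ h x‖ ≤ max (Q:ℝ) 2 := fun x hx => ⟨(hgg2 x hx).trans (le_max_right _ _), (hgh x).trans (le_max_left _ _)⟩
  have ib3 : ∀ x ∈ ball c R, ‖∇ h x‖ ≤ max (Q:ℝ) 2 ∧ ‖∇ u x - ∇ g x‖ ≤ max (Q:ℝ) 2 := fun x hx => ⟨(hgh x).trans (le_max_left _ _), by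
    rw [norm_sub_rev]; exact (hgu x (hbc hx)).2.trans (by linarith [le_max_right (Q:ℝ) 2])⟩
  have ib4 : ∀ x ∈ ball c R, ‖∇ u x‖ ≤ max (Q:ℝ) 2 ∧ ‖∇ h x‖ ≤ max (Q:ℝ) 2 := fun x hx => ⟨(hgu1 x hx).trans (by linarith [le_max_right (Q:ℝ) 2]), (hgh x).trans (le_max_left _ _)⟩
  have iGg : IntegrableOn (fun x => GG σ p (∇ g x)) (ball c R) := iB (meas_grad g) (meas_grad h) (H := fun z => GG σ p z.1) ((GG_cont hp).comp continuous_fst) ib2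
  have iGh : IntegrableOn (fun x => GG σ p (∇ h x)) (ball c R) := iB (meas_grad g) (meas_grad h) (H := fun z => GG σ p z.2) ((GG_cont hp).comp continuous_snd) ib2
  have iP : IntegrableOn (fun x => ⟪Ph σ p (∇ h x), ∇ g x - ∇ h x⟫_ℝ) (ball c R) := iB (meas_grad g) (meas_grad h) (H := fun z => ⟪Ph σ p z.2, z.1 - z.2⟫_ℝ)
    (((Ph_cont hσ).comp continuous_snd).inner (by fun_prop)) ib2
  have iq : IntegrableOn (fun x => ‖∇ g x - ∇ h x‖ ^ q) (ball c R) := iB (meas_grad g) (meas_grad h) (H := fun z => ‖z.1 - z.2‖ ^ q)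
    (Continuous.rpow_const (by fun_prop) fun _ => Or.inr (by linarith)) ib2
  have iq2 : IntegrableOn (fun x => ‖∇ u x - ∇ h x‖ ^ q) (ball c R) := iB (meas_grad u) (meas_grad h) (H := fun z => ‖z.1 - z.2‖ ^ q)
    (Continuous.rpow_const (by fun_prop) fun _ => Or.inr (by linarith)) ib4
  have iu : IntegrableOn (fun x => ‖∇ u x‖ ^ p / p) (ball c R) := iB (meas_grad u) (meas_grad h) (H := fun z => ‖z.1‖ ^ p / p)
    ((Continuous.rpow_const (by fun_prop) fun _ => Or.inr (by linarith)).div_const _) ib4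
  have iv : IntegrableOn (fun x => ‖∇ h x + (∇ u x - ∇ g x)‖ ^ p / p) (ball c R) := iB (meas_grad h) ((meas_grad u).sub (meas_grad g)) (H := fun z => ‖z.1 + z.2‖ ^ p / p)
    ((Continuous.rpow_const (by fun_prop) fun _ => Or.inr (by linarith)).div_const _) ib3
  have hEL0 : ∫ x in ball c R, ⟪Ph σ p (∇ h x), ∇ g x - ∇ h x⟫_ℝ = 0 := by
    rw [← hEL (fun y => g y - h y) _ (hg.sub hh) fun x hx => by rw [hhg x hx, sub_self]]
    refine setIntegral_congr_ae measurableSet_ball ?_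
    filter_upwards [grad_sub_ae hg hh] with x hx _
    rw [hx]
  have hΘ : ∫ x in ball c R, (GG σ p (∇ g x) - GG σ p (∇ h x) - ⟪Ph σ p (∇ h x), ∇ g x - ∇ h x⟫_ℝ) = (∫ x in ball c R, GG σ p (∇ g x)) - ∫ x in ball c R, GG σ p (∇ h x) := by
    have i3 : IntegrableOn (fun x => GG σ p (∇ g x) - GG σ p (∇ h x)) (ball c R) := iGg.sub iGh
    rw [integral_sub i3 iP, integral_sub iGg iGh, hEL0, sub_zero]
  have hΘ0 : ∀ x, 0 ≤ GG σ p (∇ g x) - GG σ p (∇ h x) - ⟪Ph σ p (∇ h x), ∇ g x - ∇ h x⟫_ℝ := fun x => by linarith [GG_conv hσ hp (∇ h x) (∇ g x)]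
  obtain ⟨Ig, hIg⟩ : ∃ I, I = ∫ x in ball c R, GG σ p (∇ g x) := ⟨_, rfl⟩
  obtain ⟨Ih, hIh⟩ : ∃ I, I = ∫ x in ball c R, GG σ p (∇ h x) := ⟨_, rfl⟩
  rw [← hIg, ← hIh] at hΘ
  have he : Ih ≤ Ig := by
    have : 0 ≤ Ig - Ih := by rw [← hΘ]; exact integral_nonneg hΘ0
    linarith
  have hIgG : Ig ≤ G0 * V := by
    have := int_le_aff (k := 0) (b := G0) iGg iGg fun x hx => by
      rw [zero_mul, zero_add, hG0]
      refine (le_abs_self _).trans ((GG_bd hp (hgg2 x hx)).trans ?_)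
      gcongr
      nlinarith
    rw [zero_mul, zero_add, ← hV, ← hIg] at this; exact this
  have hhU := HU σ h c R hσ hσ1 hR hsol (by
    have i1 : IntegrableOn (fun x => ‖∇ h x‖ ^ p) (ball c R) := iB (meas_grad u) (meas_grad h) (H := fun z => ‖z.2‖ ^ p)
      (Continuous.rpow_const (by fun_prop) fun _ => Or.inr (by linarith)) ib4
    have := int_le_aff (k := p) (b := 0) i1 iGh fun x hx => by
      have := GG_ge (δ := σ) hp (∇ h x)
      rw [div_le_iff₀ hp0] at this; linarith
    rw [← hIh] at this
    refine this.trans ?_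
    rw [zero_mul, add_zero, mul_assoc, mul_assoc, mul_comm ω, ← hV2]
    exact mul_le_mul_of_nonneg_left (he.trans hIgG) hp0.le)
  refine ⟨σ, h, hσ, hsol, hhU, ?_⟩
  have hul := lip_u hd hs (convex_closedBall c R) zero_le_one fun x hx => (hub x hx).1
  have hcc : c ∈ closedBall c R := mem_closedBall_self hR.le
  have huc : ∀ x ∈ closedBall c R, |u x - u c| ≤ R := fun x hx => by
    have := hul.dist_le_mul x hx c hcc
    rw [Real.dist_eq, Real.toNNReal_one, NNReal.coe_one, one_mul] at this
    exact this.trans hx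
  have hgcc : ∀ x ∈ closedBall c R, u c - R - σ ≤ g x ∧ g x ≤ u c + R + σ := fun x hx => by
    have h1 := abs_le.1 (huc x hx)
    have h2 := abs_le.1 (hgu x hx).1
    constructor <;> linarith
  have hvu : ∀ x ∈ ball c R, |h x - g x| ≤ 3 * R := fun x hx => by
    have h1 := hgcc x (hbc hx)
    have h2 := hmax _ (fun y hy => (hgcc y (sphere_subset_closedBall hy)).2) x hx
    have h3 := hmn _ (fun y hy => (hgcc y (sphere_subset_closedBall hy)).1) x hx
    rw [abs_le]; constructor <;> linarith
  have hgv : ∀ᵐ x : E, x ∈ ball c R → ∇ (fun y => h y + (u y - g y)) x = ∇ h x + (∇ u x - ∇ g x) := by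
    filter_upwards [hh.ae_differentiableAt (μ := volume)] with x hx hxb
    have h1 := hd x (hs (hbc hxb))
    rw [grad_add_at hx (h1.fun_sub (hgd x))]
    congr 1
    have : (fun y => u y - g y) = fun y => u y + (fun z => - g z) y := by ext y; ring
    rw [this, grad_add_at h1 (hgd x).fun_neg, sub_eq_add_neg]
    congr 1
    exact grad_neg_at g x
  have huC : ContinuousOn u (closedBall c R) := hul.continuousOn
  have hvC : ContinuousOn (fun y => h y + (u y - g y)) (closedBall c R) := hh.continuous.continuousOn.add (huC.sub hg.continuous.continuousOn)
  have iFu : IntegrableOn (fun x => F (u x)) (ball c R) := ((hF.comp_continuousOn huC).integrableOn_compact (isCompact_closedBall c R)).mono_set hbc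
  have iFv : IntegrableOn (fun x => F (h x + (u x - g x))) (ball c R) := ((hF.comp_continuousOn hvC).integrableOn_compact (isCompact_closedBall c R)).mono_set hbc
  have ha := hmin c R hR hs (fun y => h y + (u y - g y)) _ (hh.lipschitzOnWith.add (hul.sub hg.lipschitzOnWith)) (fun x hx => by
    have : x ∉ ball c R := fun hb => by rw [mem_sphere] at hx; rw [mem_ball] at hb; linarith
    show h x + (u x - g x) = u x
    rw [hhg x this]; ring)
  have hcong : ∫ x in ball c R, (‖∇ (fun y => h y + (u y - g y)) x‖ ^ p / p + F (h x + (u x - g x))) = ∫ x in ball c R, (‖∇ h x + (∇ u x - ∇ g x)‖ ^ p / p + F (h x + (u x - g x))) :=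
    setIntegral_congr_ae measurableSet_ball (by filter_upwards [hgv] with x hx hxb; rw [hx hxb])
  rw [hcong, integral_add iu iFu, integral_add iv iFv] at ha
  have hb := int_le_aff (k := 1) (b := ((1 + 2 * σ) ^ p - 1) / p + 2 * (1 + 2 * σ) ^ p * σ / p) iGg iu fun x hx => GG_up hσ.le hp (hgu x (hbc hx)).2 (hgu1 x hx)
  have hc := int_le_aff (k := (1 + 2 * σ) ^ p) (b := 2 * (1 + 2 * σ) ^ p * σ / p) iv iGh fun x hx => by
    have h1 : ‖∇ h x + (∇ u x - ∇ g x)‖ ≤ ‖∇ h x‖ + 2 * σ := by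
      have := (hgu x (hbc hx)).2
      rw [norm_sub_rev] at this
      exact (norm_add_le _ _).trans (by linarith)
    have h2 := (Real.rpow_le_rpow (norm_nonneg _) h1 hp0.le).trans (pw (norm_nonneg _) (by positivity) hp)
    have h3 := mul_le_mul_of_nonneg_left (GG_ge (δ := σ) hp (∇ h x)) (by positivity : 0 ≤ (1 + 2 * σ) ^ p)
    have h4 := div_le_div_of_nonneg_right h2 hp0.le
    refine h4.trans (le_trans (le_of_eq ?_) (add_le_add_left h3 _))
    ring
  have hd' := int_le_aff (k := 1) (b := 3 * A * R ^ β) iFv iFu fun x hx => by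
    have h1 := hvu x hx
    have h2 := (hub x (hbc hx)).2
    have e : h x + (u x - g x) - u x = h x - g x := by ring
    have h3 : |h x + (u x - g x)| ≤ U0 + 3 := by
      rw [show h x + (u x - g x) = (h x - g x) + u x by ring]
      exact (abs_add_le _ _).trans (by linarith)
    have h4 := hFH _ (u x) h3 (by linarith)
    rw [e] at h4
    have h5 : |h x - g x| ^ β ≤ 3 * R ^ β := by
      calc |h x - g x| ^ β ≤ (3 * R) ^ β := Real.rpow_le_rpow (abs_nonneg _) h1 hβ.le
        _ = 3 ^ β * R ^ β := Real.mul_rpow (by norm_num) hR.le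
        _ ≤ 3 * R ^ β := by
          gcongr
          have := Real.rpow_le_rpow_of_exponent_le (x := 3) (by norm_num) hβ1
          rwa [Real.rpow_one] at this
    have h6 := mul_le_mul_of_nonneg_left h5 hA
    linarith [le_abs_self (F (h x + (u x - g x)) - F (u x))]
  rw [← hV] at hb hc hd'
  rw [← hIg] at hb
  rw [← hIh] at hc
  have hfin := cmp_core hp hV0 hσ.le hG00 ha hb hc hd' (he.trans hIgG) hσe
  have hsub : ball c (R / 2) ⊆ ball c R := ball_subset_ball (by linarith)
  have hquant : c0 * ∫ x in ball c (R / 2), ‖∇ g x - ∇ h x‖ ^ q ≤ (3 * A + 1) * R ^ β * V := by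
    rw [← integral_const_mul]
    refine le_trans (setIntegral_mono_on ((iq.mono_set hsub).const_mul c0) (((iGg.sub iGh).sub iP).mono_set hsub) measurableSet_ball fun x hx =>
      HQ σ hσ hσ1 (∇ h x) (∇ g x) ((hhU x hx).trans (le_max_left _ _)) ((hgg2 x (hsub hx)).trans (le_max_right _ _))) ?_
    refine le_trans (setIntegral_mono_set ((iGg.sub iGh).sub iP) (Filter.Eventually.of_forall hΘ0) (Filter.Eventually.of_forall hsub)) ?_
    exact hΘ.le.trans hfin
  have hlast := int_le_aff (k := 2 ^ q) (b := 2 ^ q * R ^ β) (iq2.mono_set hsub) (iq.mono_set hsub) fun x hx => by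
    have h1 : ‖∇ u x - ∇ h x‖ ≤ ‖∇ g x - ∇ h x‖ + σ := by
      have h2 := (hgu x (hbc (hsub hx))).2
      rw [norm_sub_rev] at h2
      have : ∇ u x - ∇ h x = (∇ g x - ∇ h x) + (∇ u x - ∇ g x) := by abel
      rw [this]
      exact (norm_add_le _ _).trans (by linarith)
    refine (Real.rpow_le_rpow (norm_nonneg _) h1 (by linarith)).trans ((qpow (norm_nonneg _) hσ.le (by linarith)).trans ?_)
    rw [mul_add]
    gcongr
    refine le_trans ?_ ((by linarith : σ ≤ R).trans hRβ)
    have := Real.rpow_le_rpow_of_exponent_ge hσ hσ1 (by linarith : 1 ≤ q)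
    rwa [Real.rpow_one] at this
  refine hlast.trans ?_
  have hVV : volume.real (ball c (R / 2)) ≤ V := by rw [hV]; exact measureReal_mono hsub measure_ball_lt_top.ne
  have h7 : ∫ x in ball c (R / 2), ‖∇ g x - ∇ h x‖ ^ q ≤ (3 * A + 1) * R ^ β * V / c0 := by
    rw [le_div_iff₀ hc0]; linarith
  calc _ ≤ 2 ^ q * ((3 * A + 1) * R ^ β * V / c0) + 2 ^ q * R ^ β * V := by gcongr
    _ = _ := by rw [hV2]; ring
def Adm (p A β : ℝ) (F : ℝ → ℝ) (U0 : ℝ) (Ω : Set E) (u : E → ℝ) (c : E) (R : ℝ) : Prop :=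
  LMin p F Ω u ∧ Continuous F ∧ (∀ s t, |s| ≤ U0 + 3 → |t| ≤ U0 + 3 → |F s - F t| ≤ A * |s - t| ^ β) ∧ closedBall c R ⊆ Ω ∧
    ∀ x ∈ closedBall c R, ‖∇ u x‖ ≤ 1 ∧ |u x| ≤ U0
theorem Adm.mono {U0 : ℝ} {c' : E} {R' : ℝ} (h : Adm p A β F U0 Ω u c R) (hb : closedBall c' R' ⊆ closedBall c R) :
    Adm p A β F U0 Ω u c' R' := ⟨h.1, h.2.1, h.2.2.1, hb.trans h.2.2.2.1, fun x hx => h.2.2.2.2 x (hb hx)⟩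
theorem iN {f : E → E} (hf : Measurable f) (a : E) {B : ℝ} (hq : 0 < q) (hB : ∀ x ∈ ball c ρ, ‖f x‖ ≤ B) : IntegrableOn (fun x => ‖f x - a‖ ^ q) (ball c ρ) :=
  iB hf hf (H := fun z => ‖z.1 - a‖ ^ q) (Continuous.rpow_const (by fun_prop) fun _ => Or.inr hq.le) fun x hx => ⟨hB x hx, hB x hx⟩
theorem avg_close {f : E → E} (hf : Measurable f) {a b c1 c2 : E} {ρ1 ρ2 Y B : ℝ} (hρ : 0 < ρ) (hq : 0 < q) (h1 : ball c ρ ⊆ ball c1 ρ1) (h2 : ball c ρ ⊆ ball c2 ρ2)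
    (hB1 : ∀ x ∈ ball c1 ρ1, ‖f x‖ ≤ B) (hB2 : ∀ x ∈ ball c2 ρ2, ‖f x‖ ≤ B)
    (hX : ∫ x in ball c1 ρ1, ‖f x - a‖ ^ q ≤ X * ρ ^ Module.finrank ℝ E) (hY : ∫ x in ball c2 ρ2, ‖f x - b‖ ^ q ≤ Y * ρ ^ Module.finrank ℝ E) :
    ‖a - b‖ ^ q ≤ 2 ^ q * ((X + Y) / volume.real (ball (0:E) 1)) := by
  have hω := vol_ball_pos (0:E) one_pos
  have i1 := iN hf a hq hB1
  have i2 := iN hf b hq hB2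
  have m1 : ∫ x in ball c ρ, ‖f x - a‖ ^ q ≤ X * ρ ^ Module.finrank ℝ E :=
    (setIntegral_mono_set i1 (Filter.Eventually.of_forall fun x => by positivity) (Filter.Eventually.of_forall h1)).trans hX
  have m2 : ∫ x in ball c ρ, ‖f x - b‖ ^ q ≤ Y * ρ ^ Module.finrank ℝ E :=
    (setIntegral_mono_set i2 (Filter.Eventually.of_forall fun x => by positivity) (Filter.Eventually.of_forall h2)).trans hY
  have i1' := i1.mono_set h1
  have i2' := i2.mono_set h2
  have i3 : IntegrableOn (fun x => ‖f x - a‖ ^ q + ‖f x - b‖ ^ q) (ball c ρ) := i1'.add i2'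
  have key := setIntegral_ge_of_const_le_real (c := ‖a - b‖ ^ q / 2 ^ q) measurableSet_ball (measure_ball_lt_top (x := c) (r := ρ) (μ := volume)).ne
    (fun x hx => by
      rw [div_le_iff₀ (by positivity), mul_comm]
      refine le_trans ?_ (qpow (norm_nonneg (f x - a)) (norm_nonneg (f x - b)) hq.le)
      refine Real.rpow_le_rpow (norm_nonneg _) ?_ hq.le
      rw [show a - b = (f x - b) - (f x - a) by abel, add_comm]
      exact norm_sub_le _ _) i3
  rw [integral_add i1' i2', vol_ball c hρ.le] at key
  have h3 := key.trans (add_le_add m1 m2)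
  have hρn : 0 < ρ ^ Module.finrank ℝ E := by positivity
  rw [← add_mul] at h3
  have h4 : ‖a - b‖ ^ q / 2 ^ q * volume.real (ball (0:E) 1) ≤ X + Y := by
    refine le_of_mul_le_mul_right ?_ hρn
    calc _ = ‖a - b‖ ^ q / 2 ^ q * (ρ ^ Module.finrank ℝ E * volume.real (ball (0:E) 1)) := by ring
      _ ≤ _ := h3
  rw [← le_div_iff₀ hω, div_le_iff₀ (by positivity)] at h4
  linarith
theorem ex_pt {f : E → E} (hf : Measurable f) {a : E} {B : ℝ} (hρ : 0 < ρ) (hq : 0 < q) (hX0 : 0 < X) (hB : ∀ x ∈ ball c ρ, ‖f x‖ ≤ B)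
    (hX : ∫ x in ball c ρ, ‖f x - a‖ ^ q ≤ X * ρ ^ Module.finrank ℝ E) : ∃ x ∈ ball c ρ, ‖f x - a‖ ^ q ≤ 2 * X / volume.real (ball (0:E) 1) := by
  have hω := vol_ball_pos (0:E) one_pos
  by_contra! H
  have key := setIntegral_ge_of_const_le_real (c := 2 * X / volume.real (ball (0:E) 1)) measurableSet_ball (measure_ball_lt_top (x := c) (r := ρ) (μ := volume)).ne
    (fun x hx => (H x hx).le) (iN hf a hq hB)
  rw [vol_ball c hρ.le] at key
  have hρn : 0 < ρ ^ Module.finrank ℝ E := by positivity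
  have e : 2 * X / volume.real (ball (0:E) 1) * (ρ ^ Module.finrank ℝ E * volume.real (ball (0:E) 1)) = 2 * (X * ρ ^ Module.finrank ℝ E) := by field_simp
  have : 0 < X * ρ ^ Module.finrank ℝ E := by positivity
  linarith
theorem decay (hp : 1 < p) (hA : 0 ≤ A) (hβ : 0 < β) (hβ1 : β ≤ 1) : ∃ C b l : ℝ, 0 < C ∧ 0 < b ∧ b < 1 ∧ 0 < l ∧ l < 1 ∧
    ∀ (F : ℝ → ℝ) (U0 : ℝ) (Ω : Set E) (u : E → ℝ) (c : E), Adm p A β F U0 Ω u c 1 → ∀ j : ℕ, ∃ ξ : E,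
      ∫ x in ball c (b ^ j / 2), ‖∇ u x - ξ‖ ^ (max p 2) ≤ C * l ^ j * (b ^ j / 2) ^ Module.finrank ℝ E := by
  obtain ⟨U, C, hU, hC, HC⟩ := cmp (E := E) hp hA hβ hβ1
  obtain ⟨κ, hκ, hκ1, HK⟩ := gradHolder (E := E) hp
  obtain ⟨q, hq⟩ : ∃ q, q = max p 2 := ⟨_, rfl⟩
  have hq2 : 2 ≤ q := hq ▸ le_max_right _ _
  rw [← hq] at HC ⊢
  obtain ⟨n, hn⟩ : ∃ n, n = Module.finrank ℝ E := ⟨_, rfl⟩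
  rw [← hn] at HC ⊢
  set ω := volume.real (ball (0:E) 1) with hω
  have hω0 : 0 < ω := vol_ball_pos (0:E) one_pos
  obtain ⟨s, hs⟩ : ∃ s : ℝ, s = (1 / 5 : ℝ) ^ β := ⟨_, rfl⟩
  have hs0 : 0 < s := by rw [hs]; positivity
  have hs1 : s < 1 := by rw [hs]; exact Real.rpow_lt_one (by norm_num) (by norm_num) hβ
  obtain ⟨m, hm⟩ := exists_pow_lt_of_lt_one (show 0 < 1 / 2 / (5:ℝ) ^ n by positivity) hs1
  rw [lt_div_iff₀ (by positivity)] at hm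
  obtain ⟨l, hl⟩ : ∃ l, l = max κ (1 / 2) := ⟨_, rfl⟩
  have hl1 : κ ≤ l := hl ▸ le_max_left _ _
  have hl2 : 1 / 2 ≤ l := hl ▸ le_max_right _ _
  have hl0 : 0 < l := by linarith
  refine ⟨2 ^ q * (C * 2 ^ n + (2 / κ ^ 2 * U) ^ q * ω), (1 / 5) ^ (m + 1), l, by positivity, by positivity, pow_lt_one₀ (by norm_num) (by norm_num) (by omega), hl0, ?_, fun F U0 Ω u c hu j => ?_⟩
  · rw [hl]; exact max_lt hκ1 (by norm_num)
  obtain ⟨R, hR⟩ : ∃ R : ℝ, R = (1 / 5) ^ (m * j) := ⟨_, rfl⟩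
  have hR0 : 0 < R := by rw [hR]; positivity
  have hR1 : R ≤ 1 := by rw [hR]; exact pow_le_one₀ (by norm_num) (by norm_num)
  have hbj : (((1 / 5 : ℝ) ^ (m + 1)) ^ j) / 2 = R / 2 / 5 ^ j := by
    rw [hR, ← pow_mul, show (m + 1) * j = m * j + j by ring, pow_add, one_div_pow 5 j]; field_simp
  rw [hbj]
  obtain ⟨ρ, hρ⟩ : ∃ ρ : ℝ, ρ = R / 2 / 5 ^ j := ⟨_, rfl⟩
  have hρ0 : 0 < ρ := by rw [hρ]; positivity
  have hRρ : R = 2 * 5 ^ j * ρ := by rw [hρ]; field_simp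
  have hu' := hu.mono (closedBall_subset_closedBall hR1)
  obtain ⟨δ, h, hδ, hsol, hhU, hint⟩ := HC F U0 Ω u c R hR0 hR1 hu'.1 hu'.2.1 hu'.2.2.1 hu'.2.2.2.1 hu'.2.2.2.2
  have hK := HK j δ h c (R / 2) U hδ hU (hsol.mono (ball_subset_ball (by linarith))) (by linarith) hhU
  have hsub : ball c ρ ⊆ ball c (R / 2) := ball_subset_ball (by rw [hρ]; exact div_le_self (by linarith) (one_le_pow₀ (by norm_num)))
  refine ⟨∇ h c, ?_⟩
  rw [← hρ] at hK ⊢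
  have ib : ∀ x ∈ ball c (R / 2), ‖∇ u x‖ ≤ max U 1 ∧ ‖∇ h x‖ ≤ max U 1 := fun x hx =>
    ⟨(hu'.2.2.2.2 x (ball_subset_closedBall (ball_subset_ball (by linarith) hx))).1.trans (le_max_right _ _), (hhU x hx).trans (le_max_left _ _)⟩
  have iq : IntegrableOn (fun x => ‖∇ u x - ∇ h x‖ ^ q) (ball c (R / 2)) := iB (meas_grad u) (meas_grad h) (H := fun z => ‖z.1 - z.2‖ ^ q)
    (Continuous.rpow_const (by fun_prop) fun _ => Or.inr (by linarith)) ib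
  have h1 := int_le_aff (k := 2 ^ q) (b := 2 ^ q * (2 / κ ^ 2 * U * κ ^ j) ^ q) (iN (meas_grad u) (∇ h c) (by linarith : 0 < q) fun x hx => (ib x (hsub hx)).1) (iq.mono_set hsub) fun x hx => by
    rw [← mul_add]
    have hk := hK x hx
    refine le_trans (Real.rpow_le_rpow (norm_nonneg _) ?_ (by linarith)) (qpow (norm_nonneg (∇ u x - ∇ h x)) (by positivity) (by linarith))
    rw [show ∇ u x - ∇ h c = (∇ u x - ∇ h x) + (∇ h x - ∇ h c) by abel]
    exact (norm_add_le _ _).trans (by linarith)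
  have h2 : ∫ x in ball c ρ, ‖∇ u x - ∇ h x‖ ^ q ≤ C * R ^ β * R ^ n :=
    (setIntegral_mono_set iq (Filter.Eventually.of_forall fun x => by positivity) (Filter.Eventually.of_forall hsub)).trans hint
  rw [vol_ball c hρ0.le, ← hn] at h1
  have h3 : R ^ β * R ^ n ≤ 2 ^ n * l ^ j * ρ ^ n := by
    have e1 : R ^ β = (s ^ m) ^ j := by
      rw [hR, hs, ← pow_mul, ← Real.rpow_natCast, ← Real.rpow_natCast, ← Real.rpow_mul (by norm_num), ← Real.rpow_mul (by norm_num)]; congr 1; ring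
    have e2 : R ^ n = 2 ^ n * (5 ^ n) ^ j * ρ ^ n := by
      rw [hRρ, mul_pow, mul_pow, ← pow_mul, ← pow_mul, mul_comm j n]
    rw [e1, e2]
    calc (s ^ m) ^ j * (2 ^ n * (5 ^ n) ^ j * ρ ^ n) = 2 ^ n * (s ^ m * 5 ^ n) ^ j * ρ ^ n := by rw [mul_pow (s ^ m)]; ring
      _ ≤ 2 ^ n * l ^ j * ρ ^ n := by gcongr; linarith
  have h4 : (2 / κ ^ 2 * U * κ ^ j) ^ q ≤ (2 / κ ^ 2 * U) ^ q * l ^ j := by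
    rw [Real.mul_rpow (by positivity) (by positivity)]
    gcongr
    have := Real.rpow_le_rpow_of_exponent_ge (pow_pos hκ j) (pow_le_one₀ hκ.le hκ1.le) (by linarith : 1 ≤ q)
    rw [Real.rpow_one] at this
    exact this.trans (pow_le_pow_left₀ hκ.le hl1 j)
  refine h1.trans ?_
  calc _ ≤ 2 ^ q * (C * (2 ^ n * l ^ j * ρ ^ n)) + 2 ^ q * ((2 / κ ^ 2 * U) ^ q * l ^ j) * (ρ ^ n * ω) := by
        gcongr
        refine h2.trans ?_
        rw [mul_assoc]; gcongr
    _ = _ := by ring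
theorem root_le {D : ℝ} (ht : 0 ≤ t) (hq : 0 < q) (hD : 0 ≤ D) (hl : 0 ≤ l) {j : ℕ} (h : t ^ q ≤ D * l ^ j) : t ≤ D ^ (1 / q) * (l ^ (1 / q)) ^ j := by
  have h1 := Real.rpow_le_rpow (by positivity) h (by positivity : 0 ≤ 1 / q)
  rw [← Real.rpow_mul ht, mul_one_div_cancel hq.ne', Real.rpow_one, Real.mul_rpow hD (by positivity)] at h1
  refine h1.trans (le_of_eq ?_)
  rw [← Real.rpow_natCast, ← Real.rpow_natCast, ← Real.rpow_mul hl, ← Real.rpow_mul hl, mul_comm (j:ℝ)]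
theorem equi (hp : 1 < p) (hA : 0 ≤ A) (hβ : 0 < β) (hβ1 : β ≤ 1) (hη : 0 < η) : ∃ r0 : ℝ, 0 < r0 ∧ r0 ≤ 1 ∧
    ∀ (F : ℝ → ℝ) (U0 : ℝ) (Ω : Set E) (u : E → ℝ) (c : E), Adm p A β F U0 Ω u c 2 → ∀ x ∈ closedBall c 1, ∀ y ∈ closedBall c 1, dist x y ≤ r0 → ‖∇ u x - ∇ u y‖ ≤ η := by
  obtain ⟨C, b, l, hC, hb, hb1, hl, hl1, HD⟩ := decay (E := E) hp hA hβ hβ1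
  obtain ⟨q, hq⟩ : ∃ q, q = max p 2 := ⟨_, rfl⟩
  have hq2 : 2 ≤ q := hq ▸ le_max_right _ _
  have hq0 : 0 < q := by linarith
  rw [← hq] at HD
  obtain ⟨n, hn⟩ : ∃ n, n = Module.finrank ℝ E := ⟨_, rfl⟩
  rw [← hn] at HD
  set ω := volume.real (ball (0:E) 1) with hω
  have hω0 : 0 < ω := vol_ball_pos (0:E) one_pos
  obtain ⟨D, hD⟩ : ∃ D, D = 2 ^ q * ((C * (1 / b) ^ n + C) / ω) + 2 * C / ω + 2 ^ q * ((C * 2 ^ n + C * 2 ^ n) / ω) := ⟨_, rfl⟩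
  have hD0 : 0 ≤ D := by rw [hD]; positivity
  have hD1 : 2 ^ q * ((C * (1 / b) ^ n + C) / ω) ≤ D := by rw [hD, add_assoc]; exact le_add_of_nonneg_right (by positivity)
  have hD2 : 2 * C / ω ≤ D := by rw [hD, add_assoc, add_left_comm]; exact le_add_of_nonneg_right (by positivity)
  have hD3 : 2 ^ q * ((C * 2 ^ n + C * 2 ^ n) / ω) ≤ D := by rw [hD]; exact le_add_of_nonneg_left (by positivity)
  obtain ⟨k, hk⟩ : ∃ k, k = l ^ (1 / q) := ⟨_, rfl⟩
  have hk0 : 0 < k := by rw [hk]; positivity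
  have hk1 : k < 1 := by rw [hk]; exact Real.rpow_lt_one hl.le hl1 (by positivity)
  obtain ⟨D', hD'⟩ : ∃ D', D' = D ^ (1 / q) := ⟨_, rfl⟩
  have hD'0 : 0 ≤ D' := by rw [hD']; positivity
  have root : ∀ {t : ℝ} {j : ℕ} {D1 : ℝ}, 0 ≤ t → D1 ≤ D → t ^ q ≤ D1 * l ^ j → t ≤ D' * k ^ j := fun ht h1 h => by
    rw [hD', hk]; exact root_le ht hq0 hD0 hl.le (h.trans (by gcongr))
  have hρ0 : ∀ j : ℕ, 0 < b ^ j / 2 := fun j => by positivity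
  have hρ1 : ∀ j : ℕ, b ^ j / 2 ≤ 1 := fun j => by linarith [pow_le_one₀ (n := j) hb.le hb1.le]
  have HP : ∀ (F : ℝ → ℝ) (U0 : ℝ) (Ω : Set E) (u : E → ℝ) (c : E), Adm p A β F U0 Ω u c 1 → ∀ j : ℕ, ∃ ξ : E,
      (∫ x in ball c (b ^ j / 2), ‖∇ u x - ξ‖ ^ q ≤ C * l ^ j * (b ^ j / 2) ^ n) ∧ ‖ξ - ∇ u c‖ ≤ D' / (1 - k) * k ^ j := by
    intro F U0 Ω u c hu
    choose ξ hξ using HD F U0 Ω u c hu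
    have hB : ∀ j, ∀ x ∈ ball c (b ^ j / 2), ‖∇ u x‖ ≤ 1 := fun j x hx => (hu.2.2.2.2 x (ball_subset_closedBall (ball_subset_ball (hρ1 j) hx))).1
    have hstep : ∀ j, dist (ξ j) (ξ (j + 1)) ≤ D' * k ^ j := fun j => by
      rw [dist_eq_norm]
      refine root (norm_nonneg _) hD1 ?_
      have h1 := avg_close (meas_grad u) (X := C * l ^ j * (1 / b) ^ n) (Y := C * l ^ j) (hρ0 (j + 1)) hq0 (ball_subset_ball (div_le_div_of_nonneg_right (pow_le_pow_of_le_one hb.le hb1.le (by omega)) zero_le_two)) subset_rfl (hB j) (hB (j + 1))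
        (by rw [← hn]; refine (hξ j).trans (le_of_eq ?_)
            rw [pow_succ, mul_assoc (C * l ^ j), ← mul_pow]; congr 2; field_simp)
        (by rw [← hn]; refine (hξ (j + 1)).trans ?_
            gcongr C * ?_ * _
            exact pow_le_pow_of_le_one hl.le hl1.le (by omega))
      refine h1.trans (le_of_eq ?_); rw [← hω]; ring
    have hlim : Filter.Tendsto ξ Filter.atTop (nhds (∇ u c)) := by
      have : ∀ j, ∃ x ∈ ball c (b ^ j / 2), ‖∇ u x - ξ j‖ ≤ D' * k ^ j := fun j => by
        obtain ⟨x, hx, hx2⟩ := ex_pt (meas_grad u) (X := C * l ^ j) (hρ0 j) hq0 (by positivity) (hB j) (by rw [← hn]; exact hξ j)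
        refine ⟨x, hx, root (norm_nonneg _) hD2 (hx2.trans (le_of_eq ?_))⟩
        rw [← hω]; ring
      choose y hy hy2 using this
      have hkt := tendsto_pow_atTop_nhds_zero_of_lt_one hk0.le hk1
      have hbt := tendsto_pow_atTop_nhds_zero_of_lt_one hb.le hb1
      have hyc : Filter.Tendsto y Filter.atTop (nhds c) := by
        rw [tendsto_iff_dist_tendsto_zero]
        refine squeeze_zero (fun _ => dist_nonneg) (fun j => ?_) hbt
        have := hy j
        rw [mem_ball] at this
        have h3 : 0 < b ^ j := by positivity
        linarith
      have hcΩ : c ∈ Ω := hu.2.2.2.1 (mem_closedBall_self zero_le_one)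
      have hgc : Filter.Tendsto (fun j => ∇ u (y j)) Filter.atTop (nhds (∇ u c)) := ((hu.1.2.2.1.continuousAt (hu.1.1.mem_nhds hcΩ)).tendsto).comp hyc
      have hz : Filter.Tendsto (fun j => ∇ u (y j) - ξ j) Filter.atTop (nhds 0) := by
        rw [tendsto_zero_iff_norm_tendsto_zero]
        refine squeeze_zero (fun _ => norm_nonneg _) hy2 ?_
        simpa using hkt.const_mul D'
      simpa using hgc.sub hz
    intro j
    refine ⟨ξ j, hξ j, ?_⟩
    have := dist_le_of_le_geometric_of_tendsto k D' hk1 hstep hlim j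
    rw [dist_eq_norm] at this
    exact this.trans (le_of_eq (by ring))
  obtain ⟨D4, hD4⟩ : ∃ D4, D4 = 2 * (D' / (1 - k)) + D' := ⟨_, rfl⟩
  have hk2 : 0 < 1 - k := by linarith
  have hD40 : 0 ≤ D4 := by rw [hD4]; positivity
  obtain ⟨j, hj⟩ := exists_pow_lt_of_lt_one (show 0 < η / (D4 + 1) by positivity) hk1
  have hjη : D4 * k ^ j ≤ η := by
    rw [lt_div_iff₀ (by positivity)] at hj
    have : 0 < k ^ j := by positivity
    linarith
  refine ⟨b ^ j / 2 / 2, by positivity, by linarith [hρ1 j, hρ0 j], fun F U0 Ω u c hu x hx y hy hxy => ?_⟩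
  have hsub : ∀ z ∈ closedBall c 1, closedBall z 1 ⊆ closedBall c 2 := fun z hz => closedBall_subset_closedBall' (by rw [mem_closedBall] at hz; linarith)
  obtain ⟨ξ, h1, h2⟩ := HP F U0 Ω u x (hu.mono (hsub x hx)) j
  obtain ⟨ζ, h3, h4⟩ := HP F U0 Ω u y (hu.mono (hsub y hy)) j
  have hB : ∀ z ∈ closedBall c 1, ∀ w ∈ ball z (b ^ j / 2), ‖∇ u w‖ ≤ 1 := fun z hz w hw => (hu.2.2.2.2 w (hsub z hz (ball_subset_closedBall (ball_subset_ball (hρ1 j) hw)))).1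
  have hpow : (b ^ j / 2) ^ n = 2 ^ n * (b ^ j / 2 / 2) ^ n := by rw [← mul_pow]; congr 1; ring
  have h5 := avg_close (meas_grad u) (X := C * l ^ j * 2 ^ n) (Y := C * l ^ j * 2 ^ n) (c := x) (ρ := b ^ j / 2 / 2) (by positivity) hq0 (ball_subset_ball (by linarith [hρ0 j]))
    (ball_subset_ball' (by linarith)) (hB x hx) (hB y hy) (by rw [← hn, mul_assoc (C * l ^ j), ← hpow]; exact h1) (by rw [← hn, mul_assoc (C * l ^ j), ← hpow]; exact h3)
  have h6 : ‖ξ - ζ‖ ≤ D' * k ^ j := root (norm_nonneg _) hD3 (h5.trans (le_of_eq (by rw [← hω]; ring)))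
  rw [norm_sub_rev] at h2
  have h7 : ‖∇ u x - ∇ u y‖ ≤ ‖∇ u x - ξ‖ + ‖ξ - ζ‖ + ‖ζ - ∇ u y‖ := by
    rw [show ∇ u x - ∇ u y = (∇ u x - ξ) + (ξ - ζ) + (ζ - ∇ u y) by abel]
    exact (norm_add_le _ _).trans (add_le_add (norm_add_le _ _) le_rfl)
  have h8 : D4 * k ^ j = D' / (1 - k) * k ^ j + D' * k ^ j + D' / (1 - k) * k ^ j := by rw [hD4]; ring
  linarith
noncomputable def scl (x0 : E) (t m : ℝ) (u : E → ℝ) : E → ℝ := fun y => m⁻¹ * u (x0 + t • y)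
theorem grad_scl (x0 : E) (t m : ℝ) (u : E → ℝ) (y : E) : ∇ (scl x0 t m u) y = (m⁻¹ * t) • ∇ u (x0 + t • y) := by
  unfold scl
  rw [grad_smul_at (f := fun y => u (x0 + t • y)), mul_smul]
  congr 1
  unfold gradient
  rw [fderiv_comp_smul (f := fun z => u (x0 + z)), fderiv_comp_add_left, map_smul]
theorem norm_grad_scl (x0 : E) (ht : 0 < t) (hm : 0 < m) (u : E → ℝ) (y : E) : ‖∇ (scl x0 t m u) y‖ = t / m * ‖∇ u (x0 + t • y)‖ := by
  rw [grad_scl, norm_smul, Real.norm_of_nonneg (by positivity)]; ring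
theorem pre_ball (ht : 0 < t) (y : E) : x0 + t • y ∈ ball (x0 + t • z) (t * r) ↔ y ∈ ball z r := by
  rw [mem_ball, mem_ball, dist_add_left, dist_smul₀, Real.norm_of_nonneg ht.le, mul_lt_mul_iff_right₀ ht]
theorem pre_cball (ht : 0 < t) (y : E) : x0 + t • y ∈ closedBall (x0 + t • z) (t * r) ↔ y ∈ closedBall z r := by
  rw [mem_closedBall, mem_closedBall, dist_add_left, dist_smul₀, Real.norm_of_nonneg ht.le, mul_le_mul_iff_right₀ ht]
theorem cov (x0 z : E) (ht : 0 < t) (r : ℝ) (g : E → ℝ) :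
    ∫ y in ball z r, g (x0 + t • y) = (t ^ Module.finrank ℝ E)⁻¹ * ∫ x in ball (x0 + t • z) (t * r), g x := by
  rw [← integral_indicator measurableSet_ball, ← integral_indicator measurableSet_ball]
  have e : (fun y => (ball z r).indicator (fun y => g (x0 + t • y)) y) = fun y => (fun w => (ball (x0 + t • z) (t * r)).indicator g (x0 + w)) (t • y) := by
    ext y
    by_cases hy : y ∈ ball z r
    · rw [indicator_of_mem hy]; show _ = indicator _ _ _; rw [indicator_of_mem ((pre_ball ht y).2 hy)]
    · rw [indicator_of_notMem hy]; show _ = indicator _ _ _; rw [indicator_of_notMem (fun h => hy ((pre_ball ht y).1 h))]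
  have e2 := Measure.integral_comp_smul_of_nonneg volume (fun w => (ball (x0 + t • z) (t * r)).indicator g (x0 + w)) t (hR := ht.le)
  rw [integral_add_left_eq_self (fun w => (ball (x0 + t • z) (t * r)).indicator g w) x0, smul_eq_mul] at e2
  rw [← e2]
  exact congrArg (fun f => ∫ y, f y) e
theorem en_scl (F : ℝ → ℝ) (x0 z : E) (ht : 0 < t) (hm : 0 < m) (r : ℝ) (w : E → ℝ) :
    ∫ y in ball z r, (‖∇ (scl x0 t m w) y‖ ^ p / p + (t / m) ^ p * F (m * scl x0 t m w y)) =
      (t / m) ^ p * ((t ^ Module.finrank ℝ E)⁻¹ * ∫ x in ball (x0 + t • z) (t * r), (‖∇ w x‖ ^ p / p + F (w x))) := by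
  rw [← cov x0 z ht r (fun x => ‖∇ w x‖ ^ p / p + F (w x)), ← integral_const_mul]
  congr 1
  ext y
  rw [norm_grad_scl x0 ht hm, Real.mul_rpow (by positivity) (norm_nonneg _)]
  unfold scl
  rw [← mul_assoc m, mul_inv_cancel₀ hm.ne', one_mul]
  ring
theorem LMin.scale (hu : LMin p F Ω u) (x0 : E) (ht : 0 < t) (hm : 0 < m) :
    LMin p (fun s => (t / m) ^ p * F (m * s)) {y | x0 + t • y ∈ Ω} (scl x0 t m u) := by
  obtain ⟨hΩ, hd, hc, hmin⟩ := hu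
  have hcont : Continuous fun y : E => x0 + t • y := by fun_prop
  refine ⟨hΩ.preimage hcont, fun y hy => ?_, ?_, fun z r hr hs v K hv hE => ?_⟩
  · have h1 : DifferentiableAt ℝ u (x0 + t • y) := hd _ hy
    have h2 : DifferentiableAt ℝ (fun y : E => x0 + t • y) y := by fun_prop
    exact (h1.comp y h2).const_mul m⁻¹
  · have : (fun y => ∇ (scl x0 t m u) y) = fun y => (m⁻¹ * t) • ∇ u (x0 + t • y) := by ext1 y; exact grad_scl x0 t m u y
    rw [this]
    exact (hc.comp hcont.continuousOn fun y hy => hy).const_smul (m⁻¹ * t)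
  · obtain ⟨w, hw⟩ : ∃ w : E → ℝ, w = fun x => m * v (t⁻¹ • (x - x0)) := ⟨_, rfl⟩
    have hvw : scl x0 t m w = v := by
      ext y
      unfold scl
      rw [hw]
      show m⁻¹ * (m * v (t⁻¹ • (x0 + t • y - x0))) = v y
      rw [add_sub_cancel_left, inv_smul_smul₀ ht.ne', ← mul_assoc, inv_mul_cancel₀ hm.ne', one_mul]
    have hinv : ∀ x : E, x0 + t • (t⁻¹ • (x - x0)) = x := fun x => by rw [smul_inv_smul₀ ht.ne']; abel
    rw [← hvw, en_scl F x0 z ht hm, en_scl F x0 z ht hm]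
    refine mul_le_mul_of_nonneg_left (mul_le_mul_of_nonneg_left ?_ (by positivity)) (by positivity)
    refine hmin (x0 + t • z) (t * r) (by positivity) (fun x hx => ?_) w (Real.toNNReal (m * (K * t⁻¹))) ?_ ?_
    · rw [← hinv x] at hx ⊢
      exact hs ((pre_cball ht _).1 hx)
    · refine LipschitzOnWith.of_dist_le_mul fun x hx y hy => ?_
      rw [← hinv x, pre_cball ht] at hx
      rw [← hinv y, pre_cball ht] at hy
      have h1 := hv.dist_le_mul _ hx _ hy
      rw [dist_smul₀, dist_sub_right, Real.norm_of_nonneg (by positivity)] at h1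
      rw [Real.coe_toNNReal _ (by positivity), hw]
      show dist (m * v (t⁻¹ • (x - x0))) (m * v (t⁻¹ • (y - x0))) ≤ _
      rw [Real.dist_eq, ← mul_sub, abs_mul, abs_of_pos hm, ← Real.dist_eq]
      calc _ ≤ m * (K * (t⁻¹ * dist x y)) := by gcongr
        _ = _ := by ring
    · intro x hx
      have hx' : t⁻¹ • (x - x0) ∈ sphere z r := by
        rw [← hinv x, mem_sphere, dist_add_left, dist_smul₀, Real.norm_of_nonneg ht.le] at hx
        exact mul_left_cancel₀ ht.ne' hx
      have h1 := hE hx'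
      rw [hw]
      show m * v (t⁻¹ • (x - x0)) = u x
      rw [h1]
      unfold scl
      rw [hinv, ← mul_assoc, mul_inv_cancel₀ hm.ne', one_mul]
theorem pow_holder (hγ : 0 < γ) {B : ℝ} (hB : 0 ≤ B) : ∃ A : ℝ, 0 ≤ A ∧ ∀ a b, 0 ≤ a → 0 ≤ b → a ≤ B → b ≤ B → |a ^ γ - b ^ γ| ≤ A * |a - b| ^ (min γ 1) := by
  rcases le_total γ 1 with h | h
  · rw [min_eq_left h]
    refine ⟨1, zero_le_one, ?_⟩
    have key : ∀ a b : ℝ, 0 ≤ b → b ≤ a → |a ^ γ - b ^ γ| ≤ 1 * |a - b| ^ γ := fun a b hb hab => by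
      rw [abs_of_nonneg (sub_nonneg.2 hab), abs_of_nonneg (sub_nonneg.2 (Real.rpow_le_rpow hb hab hγ.le)), one_mul]
      have := Real.rpow_add_le_add_rpow (sub_nonneg.2 hab) hb hγ.le h
      rw [sub_add_cancel] at this; linarith
    intro a b ha hb _ _
    rcases le_total a b with h1 | h1
    · rw [abs_sub_comm, abs_sub_comm a b]; exact key b a ha h1
    · exact key a b hb h1
  · rw [min_eq_right h]
    refine ⟨γ * B ^ (γ - 1), by positivity, fun a b ha hb haB hbB => ?_⟩
    rw [Real.rpow_one]
    have := (convex_Icc (0:ℝ) B).norm_image_sub_le_of_norm_deriv_le (f := fun x => x ^ γ) (C := γ * B ^ (γ - 1)) (x := b) (y := a)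
      (fun x hx => (Real.hasDerivAt_rpow_const (Or.inr h)).differentiableAt) (fun x hx => by
        rw [(Real.hasDerivAt_rpow_const (Or.inr h)).deriv, Real.norm_of_nonneg (mul_nonneg hγ.le (Real.rpow_nonneg hx.1 _))]
        exact mul_le_mul_of_nonneg_left (Real.rpow_le_rpow hx.1 hx.2 (by linarith)) hγ.le) ⟨hb, hbB⟩ ⟨ha, haB⟩
    rwa [Real.norm_eq_abs, Real.norm_eq_abs] at this
def HF (γ β : ℝ) (F : ℝ → ℝ) : Prop := Continuous F ∧ (∀ m s, 0 < m → F (m * s) = m ^ γ * F s) ∧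
  ∀ B, 0 ≤ B → ∃ A, 0 ≤ A ∧ ∀ s t, |s| ≤ B → |t| ≤ B → |F s - F t| ≤ A * |s - t| ^ β
theorem HF_F (hγ : 0 < γ) (ha : 0 < a) (hb : 0 < b) : HF γ (min γ 1) (fun t => a * (max t 0) ^ γ + b * (max (-t) 0) ^ γ) := by
  refine ⟨?_, fun m s hm => ?_, fun B hB => ?_⟩
  · exact (continuous_const.mul ((continuous_id.max continuous_const).rpow_const fun _ => Or.inr hγ.le)).add
      (continuous_const.mul ((continuous_neg.max continuous_const).rpow_const fun _ => Or.inr hγ.le))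
  · have e1 : max (m * s) 0 = m * max s 0 := by rw [mul_max_of_nonneg _ _ hm.le, mul_zero]
    have e2 : max (-(m * s)) 0 = m * max (-s) 0 := by rw [mul_max_of_nonneg _ _ hm.le, mul_zero, mul_neg]
    show a * (max (m * s) 0) ^ γ + b * (max (-(m * s)) 0) ^ γ = m ^ γ * (a * (max s 0) ^ γ + b * (max (-s) 0) ^ γ)
    rw [e1, e2, Real.mul_rpow hm.le (le_max_right _ _), Real.mul_rpow hm.le (le_max_right _ _)]
    ring
  · obtain ⟨A, hA, H⟩ := pow_holder hγ hB
    refine ⟨(a + b) * A, by positivity, fun s t hs ht => ?_⟩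
    have hs' := abs_le.1 hs
    have ht' := abs_le.1 ht
    have h1 := H (max s 0) (max t 0) (le_max_right _ _) (le_max_right _ _) (max_le hs'.2 hB) (max_le ht'.2 hB)
    have h2 := H (max (-s) 0) (max (-t) 0) (le_max_right _ _) (le_max_right _ _) (max_le (by linarith) hB) (max_le (by linarith) hB)
    have e1 : |max s 0 - max t 0| ≤ |s - t| := abs_max_sub_max_le_abs s t 0
    have e2 : |max (-s) 0 - max (-t) 0| ≤ |s - t| := by
      have := abs_max_sub_max_le_abs (-s) (-t) 0
      rwa [show -s - -t = -(s - t) by ring, abs_neg] at this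
    have hm : 0 < min γ 1 := lt_min hγ one_pos
    have f1 := h1.trans (mul_le_mul_of_nonneg_left (Real.rpow_le_rpow (abs_nonneg _) e1 hm.le) hA)
    have f2 := h2.trans (mul_le_mul_of_nonneg_left (Real.rpow_le_rpow (abs_nonneg _) e2 hm.le) hA)
    show |a * (max s 0) ^ γ + b * (max (-s) 0) ^ γ - (a * (max t 0) ^ γ + b * (max (-t) 0) ^ γ)| ≤ _
    rw [show a * (max s 0) ^ γ + b * (max (-s) 0) ^ γ - (a * (max t 0) ^ γ + b * (max (-t) 0) ^ γ) = a * ((max s 0) ^ γ - (max t 0) ^ γ) + b * ((max (-s) 0) ^ γ - (max (-t) 0) ^ γ) by ring]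
    refine (abs_add_le _ _).trans ?_
    rw [abs_mul, abs_mul, abs_of_pos ha, abs_of_pos hb]
    have g1 := mul_le_mul_of_nonneg_left f1 ha.le
    have g2 := mul_le_mul_of_nonneg_left f2 hb.le
    linarith
theorem mvt (hd : ∀ y ∈ closedBall x r, DifferentiableAt ℝ u y) (h : ∀ y ∈ closedBall x r, ‖∇ u y - ∇ u x‖ ≤ η) (hy : y ∈ closedBall x r) :
    |u y - u x - ⟪∇ u x, y - x⟫_ℝ| ≤ η * ‖y - x‖ := by
  have hx : x ∈ closedBall x r := mem_closedBall_self (dist_nonneg.trans hy)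
  have := (convex_closedBall x r).norm_image_sub_le_of_norm_fderiv_le' (φ := fderiv ℝ u x) hd (fun z hz => by rw [fd_sub]; exact h z hz) hx hy
  rwa [Real.norm_eq_abs, ← inner_gradient_left] at this
theorem lipest {M : ℝ} (hp : 1 < p) (hγ : 0 < γ) (hγp : γ < p) (hβ : 0 < β) (hβ1 : β ≤ 1) (hF : HF γ β F) (hM : 0 < M) (hd : 0 < d) :
    ∃ L0 : ℝ, 0 < L0 ∧ ∀ (Ω : Set E) (u : E → ℝ) (z : E), LMin p F Ω u → ball z d ⊆ Ω → (∀ x ∈ Ω, |u x| ≤ M) → ∀ x ∈ closedBall z (d / 2), ‖∇ u x‖ ≤ L0 := by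
  have hp0 : 0 < p := by linarith
  obtain ⟨A, hA, HA⟩ := hF.2.2 (M + 3) (by linarith)
  obtain ⟨r0, hr0, hr01, H⟩ := equi (E := E) hp (A := d ^ p * A) (by positivity) hβ hβ1 (show (0:ℝ) < 1 / 4 by norm_num)
  refine ⟨(4 + 16 * M / r0) / (d / 4), by positivity, fun Ω u z hu hz hb x hx => ?_⟩
  have hsub : closedBall z (3 * d / 4) ⊆ Ω := (closedBall_subset_ball (by linarith)).trans hz
  have hcont : ContinuousOn (fun y => (3 * d / 4 - dist y z) * ‖∇ u y‖) (closedBall z (3 * d / 4)) :=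
    (Continuous.continuousOn (by fun_prop)).mul (hu.2.2.1.mono hsub).norm
  obtain ⟨x1, hx1, hmax⟩ := (isCompact_closedBall z (3 * d / 4)).exists_isMaxOn ⟨z, mem_closedBall_self (by positivity)⟩ hcont
  have hmax' : ∀ y ∈ closedBall z (3 * d / 4), (3 * d / 4 - dist y z) * ‖∇ u y‖ ≤ (3 * d / 4 - dist x1 z) * ‖∇ u x1‖ := fun y hy => hmax hy
  obtain ⟨t, ht⟩ : ∃ t, t = (3 * d / 4 - dist x1 z) / 4 := ⟨_, rfl⟩
  obtain ⟨L, hL⟩ : ∃ L, L = ‖∇ u x1‖ := ⟨_, rfl⟩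
  have hL0 : 0 ≤ L := by rw [hL]; positivity
  have ht4 : 3 * d / 4 - dist x1 z = 4 * t := by rw [ht]; ring
  rw [mem_closedBall] at hx1 hx
  have ht0 : 0 ≤ t := by linarith
  have htd : t ≤ d := by have := dist_nonneg (x := x1) (y := z); linarith
  rw [ht4, ← hL] at hmax'
  have hP : 4 * t * L ≤ 4 + 16 * M / r0 := by
    have hMr : 0 ≤ 16 * M / r0 := by positivity
    rcases le_total (t * L) 1 with h1 | h1
    · linarith
    have htp : 0 < t := by
      rcases ht0.eq_or_lt with h | h
      · rw [← h, zero_mul] at h1; linarith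
      · exact h
    have hLp : 0 < L := by
      rcases hL0.eq_or_lt with h | h
      · rw [← h, mul_zero] at h1; linarith
      · exact h
    obtain ⟨m, hm⟩ : ∃ m, m = 2 * (t * L) := ⟨_, rfl⟩
    have hm1 : 1 ≤ m := by linarith
    have hm0 : 0 < m := by linarith
    have htm : t / m = 1 / (2 * L) := by rw [hm]; field_simp
    have hmap : ∀ y ∈ closedBall (0:E) 2, dist (x1 + t • y) z ≤ 3 * d / 4 - 2 * t := fun y hy => by
      rw [mem_closedBall_zero_iff] at hy
      have h2 : dist (x1 + t • y) x1 ≤ t * 2 := by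
        rw [dist_eq_norm, add_sub_cancel_left, norm_smul, Real.norm_of_nonneg ht0]; gcongr
      linarith [dist_triangle (x1 + t • y) x1 z]
    have hin : ∀ y ∈ closedBall (0:E) 2, x1 + t • y ∈ closedBall z (3 * d / 4) := fun y hy => by
      rw [mem_closedBall]; linarith [hmap y hy]
    have hadm : Adm p (d ^ p * A) β (fun s => (t / m) ^ p * F (m * s)) M {y | x1 + t • y ∈ Ω} (scl x1 t m u) 0 2 := by
      refine ⟨hu.scale x1 htp hm0, by have := hF.1; fun_prop, fun s s' hs hs' => ?_, fun y hy => hsub (hin y hy), fun y hy => ⟨?_, ?_⟩⟩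
      · show |(t / m) ^ p * F (m * s) - (t / m) ^ p * F (m * s')| ≤ _
        rw [hF.2.1 m s hm0, hF.2.1 m s' hm0, ← mul_sub, ← mul_sub, ← mul_assoc, abs_mul, abs_of_nonneg (by positivity), mul_assoc (d ^ p)]
        refine mul_le_mul ?_ (HA s s' hs hs') (abs_nonneg _) (by positivity)
        rw [Real.div_rpow ht0 hm0.le, div_mul_eq_mul_div, div_le_iff₀ (by positivity)]
        exact mul_le_mul (Real.rpow_le_rpow ht0 htd hp0.le) (Real.rpow_le_rpow_of_exponent_le hm1 hγp.le) (by positivity) (by positivity)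
      · rw [norm_grad_scl x1 htp hm0, htm, div_mul_eq_mul_div, one_mul, div_le_one (by positivity)]
        have h2 := hmax' _ (hin y hy)
        have h3 := hmap y hy
        have h4 : 2 * t * ‖∇ u (x1 + t • y)‖ ≤ 4 * t * L := le_trans (mul_le_mul_of_nonneg_right (by linarith) (norm_nonneg _)) h2
        refine le_of_mul_le_mul_left ?_ (show 0 < 2 * t by linarith)
        linarith
      · unfold scl
        rw [abs_mul, abs_of_pos (by positivity)]
        calc m⁻¹ * |u (x1 + t • y)| ≤ 1 * M := mul_le_mul (inv_le_one_of_one_le₀ hm1) (hb _ (hsub (hin y hy))) (abs_nonneg _) zero_le_one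
          _ = M := one_mul M
    have hE := H _ _ _ _ _ hadm
    obtain ⟨v, hv⟩ : ∃ v, v = scl x1 t m u := ⟨_, rfl⟩
    have hv0 : ‖∇ v 0‖ = 1 / 2 := by
      rw [hv, norm_grad_scl x1 htp hm0, smul_zero, add_zero, ← hL, htm]; field_simp
    rw [← hv] at hadm hE
    have hmv := mvt (u := v) (x := 0) (r := r0) (η := 1 / 4) (y := (r0 * 2) • ∇ v 0)
      (fun y hy => hadm.1.2.1 y (hadm.2.2.2.1 (closedBall_subset_closedBall (by linarith) hy)))
      (fun y hy => hE y (closedBall_subset_closedBall hr01 hy) 0 (mem_closedBall_self zero_le_one) hy)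
      (by rw [mem_closedBall_zero_iff, norm_smul, hv0, Real.norm_of_nonneg (by positivity)]; linarith)
    rw [sub_zero, inner_smul_right, real_inner_self_eq_norm_sq, norm_smul, hv0, Real.norm_of_nonneg (by positivity)] at hmv
    have hvb : ∀ y ∈ closedBall (0:E) 2, |v y| ≤ M / m := fun y hy => by
      rw [hv]; unfold scl
      rw [abs_mul, abs_of_pos (by positivity), div_eq_inv_mul]
      exact mul_le_mul_of_nonneg_left (hb _ (hsub (hin y hy))) (by positivity)
    have b1 := abs_le.1 (hvb ((r0 * 2) • ∇ v 0) (by rw [mem_closedBall_zero_iff, norm_smul, hv0, Real.norm_of_nonneg (by positivity)]; linarith))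
    have b2 := abs_le.1 (hvb 0 (mem_closedBall_self zero_le_two))
    have b3 := abs_le.1 hmv
    have b4 : r0 / 4 ≤ 2 * (M / m) := by linarith
    have b5 : m ≤ 8 * M / r0 := by
      rw [le_div_iff₀ hr0]
      have b6 := mul_le_mul_of_nonneg_right b4 hm0.le
      rw [mul_assoc, div_mul_cancel₀ _ hm0.ne'] at b6
      linarith
    have : 2 * (8 * M / r0) = 16 * M / r0 := by ring
    linarith
  rw [le_div_iff₀ (by positivity)]
  have h5 := hmax' x (by rw [mem_closedBall]; linarith)
  have h6 : d / 4 * ‖∇ u x‖ ≤ (3 * d / 4 - dist x z) * ‖∇ u x‖ := mul_le_mul_of_nonneg_right (by linarith) (norm_nonneg _)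
  linarith
def BS (p τ : ℝ) (F : ℝ → ℝ) (ε R : ℝ) (Ω : Set E) (v : E → ℝ) : Prop :=
  LMin p (fun s => ε * F s) Ω v ∧ 0 ≤ ε ∧ closedBall 0 R ⊆ Ω ∧ (∀ y ∈ closedBall 0 R, ‖∇ v y‖ ≤ (max ‖y‖ 1) ^ τ) ∧ v 0 = 0 ∧ ∇ v 0 = 0
theorem BS.bd {v : E → ℝ} (h : BS p τ F ε R Ω v) (hτ : 0 ≤ τ) {S : ℝ} (hS : 1 ≤ S) (hSR : S ≤ R) (hy : y ∈ closedBall 0 S) :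
    ‖∇ v y‖ ≤ S ^ τ ∧ |v y| ≤ S ^ τ * ‖y‖ := by
  have h1 : ∀ y ∈ closedBall (0:E) S, ‖∇ v y‖ ≤ S ^ τ := fun y hy => by
    refine (h.2.2.2.1 y (closedBall_subset_closedBall hSR hy)).trans (Real.rpow_le_rpow (by positivity) (max_le ?_ hS) hτ)
    rwa [mem_closedBall_zero_iff] at hy
  refine ⟨h1 y hy, ?_⟩
  have h0 : (0:E) ∈ closedBall (0:E) S := mem_closedBall_self (by linarith)
  have := (lip_u h.1.2.1 ((closedBall_subset_closedBall hSR).trans h.2.2.1) (convex_closedBall 0 S) (by positivity) h1).dist_le_mul y hy 0 h0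
  rwa [Real.coe_toNNReal _ (by positivity), h.2.2.2.2.1, Real.dist_eq, sub_zero, dist_zero_right] at this
theorem bs_equi (hp : 1 < p) (hβ : 0 < β) (hβ1 : β ≤ 1) (hτ : 0 ≤ τ) (hF : HF γ β F) (x : E) (hη : 0 < η) :
    ∃ δ : ℝ, 0 < δ ∧ ∀ (ε R : ℝ) (Ω : Set E) (v : E → ℝ), ε ≤ 1 → ‖x‖ + 2 ≤ R → BS p τ F ε R Ω v → ∀ y, dist y x ≤ δ → ‖∇ v y - ∇ v x‖ ≤ η ∧ |v y - v x - ⟪∇ v x, y - x⟫_ℝ| ≤ η * ‖y - x‖ := by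
  obtain ⟨S, hS⟩ : ∃ S, S = ‖x‖ + 2 := ⟨_, rfl⟩
  have hS2 : 2 ≤ S := by linarith [norm_nonneg x]
  obtain ⟨m, hm⟩ : ∃ m, m = S ^ τ := ⟨_, rfl⟩
  have hm1 : 1 ≤ m := by rw [hm]; exact Real.one_le_rpow (by linarith) hτ
  have hm0 : 0 < m := by linarith
  obtain ⟨A, hA, HA⟩ := hF.2.2 (m * (S + 3)) (by positivity)
  obtain ⟨r0, hr0, hr01, H⟩ := equi (E := E) hp (A := A * m ^ β) (by positivity) hβ hβ1 (show (0:ℝ) < η / m by positivity)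
  refine ⟨r0, hr0, fun ε R Ω v hε hR hv => ?_⟩
  rw [← hS] at hR
  have hsc := hv.1.scale (0:E) one_pos hm0
  have hin : closedBall x 2 ⊆ closedBall (0:E) S := closedBall_subset_closedBall' (by rw [dist_zero_right]; linarith)
  have hinR : closedBall x 2 ⊆ Ω := (hin.trans (closedBall_subset_closedBall hR)).trans hv.2.2.1
  have hg : ∀ y, ∇ (scl 0 1 m v) y = m⁻¹ • ∇ v y := fun y => by rw [grad_scl, mul_one, one_smul, zero_add]
  have hadm : Adm p (A * m ^ β) β (fun s => (1 / m) ^ p * (ε * F (m * s))) S {y | (0:E) + (1:ℝ) • y ∈ Ω} (scl 0 1 m v) x 2 := by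
    refine ⟨hsc, by have := hF.1; fun_prop, fun s t hs ht => ?_, fun y hy => ?_, fun y hy => ⟨?_, ?_⟩⟩
    · show |(1 / m) ^ p * (ε * F (m * s)) - (1 / m) ^ p * (ε * F (m * t))| ≤ _
      have h1 := HA (m * s) (m * t) (by rw [abs_mul, abs_of_pos hm0]; gcongr) (by rw [abs_mul, abs_of_pos hm0]; gcongr)
      rw [← mul_sub m, abs_mul m, abs_of_pos hm0, Real.mul_rpow hm0.le (abs_nonneg _), ← mul_assoc] at h1
      refine le_trans ?_ h1
      rw [← mul_sub, ← mul_sub, ← mul_assoc, abs_mul, abs_of_nonneg (mul_nonneg (by positivity) hv.2.1)]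
      refine mul_le_of_le_one_left (abs_nonneg _) (mul_le_one₀ (Real.rpow_le_one (by positivity) ?_ (by linarith)) hv.2.1 hε)
      rw [div_le_one hm0]; exact hm1
    · show (0:E) + (1:ℝ) • y ∈ Ω
      rw [zero_add, one_smul]; exact hinR hy
    · rw [hg, norm_smul, norm_inv, Real.norm_of_nonneg hm0.le, inv_mul_le_iff₀ hm0, mul_one, hm]
      exact (hv.bd hτ (by linarith) hR (hin hy)).1
    · unfold scl
      rw [zero_add, one_smul, abs_mul, abs_of_pos (by positivity), inv_mul_le_iff₀ hm0]
      refine (hv.bd hτ (by linarith) hR (hin hy)).2.trans ?_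
      rw [← hm]
      have := hin hy
      rw [mem_closedBall_zero_iff] at this
      gcongr
  have hgr : ∀ y ∈ closedBall x r0, ‖∇ v y - ∇ v x‖ ≤ η := fun y hy => by
    have := H _ _ _ _ _ hadm y (closedBall_subset_closedBall hr01 hy) x (mem_closedBall_self zero_le_one) hy
    rw [hg, hg, ← smul_sub, norm_smul, norm_inv, Real.norm_of_nonneg hm0.le, inv_mul_le_iff₀ hm0, mul_div_cancel₀ _ hm0.ne'] at this
    exact this
  intro y hy
  exact ⟨hgr y hy, mvt (fun z hz => hv.1.2.1 z (hinR (closedBall_subset_closedBall (by linarith) hz))) hgr hy⟩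
theorem deriv_np (hp : 1 < p) (a b : E) (t : ℝ) : HasDerivAt (fun t : ℝ => ‖a + t • b‖ ^ p / p) (‖a + t • b‖ ^ (p - 2) * ⟪a + t • b, b⟫_ℝ) t := by
  have h1 : HasDerivAt (fun t : ℝ => a + t • b) b t := by simpa using ((hasDerivAt_id t).smul_const b).const_add a
  have h2 := ((hasFDerivAt_norm_rpow (a + t • b) hp).comp_hasDerivAt t h1).div_const p
  refine h2.congr_deriv ?_
  show (p * ‖a + t • b‖ ^ (p - 2)) * ⟪a + t • b, b⟫_ℝ / p = _
  field_simp
theorem np_bd {Q : ℝ} (hp : 1 < p) {a b : E} (h : ‖a‖ ≤ Q) : |‖a‖ ^ (p - 2) * ⟪a, b⟫_ℝ| ≤ Q ^ (p - 1) * ‖b‖ := by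
  rcases eq_or_ne a 0 with rfl | ha
  · rw [inner_zero_left, mul_zero, abs_zero]
    have : 0 ≤ Q := by simpa using h
    positivity
  · have h0 : 0 < ‖a‖ := norm_pos_iff.2 ha
    rw [abs_mul, abs_of_nonneg (by positivity)]
    calc ‖a‖ ^ (p - 2) * |⟪a, b⟫_ℝ| ≤ ‖a‖ ^ (p - 2) * (‖a‖ * ‖b‖) := by gcongr; exact abs_real_inner_le_norm a b
      _ = ‖a‖ ^ (p - 1) * ‖b‖ := by rw [← mul_assoc, ← Real.rpow_add_one h0.ne']; congr 2; ring
      _ ≤ _ := by gcongr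
theorem pharm (hp : 1 < p) (hF : Continuous F) (hτ : 0 ≤ τ) {ε R : ℕ → ℝ} {Ω : ℕ → Set E} (hv : ∀ j, BS p τ F (ε j) (R j) (Ω j) (v j))
    (hε : Filter.Tendsto ε Filter.atTop (nhds 0)) (hε1 : ∀ j, ε j ≤ 1) (hR : Filter.Tendsto R Filter.atTop Filter.atTop) {D : E → E}
    (hD : ∀ x, Filter.Tendsto (fun j => ∇ (v j) x) Filter.atTop (nhds (D x))) (hφ : ContDiff ℝ (⊤ : ℕ∞) φ) (hc : HasCompactSupport φ) :
    ∫ x, ‖D x‖ ^ (p - 2) * ⟪D x, ∇ φ x⟫_ℝ = 0 := by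
  have hp0 : 0 < p := by linarith
  obtain ⟨S, hS1, hS⟩ : ∃ S : ℝ, 1 ≤ S ∧ ∀ x ∉ ball (0:E) S, φ x = 0 := by
    obtain ⟨S, hS⟩ := hc.isCompact.isBounded.subset_ball (0:E)
    refine ⟨max S 1, le_max_right _ _, fun x hx => image_eq_zero_of_notMem_tsupport fun h => hx (ball_subset_ball (le_max_left _ _) (hS h))⟩
  obtain ⟨K, hK⟩ := (hφ.of_le (by exact_mod_cast le_top) : ContDiff ℝ 1 φ).lipschitzWith_of_hasCompactSupport hc one_ne_zero
  have hφd : Differentiable ℝ φ := hφ.differentiable (by simp)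
  have hmD : Measurable D := measurable_of_tendsto_metrizable (fun j => meas_grad (v j)) (tendsto_pi_nhds.2 hD)
  have hRe : ∀ᶠ j in Filter.atTop, S ≤ R j := hR.eventually_ge_atTop S
  have hbd : ∀ᶠ j in Filter.atTop, ∀ x ∈ ball (0:E) S, ‖∇ (v j) x‖ ≤ S ^ τ ∧ |v j x| ≤ S ^ τ * S := by
    filter_upwards [hRe] with j hj x hx
    have h1 := (hv j).bd hτ hS1 hj (ball_subset_closedBall hx)
    rw [mem_ball_zero_iff] at hx
    exact ⟨h1.1, h1.2.trans (by gcongr)⟩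
  have hDb : ∀ x ∈ ball (0:E) S, ‖D x‖ ≤ S ^ τ := fun x hx => le_of_tendsto (hD x).norm (by filter_upwards [hbd] with j hj; exact (hj x hx).1)
  obtain ⟨Kφ, hKφ⟩ : ∃ C, ∀ x, |φ x| ≤ C := by
    obtain ⟨C, hC⟩ := hc.exists_bound_of_continuous hK.continuous
    exact ⟨C, fun x => hC x⟩
  have hlim : ∀ t : ℝ, Filter.Tendsto (fun j => ∫ x in ball (0:E) S, (‖∇ (v j) x + t • ∇ φ x‖ ^ p / p + ε j * F (v j x + t * φ x))) Filter.atTop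
      (nhds (∫ x in ball (0:E) S, ‖D x + t • ∇ φ x‖ ^ p / p)) := by
    intro t
    obtain ⟨CF, hCF⟩ := ((isCompact_Icc (a := -(S ^ τ * S + |t| * Kφ)) (b := S ^ τ * S + |t| * Kφ)).image hF).isBounded.exists_norm_le
    have hFb : ∀ᶠ j in Filter.atTop, ∀ x ∈ ball (0:E) S, |F (v j x + t * φ x)| ≤ CF := by
      filter_upwards [hbd] with j hj x hx
      refine hCF _ ⟨_, ?_, rfl⟩
      refine abs_le.1 ((abs_add_le _ _).trans (add_le_add (hj x hx).2 ?_))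
      rw [abs_mul]; exact mul_le_mul_of_nonneg_left (hKφ x) (abs_nonneg _)
    refine tendsto_integral_filter_of_dominated_convergence (fun _ => (S ^ τ + |t| * K) ^ p / p + CF) ?_ ?_ (integrableOn_const (measure_ball_lt_top.ne)) ?_
    · filter_upwards [hRe] with j hj
      have hsub : ball (0:E) S ⊆ Ω j := (ball_subset_closedBall.trans (closedBall_subset_closedBall hj)).trans (hv j).2.2.1
      refine AEStronglyMeasurable.add ?_ ?_
      · exact ((((meas_grad (v j)).add ((meas_grad φ).const_smul t)).norm.pow_const p).div_const p).aestronglyMeasurable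
      · refine ContinuousOn.aestronglyMeasurable ?_ measurableSet_ball
        have hvc : ContinuousOn (v j) (ball (0:E) S) := fun x hx => ((hv j).1.2.1 x (hsub hx)).continuousAt.continuousWithinAt
        exact continuousOn_const.mul (hF.comp_continuousOn (hvc.add (continuousOn_const.mul hK.continuous.continuousOn)))
    · filter_upwards [hbd, hFb] with j hj hj2
      refine (ae_restrict_iff' measurableSet_ball).2 (Filter.Eventually.of_forall fun x hx => ?_)
      refine (norm_add_le _ _).trans (add_le_add ?_ ?_)
      · rw [Real.norm_of_nonneg (by positivity)]
        gcongr
        refine (norm_add_le _ _).trans (add_le_add (hj x hx).1 ?_)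
        rw [norm_smul, Real.norm_eq_abs]
        exact mul_le_mul_of_nonneg_left (grad_norm_le hK x) (abs_nonneg _)
      · rw [Real.norm_eq_abs, abs_mul, abs_of_nonneg (hv j).2.1]
        exact (mul_le_of_le_one_left (abs_nonneg _) (hε1 j)).trans (hj2 x hx)
    · refine (ae_restrict_iff' measurableSet_ball).2 (Filter.Eventually.of_forall fun x hx => ?_)
      have h1 : Filter.Tendsto (fun j => ‖∇ (v j) x + t • ∇ φ x‖ ^ p / p) Filter.atTop (nhds (‖D x + t • ∇ φ x‖ ^ p / p)) :=
        (((hD x).add_const (t • ∇ φ x)).norm.rpow_const (Or.inr hp0.le)).div_const p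
      have h2 : Filter.Tendsto (fun j => ε j * F (v j x + t * φ x)) Filter.atTop (nhds 0) := by
        rw [tendsto_zero_iff_norm_tendsto_zero]
        refine squeeze_zero' (Filter.Eventually.of_forall fun _ => norm_nonneg _) (g := fun j => ε j * CF) ?_ (by simpa using hε.mul_const CF)
        filter_upwards [hFb] with j hj
        rw [Real.norm_eq_abs, abs_mul, abs_of_nonneg (hv j).2.1]
        exact mul_le_mul_of_nonneg_left (hj x hx) (hv j).2.1
      simpa using h1.add h2
  have hmin : ∀ t : ℝ, ∫ x in ball (0:E) S, ‖D x + (0:ℝ) • ∇ φ x‖ ^ p / p ≤ ∫ x in ball (0:E) S, ‖D x + t • ∇ φ x‖ ^ p / p := by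
    intro t
    refine le_of_tendsto_of_tendsto (hlim 0) (hlim t) ?_
    filter_upwards [hRe] with j hj
    have hsub : closedBall (0:E) S ⊆ Ω j := (closedBall_subset_closedBall hj).trans (hv j).2.2.1
    have hl := lip_u (hv j).1.2.1 hsub (convex_closedBall 0 S) (by positivity) fun x hx => ((hv j).bd hτ hS1 hj hx).1
    have h1 := (hv j).1.2.2.2 0 S (by linarith) hsub (fun x => v j x + t * φ x) (Real.toNNReal (S ^ τ) + Real.toNNReal (|t| * K)) (by
      refine hl.add (LipschitzWith.lipschitzOnWith (LipschitzWith.of_dist_le_mul fun x y => ?_))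
      rw [Real.coe_toNNReal _ (by positivity), Real.dist_eq, ← mul_sub, abs_mul, mul_assoc, ← Real.dist_eq]
      exact mul_le_mul_of_nonneg_left (hK.dist_le_mul x y) (abs_nonneg _)) (fun x hx => by
      show v j x + t * φ x = v j x
      rw [hS x (fun h => by rw [mem_sphere] at hx; rw [mem_ball] at h; linarith), mul_zero, add_zero])
    have e1 : ∫ x in ball (0:E) S, (‖∇ (v j) x + (0:ℝ) • ∇ φ x‖ ^ p / p + ε j * F (v j x + 0 * φ x)) = ∫ x in ball (0:E) S, (‖∇ (v j) x‖ ^ p / p + ε j * F (v j x)) := by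
      simp only [zero_smul, add_zero, zero_mul]
    have e2 : ∫ x in ball (0:E) S, (‖∇ (fun x => v j x + t * φ x) x‖ ^ p / p + ε j * F (v j x + t * φ x)) = ∫ x in ball (0:E) S, (‖∇ (v j) x + t • ∇ φ x‖ ^ p / p + ε j * F (v j x + t * φ x)) := by
      refine setIntegral_congr_fun measurableSet_ball fun x hx => ?_
      show ‖∇ (fun x => v j x + t * φ x) x‖ ^ p / p + _ = _
      rw [grad_add_at ((hv j).1.2.1 x (hsub (ball_subset_closedBall hx))) ((hφd x).const_mul t), grad_smul_at]
    show _ ≤ ∫ x in ball (0:E) S, _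
    rw [e1, ← e2]
    exact h1
  have hm1 : ∀ t : ℝ, Measurable fun x => D x + t • ∇ φ x := fun t => hmD.add ((meas_grad φ).const_smul t)
  have hder : HasDerivAt (fun t : ℝ => ∫ x in ball (0:E) S, ‖D x + t • ∇ φ x‖ ^ p / p) (∫ x in ball (0:E) S, ‖D x + (0:ℝ) • ∇ φ x‖ ^ (p - 2) * ⟪D x + (0:ℝ) • ∇ φ x, ∇ φ x⟫_ℝ) 0 := by
    have i1 : IntegrableOn (fun x => ‖D x + (0:ℝ) • ∇ φ x‖ ^ p / p) (ball (0:E) S) := by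
      refine iB hmD (meas_grad φ) (H := fun z => ‖z.1 + (0:ℝ) • z.2‖ ^ p / p) (C := max (S ^ τ) K) ((Continuous.rpow_const (by fun_prop) fun _ => Or.inr hp0.le).div_const _) ?_
      exact fun x hx => ⟨(hDb x hx).trans (le_max_left _ (K:ℝ)), (grad_norm_le hK x).trans (le_max_right _ _)⟩
    refine (hasDerivAt_integral_of_dominated_loc_of_deriv_le (μ := volume.restrict (ball (0:E) S)) (F := fun t x => ‖D x + t • ∇ φ x‖ ^ p / p)
      (F' := fun t x => ‖D x + t • ∇ φ x‖ ^ (p - 2) * ⟪D x + t • ∇ φ x, ∇ φ x⟫_ℝ) (x₀ := (0:ℝ)) (bound := fun _ => (S ^ τ + K) ^ (p - 1) * K) (ball_mem_nhds (0:ℝ) one_pos) ?_ i1 ?_ ?_ ?_ ?_).2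
    · exact Filter.Eventually.of_forall fun t => (((hm1 t).norm.pow_const p).div_const p).aestronglyMeasurable
    · exact (((hm1 0).norm.pow_const (p - 2)).mul ((hm1 0).inner (meas_grad φ))).aestronglyMeasurable
    · refine (ae_restrict_iff' measurableSet_ball).2 (Filter.Eventually.of_forall fun x hx t ht => ?_)
      rw [mem_ball_zero_iff, Real.norm_eq_abs] at ht
      have h2 : ‖D x + t • ∇ φ x‖ ≤ S ^ τ + K := by
        refine (norm_add_le _ _).trans (add_le_add (hDb x hx) ?_)
        rw [norm_smul, Real.norm_eq_abs]
        exact (mul_le_of_le_one_left (norm_nonneg _) ht.le).trans (grad_norm_le hK x)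
      exact (np_bd hp h2).trans (mul_le_mul_of_nonneg_left (grad_norm_le hK x) (by positivity))
    · exact integrableOn_const (measure_ball_lt_top.ne)
    · exact Filter.Eventually.of_forall fun x t ht => deriv_np hp (D x) (∇ φ x) t
  have h0 := IsLocalMin.hasDerivAt_eq_zero (Filter.Eventually.of_forall hmin) hder
  simp only [zero_smul, add_zero] at h0
  have e3 := set_int_full (Ψ := fun x => ‖D x‖ ^ (p - 2) • D x) hS
  simp only [real_inner_smul_left] at e3
  rw [← e3]; exact h0
theorem ev_bdd {f : ℕ → ℝ} {C : ℝ} (h : ∀ᶠ j in Filter.atTop, f j ≤ C) : ∃ C', ∀ j, f j ≤ C' := by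
  obtain ⟨J, hJ⟩ := Filter.eventually_atTop.1 h
  refine ⟨|C| + ∑ i ∈ Finset.range J, |f i|, fun j => ?_⟩
  have h0 : 0 ≤ ∑ i ∈ Finset.range J, |f i| := Finset.sum_nonneg fun _ _ => abs_nonneg _
  rcases le_or_gt J j with h1 | h1
  · linarith [hJ j h1, le_abs_self C]
  · have := Finset.single_le_sum (f := fun i => |f i|) (fun _ _ => abs_nonneg _) (Finset.mem_range.2 h1)
    linarith [abs_nonneg C, le_abs_self (f j), this]
theorem limit (hp : 1 < p) (hβ : 0 < β) (hβ1 : β ≤ 1) (hτ : 0 ≤ τ) (hF : HF γ β F) {ε R : ℕ → ℝ} {Ω : ℕ → Set E} {y : ℕ → E} (hv : ∀ j, BS p τ F (ε j) (R j) (Ω j) (v j))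
    (hε : Filter.Tendsto ε Filter.atTop (nhds 0)) (hε1 : ∀ j, ε j ≤ 1) (hR : Filter.Tendsto R Filter.atTop Filter.atTop) (hy : ∀ j, y j ∈ closedBall (0:E) 1) (hy1 : ∀ j, ‖∇ (v j) (y j)‖ = 1) :
    ∃ w : E → ℝ, ContDiff ℝ 1 w ∧ (∀ φ : E → ℝ, ContDiff ℝ (⊤ : ℕ∞) φ → HasCompactSupport φ → ∫ x, ‖∇ w x‖ ^ (p - 2) * ⟪∇ w x, ∇ φ x⟫_ℝ = 0) ∧ w 0 = 0 ∧ ∇ w 0 = 0 ∧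
      (∀ S : ℝ, 1 ≤ S → ∀ x ∈ ball (0:E) S, |w x| ≤ S ^ (1 + τ)) ∧ ∃ z, ‖∇ w z‖ = 1 := by
  obtain ⟨y0, _, φ1, hφ1, hy0⟩ := (isCompact_closedBall (0:E) 1).tendsto_subseq hy
  have hRe : ∀ S : ℝ, ∀ᶠ j in Filter.atTop, S ≤ R j := fun S => hR.eventually_ge_atTop S
  have hEq : ∀ x : E, ∀ η : ℝ, 0 < η → ∃ δ : ℝ, 0 < δ ∧ ∀ᶠ j in Filter.atTop, ∀ y, dist y x ≤ δ →
      ‖∇ (v j) y - ∇ (v j) x‖ ≤ η ∧ |v j y - v j x - ⟪∇ (v j) x, y - x⟫_ℝ| ≤ η * ‖y - x‖ := fun x η hη => by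
    obtain ⟨δ, hδ, H⟩ := bs_equi (E := E) hp hβ hβ1 hτ hF x hη
    refine ⟨δ, hδ, ?_⟩
    filter_upwards [hRe (‖x‖ + 2)] with j hj
    exact H _ _ _ _ (hε1 j) hj (hv j)
  have hbd : ∀ x : E, ∀ S : ℝ, 1 ≤ S → ‖x‖ ≤ S → ∀ᶠ j in Filter.atTop, ‖∇ (v j) x‖ ≤ S ^ τ ∧ |v j x| ≤ S ^ τ * ‖x‖ := fun x S hS hx => by
    filter_upwards [hRe S] with j hj
    exact (hv j).bd hτ hS hj (mem_closedBall_zero_iff.2 hx)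
  have ht1 := hφ1.tendsto_atTop
  obtain ⟨φ2, hφ2, g, hg⟩ := aa_sub (F := E × ℝ) (fun j x => (∇ (v (φ1 j)) x, v (φ1 j) x))
    (fun x => ev_bdd (f := fun j => ‖((∇ (v (φ1 j)) x, v (φ1 j) x) : E × ℝ)‖) (C := max ((‖x‖ + 1) ^ τ) ((‖x‖ + 1) ^ τ * ‖x‖)) (by
      filter_upwards [ht1.eventually (hbd x (‖x‖ + 1) (by linarith [norm_nonneg x]) (by linarith))] with j hj
      rw [Prod.norm_def]
      exact max_le_max hj.1 hj.2))
    (fun x η hη => by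
      obtain ⟨δ, hδ, H⟩ := hEq x (min η 1) (lt_min hη one_pos)
      obtain ⟨T, hT⟩ : ∃ T, T = (‖x‖ + 1) ^ τ + 1 := ⟨_, rfl⟩
      have hT0 : 0 < T := by rw [hT]; positivity
      refine ⟨min δ (η / T), by positivity, fun y hy => ?_⟩
      filter_upwards [ht1.eventually H, ht1.eventually (hbd x (‖x‖ + 1) (by linarith [norm_nonneg x]) (by linarith))] with j hj hj2
      have h1 := hj y ((hy.le).trans (min_le_left _ _))
      rw [dist_comm, Prod.dist_eq]
      refine max_le ?_ ?_
      · rw [dist_eq_norm]; exact h1.1.trans (min_le_left _ _)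
      · show dist (v (φ1 j) y) (v (φ1 j) x) ≤ η
        rw [Real.dist_eq]
        have h2 := abs_le.1 (h1.2.trans (mul_le_mul_of_nonneg_right (min_le_right _ _) (norm_nonneg _)))
        have h3 := abs_le.1 ((abs_real_inner_le_norm (∇ (v (φ1 j)) x) (y - x)).trans (mul_le_mul_of_nonneg_right hj2.1 (norm_nonneg _)))
        have h4 : ‖y - x‖ * T ≤ η := by
          rw [← le_div_iff₀ hT0, ← dist_eq_norm]; exact hy.le.trans (min_le_right _ _)
        rw [hT] at h4
        rw [abs_le]; constructor <;> linarith)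
  have ht : Filter.Tendsto (fun j => φ1 (φ2 j)) Filter.atTop Filter.atTop := ht1.comp hφ2.tendsto_atTop
  obtain ⟨k, hk⟩ : ∃ k : ℕ → ℕ, k = fun j => φ1 (φ2 j) := ⟨_, rfl⟩
  rw [← hk] at ht
  have hgD : ∀ x, Filter.Tendsto (fun j => ∇ (v (k j)) x) Filter.atTop (nhds (g x).1) := fun x => by rw [hk]; exact (continuous_fst.tendsto _).comp (hg x)
  have hgw : ∀ x, Filter.Tendsto (fun j => v (k j) x) Filter.atTop (nhds (g x).2) := fun x => by rw [hk]; exact (continuous_snd.tendsto _).comp (hg x)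
  obtain ⟨D, hD⟩ : ∃ D : E → E, D = fun x => (g x).1 := ⟨_, rfl⟩
  obtain ⟨w, hw⟩ : ∃ w : E → ℝ, w = fun x => (g x).2 := ⟨_, rfl⟩
  have hgD' : ∀ x, Filter.Tendsto (fun j => ∇ (v (k j)) x) Filter.atTop (nhds (D x)) := fun x => by rw [hD]; exact hgD x
  have hgw' : ∀ x, Filter.Tendsto (fun j => v (k j) x) Filter.atTop (nhds (w x)) := fun x => by rw [hw]; exact hgw x
  have hEqL : ∀ x : E, ∀ η : ℝ, 0 < η → ∃ δ : ℝ, 0 < δ ∧ ∀ y, dist y x ≤ δ → ‖D y - D x‖ ≤ η ∧ |w y - w x - ⟪D x, y - x⟫_ℝ| ≤ η * ‖y - x‖ := fun x η hη => by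
    obtain ⟨δ, hδ, H⟩ := hEq x η hη
    refine ⟨δ, hδ, fun y hy => ⟨?_, ?_⟩⟩
    · refine le_of_tendsto ((hgD' y).sub (hgD' x)).norm ?_
      filter_upwards [ht.eventually H] with j hj using (hj y hy).1
    · refine le_of_tendsto (((hgw' y).sub (hgw' x)).sub ((hgD' x).inner tendsto_const_nhds)).abs ?_
      filter_upwards [ht.eventually H] with j hj using (hj y hy).2
  have hgrad : ∀ x, HasGradientAt w (D x) x := fun x => by
    rw [hasGradientAt_iff_isLittleO, Asymptotics.isLittleO_iff]
    intro η hη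
    obtain ⟨δ, hδ, H⟩ := hEqL x η hη
    filter_upwards [closedBall_mem_nhds x hδ] with y hy
    rw [Real.norm_eq_abs]
    exact (H y hy).2
  have hDw : ∀ x, ∇ w x = D x := fun x => (hgrad x).gradient
  have hDc : Continuous D := by
    rw [continuous_iff_continuousAt]
    intro x
    rw [Metric.continuousAt_iff']
    intro η hη
    obtain ⟨δ, hδ, H⟩ := hEqL x (η / 2) (by positivity)
    filter_upwards [closedBall_mem_nhds x hδ] with y hy
    rw [dist_eq_norm]
    linarith [(H y hy).1]
  refine ⟨w, ?_, fun φ hφ hc => ?_, ?_, ?_, fun S hS x hx => ?_, y0, ?_⟩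
  · rw [contDiff_one_iff_fderiv]
    refine ⟨fun x => (hgrad x).differentiableAt, ?_⟩
    rw [fd_grad]
    have : (fun x => ∇ w x) = D := funext hDw
    simp only [hDw]
    exact (InnerProductSpace.toDual ℝ E).continuous.comp hDc
  · simp only [hDw]
    exact pharm hp hF.1 hτ (fun j => hv (k j)) (hε.comp ht) (fun j => hε1 _) (hR.comp ht) hgD' hφ hc
  · refine tendsto_nhds_unique (hgw' 0) ?_
    simp only [fun j => (hv (k j)).2.2.2.2.1]; exact tendsto_const_nhds
  · rw [hDw]
    refine tendsto_nhds_unique (hgD' 0) ?_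
    simp only [fun j => (hv (k j)).2.2.2.2.2]; exact tendsto_const_nhds
  · refine le_of_tendsto (hgw' x).abs ?_
    rw [mem_ball_zero_iff] at hx
    filter_upwards [ht.eventually (hbd x S hS hx.le)] with j hj
    rw [add_comm, Real.rpow_add_one (by linarith)]
    exact hj.2.trans (by gcongr)
  · rw [hDw]
    have hyk : Filter.Tendsto (fun j => y (k j)) Filter.atTop (nhds y0) := by rw [hk]; exact hy0.comp hφ2.tendsto_atTop
    have h1 : Filter.Tendsto (fun j => ∇ (v (k j)) (y (k j)) - ∇ (v (k j)) y0) Filter.atTop (nhds 0) := by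
      rw [Metric.tendsto_nhds]
      intro η hη
      obtain ⟨δ, hδ, H⟩ := hEq y0 (η / 2) (by positivity)
      filter_upwards [ht.eventually H, hyk (closedBall_mem_nhds y0 hδ)] with j hj hj2
      rw [dist_zero_right]
      have := (hj (y (k j)) hj2).1
      linarith
    have h2 := (h1.add (hgD' y0)).norm
    simp only [sub_add_cancel, zero_add, hy1] at h2
    exact tendsto_nhds_unique h2 tendsto_const_nhds
theorem blow_one {L0 K : ℝ} (hp : 1 < p) (hγ : 0 < γ) (hγp : γ < p) (hτ : τ = γ / (p - γ)) (hF : HF γ β F) (hL0 : 0 < L0) (hd : 0 < d) (hK : 1 ≤ K)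
       (hu : LMin p F Ω u) (hb : ball z d ⊆ Ω) (hL : ∀ x ∈ closedBall z (d / 2), ‖∇ u x‖ ≤ L0) (hz : u z = 0) (hgz : ∇ u z = 0)
     (hx : x ∈ closedBall z (d / 4)) (hxK : K * dist x z ^ τ < ‖∇ u x‖) :
    ∃ (ε : ℝ) (Ω' : Set E) (v : E → ℝ) (y : E), BS p τ F ε ((d / 4) * (K / L0) ^ (1 / τ)) Ω' v ∧ ε ≤ K ^ (-(p - γ)) ∧ y ∈ closedBall (0:E) 1 ∧ ‖∇ v y‖ = 1 := by
  have hpγ : 0 < p - γ := by linarith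
  have hτ0 : 0 < τ := by rw [hτ]; positivity
  have hK0 : 0 < K := by linarith
  obtain ⟨r, hr⟩ : ∃ r, r = dist x z := ⟨_, rfl⟩
  have hr0 : 0 < r := by
    rw [hr]
    rcases eq_or_ne x z with h | h
    · rw [h, hgz, norm_zero] at hxK
      have : 0 ≤ K * dist z z ^ τ := by positivity
      linarith
    · exact dist_pos.2 h
  have hs4 : closedBall z (d / 4) ⊆ Ω := (closedBall_subset_ball (by linarith)).trans hb
  have hmx : ∀ y : E, 0 < max (dist y z) r := fun y => lt_max_of_lt_right hr0
  obtain ⟨x1, hx1, hmax⟩ := (isCompact_closedBall z (d / 4)).exists_isMaxOn ⟨x, hx⟩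
    (show ContinuousOn (fun y => ‖∇ u y‖ / (max (dist y z) r) ^ τ) (closedBall z (d / 4)) from
      ((hu.2.2.1.mono hs4).norm).div ((Continuous.rpow_const (by fun_prop) fun y => Or.inr hτ0.le).continuousOn) fun y _ => (Real.rpow_pos_of_pos (hmx y) τ).ne')
  obtain ⟨s, hs⟩ : ∃ s, s = max (dist x1 z) r := ⟨_, rfl⟩
  obtain ⟨G, hG⟩ : ∃ G, G = ‖∇ u x1‖ := ⟨_, rfl⟩
  have hs0 : 0 < s := by rw [hs]; exact hmx x1
  have hst : 0 < s ^ τ := Real.rpow_pos_of_pos hs0 τ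
  have hmax' : ∀ y ∈ closedBall z (d / 4), ‖∇ u y‖ ≤ G / s ^ τ * (max (dist y z) r) ^ τ := fun y hy => by
    have h1 : ‖∇ u y‖ / (max (dist y z) r) ^ τ ≤ ‖∇ u x1‖ / (max (dist x1 z) r) ^ τ := hmax hy
    rw [← hs, ← hG] at h1
    rwa [div_le_iff₀ (Real.rpow_pos_of_pos (hmx y) τ)] at h1
  have hKs : K * s ^ τ < G := by
    have h1 := hmax' x hx
    rw [← hr, max_self] at h1
    rw [← hr] at hxK
    have h2 : K < G / s ^ τ := lt_of_mul_lt_mul_right (hxK.trans_le h1) (by positivity)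
    rwa [lt_div_iff₀ hst] at h2
  have hG0 : 0 < G := lt_trans (by positivity) hKs
  have hGL : G ≤ L0 := by rw [hG]; exact hL x1 (closedBall_subset_closedBall (by linarith) hx1)
  have hsR : s * (K / L0) ^ (1 / τ) ≤ 1 := by
    have h1 : s = (s ^ τ) ^ (1 / τ) := by rw [← Real.rpow_mul hs0.le, mul_one_div_cancel hτ0.ne', Real.rpow_one]
    rw [h1, ← Real.mul_rpow hst.le (by positivity)]
    refine Real.rpow_le_one (by positivity) ?_ (by positivity)
    rw [← mul_div_assoc, div_le_one hL0]; linarith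
  obtain ⟨ε, hε⟩ : ∃ ε, ε = (s / (s * G)) ^ p * (s * G) ^ γ := ⟨_, rfl⟩
  have hsG : 0 < s * G := by positivity
  have hsd : s / (s * G) = G⁻¹ := by field_simp
  have hLM : LMin p (fun t => ε * F t) {y | z + s • y ∈ Ω} (scl z s (s * G) u) := by
    have h1 := hu.scale z hs0 hsG
    have h2 : (fun t => (s / (s * G)) ^ p * F ((s * G) * t)) = fun t => ε * F t := by
      funext t; rw [hF.2.1 _ t hsG, hε, mul_assoc]
    rwa [h2] at h1
  have hdz : ∀ y : E, dist (z + s • y) z = s * ‖y‖ := fun y => by rw [dist_eq_norm, add_sub_cancel_left, norm_smul, Real.norm_of_nonneg hs0.le]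
  have hin : ∀ y ∈ closedBall (0:E) ((d / 4) * (K / L0) ^ (1 / τ)), z + s • y ∈ closedBall z (d / 4) := fun y hy => by
    rw [mem_closedBall_zero_iff] at hy
    rw [mem_closedBall, hdz]
    calc s * ‖y‖ ≤ s * ((d / 4) * (K / L0) ^ (1 / τ)) := by gcongr
      _ = (d / 4) * (s * (K / L0) ^ (1 / τ)) := by ring
      _ ≤ (d / 4) * 1 := by gcongr
      _ = d / 4 := mul_one _
  refine ⟨ε, {y | z + s • y ∈ Ω}, scl z s (s * G) u, s⁻¹ • (x1 - z), ⟨hLM, by rw [hε]; positivity, fun y hy => hs4 (hin y hy), fun y hy => ?_, ?_, ?_⟩, ?_, ?_, ?_⟩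
  · rw [norm_grad_scl z hs0 hsG, hsd, inv_mul_le_iff₀ hG0]
    refine (hmax' _ (hin y hy)).trans ?_
    rw [hdz]
    have h1 : max (s * ‖y‖) r ≤ s * max ‖y‖ 1 := by
      refine max_le (by gcongr; exact le_max_left _ _) ?_
      have h2 : r ≤ s := by rw [hs]; exact le_max_right _ _
      exact h2.trans (le_mul_of_one_le_right hs0.le (le_max_right _ _))
    calc G / s ^ τ * (max (s * ‖y‖) r) ^ τ ≤ G / s ^ τ * (s * max ‖y‖ 1) ^ τ := by gcongr
      _ = G * (max ‖y‖ 1) ^ τ := by rw [Real.mul_rpow hs0.le (by positivity)]; field_simp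
  · simp [scl, hz]
  · rw [← norm_eq_zero, norm_grad_scl z hs0 hsG, smul_zero, add_zero, hgz, norm_zero, mul_zero]
  · have e1 : s ^ γ = (s ^ τ) ^ (p - γ) := by rw [← Real.rpow_mul hs0.le, hτ, div_mul_cancel₀ _ hpγ.ne']
    have e2 : ε = (s ^ τ / G) ^ (p - γ) := by
      rw [hε, hsd, Real.mul_rpow hs0.le hG0.le, e1, Real.div_rpow hst.le hG0.le, Real.inv_rpow hG0.le, Real.rpow_sub hG0 p γ]
      field_simp
    rw [e2, Real.rpow_neg hK0.le, ← Real.inv_rpow hK0.le]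
    refine Real.rpow_le_rpow (by positivity) ?_ hpγ.le
    rw [div_le_iff₀ hG0, le_inv_mul_iff₀ hK0]; exact hKs.le
  · rw [mem_closedBall_zero_iff, norm_smul, norm_inv, Real.norm_of_nonneg hs0.le, ← dist_eq_norm, inv_mul_le_iff₀ hs0, mul_one, hs]
    exact le_max_left _ _
  · rw [norm_grad_scl z hs0 hsG, hsd, smul_inv_smul₀ hs0.ne', add_sub_cancel, ← hG, inv_mul_cancel₀ hG0.ne']
theorem growth {M : ℝ} (hp : 1 < p) (hγ : 0 < γ) (hγp : γ < p) (hτ : τ = γ / (p - γ)) (hβ : 0 < β) (hβ1 : β ≤ 1) (hF : HF γ β F) (hM : 0 < M) (hd : 0 < d)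
    (hLi : ∀ v : E → ℝ, ContDiff ℝ 1 v → (∀ φ : E → ℝ, ContDiff ℝ (⊤ : ℕ∞) φ → HasCompactSupport φ → (∫ x, ‖∇ v x‖ ^ (p - 2) * ⟪∇ v x, ∇ φ x⟫_ℝ) = 0) →
      v 0 = 0 → ∇ v 0 = 0 → (∀ R : ℝ, 1 ≤ R → ∀ x ∈ ball (0 : E) R, |v x| ≤ R ^ (1 + τ)) → ∀ x, v x = 0) :
    ∃ C : ℝ, 0 < C ∧ ∀ (Ω : Set E) (u : E → ℝ) (z : E), LMin p F Ω u → ball z d ⊆ Ω → (∀ x ∈ Ω, |u x| ≤ M) → u z = 0 → ∇ u z = 0 →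
      ∀ x ∈ closedBall z (d / 4), ‖∇ u x‖ ≤ C * dist x z ^ τ := by
  have hpγ : 0 < p - γ := by linarith
  have hτ0 : 0 < τ := by rw [hτ]; positivity
  obtain ⟨L0, hL0, HL⟩ := lipest (E := E) hp hγ hγp hβ hβ1 hF hM hd
  by_contra hcon
  push Not at hcon
  have hex : ∀ k : ℕ, ∃ (ε : ℝ) (Ω' : Set E) (v : E → ℝ) (y : E), BS p τ F ε ((d / 4) * (((k:ℝ) + 1) / L0) ^ (1 / τ)) Ω' v ∧ ε ≤ ((k:ℝ) + 1) ^ (-(p - γ)) ∧ y ∈ closedBall (0:E) 1 ∧ ‖∇ v y‖ = 1 := fun k => by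
    obtain ⟨Ω, u, z, hu, hb, hbd, hz, hgz, x, hx, hxK⟩ := hcon ((k:ℝ) + 1) (by positivity)
    exact blow_one hp hγ hγp hτ hF hL0 hd (by have : (0:ℝ) ≤ k := k.cast_nonneg; linarith) hu hb (HL Ω u z hu hb hbd) hz hgz hx hxK
  choose ε Ω v y hBS hε hy hy1 using hex
  have hk : Filter.Tendsto (fun k : ℕ => (k:ℝ) + 1) Filter.atTop Filter.atTop := Filter.tendsto_atTop_add_const_right _ _ tendsto_natCast_atTop_atTop
  obtain ⟨w, hw1, hw2, hw3, hw4, hw5, z, hw6⟩ := limit hp hβ hβ1 hτ0.le hF hBS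
    (squeeze_zero (fun j => (hBS j).2.1) hε ((tendsto_rpow_neg_atTop hpγ).comp hk))
    (fun j => (hε j).trans (Real.rpow_le_one_of_one_le_of_nonpos (by have : (0:ℝ) ≤ j := j.cast_nonneg; linarith) (by linarith)))
    (((tendsto_rpow_atTop (show 0 < 1 / τ by positivity)).comp (hk.atTop_div_const hL0)).const_mul_atTop (by positivity)) hy hy1
  have hw0 : w = fun _ => 0 := funext (hLi w hw1 hw2 hw3 hw4 hw5)
  rw [hw0, gradient_fun_const, norm_zero] at hw6
  exact zero_ne_one hw6
theorem ball_sub (hΩ : IsOpen Ω) (hd : 0 < d) (hz : z ∈ Ω) (h : d ≤ infDist z (frontier Ω)) : ball z d ⊆ Ω := by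
  have hdis : ∀ y ∈ ball z d, y ∉ frontier Ω := fun y hy hf => by
    have := infDist_le_dist_of_mem (x := z) hf
    rw [mem_ball, dist_comm] at hy
    linarith
  refine (convex_ball z d).isPreconnected.subset_left_of_subset_union hΩ isClosed_closure.isOpen_compl
    (disjoint_compl_right.mono_right (compl_subset_compl.2 subset_closure)) (fun y hy => ?_) ⟨z, mem_ball_self hd, hz⟩
  by_contra hn
  rw [mem_union, not_or, mem_compl_iff, not_not] at hn
  exact hdis y hy (by rw [hΩ.frontier_eq]; exact ⟨hn.2, hn.1⟩)
end
end AP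

theorem AP.fb_zero {N : ℕ} {Ω : Set (EuclideanSpace ℝ (Fin N))} (hΩ : IsOpen Ω) {u : EuclideanSpace ℝ (Fin N) → ℝ} (hu : ∀ x ∈ Ω, DifferentiableAt ℝ u x) {z : EuclideanSpace ℝ (Fin N)}
    (hz : z ∈ (frontier {x ∈ Ω | 0 < u x} ∪ frontier {x ∈ Ω | u x < 0}) ∩ Ω) : u z = 0 := by
  obtain ⟨h1, hzΩ⟩ := hz
  have hc : ContinuousOn u Ω := fun x hx => (hu x hx).continuousAt.continuousWithinAt
  have o1 : IsOpen {x ∈ Ω | 0 < u x} := hc.isOpen_inter_preimage hΩ isOpen_Ioi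
  have o2 : IsOpen {x ∈ Ω | u x < 0} := hc.isOpen_inter_preimage hΩ isOpen_Iio
  have d1 : Disjoint {x ∈ Ω | 0 < u x} {x ∈ Ω | u x < 0} := Set.disjoint_left.2 fun x hx hy => lt_asymm hx.2 hy.2
  rw [o1.frontier_eq, o2.frontier_eq] at h1
  by_contra hne
  rcases lt_or_gt_of_ne hne with h | h
  · rcases h1 with h1 | h1
    · exact (d1.closure_left o2).le_bot ⟨h1.1, hzΩ, h⟩
    · exact h1.2 ⟨hzΩ, h⟩
  · rcases h1 with h1 | h1
    · exact h1.2 ⟨hzΩ, h⟩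
    · exact (d1.closure_right o1).le_bot ⟨⟨hzΩ, h⟩, h1.1⟩

/-- Optimal growth of local minimizers near the zero-gradient free boundary `Γ₀(u)`,
conditional on the Liouville property for `p`-harmonic functions with subcritical
growth exponent `1 + τ`, `τ = γ/(p-γ) < 1`. -/
theorem stmt3 (N : ℕ) (hN : 1 ≤ N) (p γ lp lm M d : ℝ)
    (hp : 1 < p) (hγ0 : 0 < γ) (hγp : γ < p) (hlp : 0 < lp) (hlm : 0 < lm)
    (hM : 0 < M) (hd : 0 < d) (hτ : γ / (p - γ) < 1)
    (hLiouville : ∀ v : EuclideanSpace ℝ (Fin N) → ℝ, ContDiff ℝ 1 v →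
      (∀ φ : EuclideanSpace ℝ (Fin N) → ℝ, ContDiff ℝ (⊤ : ℕ∞) φ → HasCompactSupport φ →
        (∫ x, ‖gradient v x‖ ^ (p - 2) * ⟪gradient v x, gradient φ x⟫_ℝ) = 0) →
      v 0 = 0 → gradient v 0 = 0 →
      (∀ R : ℝ, 1 ≤ R → ∀ x ∈ Metric.ball (0 : EuclideanSpace ℝ (Fin N)) R,
        |v x| ≤ R ^ (1 + γ / (p - γ))) →
      ∀ x, v x = 0) :
    ∃ ρ₀ C₂ : ℝ, 0 < ρ₀ ∧ ρ₀ < d ∧ 0 < C₂ ∧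
      ∀ (Ω : Set (EuclideanSpace ℝ (Fin N))), IsOpen Ω → Bornology.IsBounded Ω →
      ∀ u : EuclideanSpace ℝ (Fin N) → ℝ, APLocMin N p (Fgam γ lp lm) Ω u →
        (∀ x ∈ Ω, |u x| ≤ M) →
      ∀ Ω' : Set (EuclideanSpace ℝ (Fin N)), Ω' ⊆ Ω →
        (∀ x ∈ Ω', d ≤ Metric.infDist x (frontier Ω)) →
      ∀ z ∈ apFB0 N Ω u ∩ Ω', ∀ r : ℝ, 0 < r → r < ρ₀ →
        ∀ x ∈ Metric.ball z r, |u x| ≤ C₂ * r ^ (1 + γ / (p - γ)) := by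
  obtain ⟨n, rfl⟩ : ∃ n, N = n + 1 := ⟨N - 1, by omega⟩
  obtain ⟨C, hC, H⟩ := AP.growth (E := EuclideanSpace ℝ (Fin (n + 1))) (d := d) hp hγ0 hγp rfl (lt_min hγ0 one_pos) (min_le_right γ 1) (AP.HF_F hγ0 hlp hlm) hM hd hLiouville
  refine ⟨d / 4, C, by linarith, by linarith, hC, fun Ω hΩ _ u hu hbd Ω' hΩ' hdist z hz r hr hrd x hx => ?_⟩
  have hzΩ : z ∈ Ω := hz.1.1.2
  have hb := AP.ball_sub hΩ hd hzΩ (hdist z hz.2)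
  have hL : AP.LMin p (fun t => lp * (max t 0) ^ γ + lm * (max (-t) 0) ^ γ) Ω u := by
    refine ⟨hΩ, hu.1, hu.2.1, fun z r hr hs v K hv he => ?_⟩
    rw [← closure_ball z hr.ne'] at hs hv
    exact hu.2.2.2 z r hr hs v K hv he
  have hz0 : u z = 0 := AP.fb_zero hΩ hu.1 hz.1.1
  have hτ0 : 0 < γ / (p - γ) := div_pos hγ0 (by linarith)
  have h1 := H Ω u z hL hb hbd hz0 hz.1.2
  have h2 : ∀ y ∈ ball z r, ‖gradient u y‖ ≤ C * r ^ (γ / (p - γ)) := fun y hy => by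
    refine (h1 y (ball_subset_closedBall (ball_subset_ball hrd.le hy))).trans ?_
    gcongr
    exact (mem_ball.1 hy).le
  have h3 := (AP.lip_u hu.1 ((ball_subset_ball (by linarith)).trans hb) (convex_ball z r) (by positivity) h2).dist_le_mul x hx z (mem_ball_self hr)
  rw [Real.coe_toNNReal _ (by positivity), hz0, Real.dist_eq, sub_zero] at h3
  refine h3.trans ?_
  rw [Real.rpow_add hr, Real.rpow_one, mul_assoc, mul_comm r]
  gcongr
  exact (mem_ball.1 hx).le
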